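/- arXiv:1812.01092 — 3 statements merged into one kernel-verified Lean document; each statement's English description precedes it below -/
import Mathlib

section
/- Let X = (X_1,…,X_n) be a random vector with independent components taking values in a product space 𝒴 = 𝒳_1 × ⋯ × 𝒳_n, let f : 𝒴 → ℝ be measurable with f(X) ∈ L^∞(ℙ), let d ∈ ℕ and set C := 217 d². Then for all t ≥ 0, ℙ(|f(X) − 𝔼f(X)| ≥ t) ≤ 2 exp( −(1/C) · min( min_{k=1,…,d−1} ( t / ‖𝔥^{(k)} f‖_{op,1} )^{2/k} , ( t / ‖𝔥^{(d)} f‖_{op,∞} )^{2/d} ) ). -/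
open MeasureTheory Finset Real Filter

noncomputable section

/-- Operator norm of a `k`-tensor indexed by tuples in `[n]^k`. -/
def tOp {n k : ℕ} (A : (Fin k → Fin n) → ℝ) : ℝ :=
  ⨆ v : {v : Fin k → Fin n → ℝ // ∀ j, ∑ i, (v j i) ^ 2 ≤ 1},
    ∑ idx : Fin k → Fin n, (∏ j, v.1 j (idx j)) * A idx

/-- `k`-th order difference `𝔥_{i_1 … i_k} f` (L^∞ taken as sup over the involved coordinates). -/
def hOrd {n : ℕ} {𝒳 : Fin n → Type*} (f : (∀ i, 𝒳 i) → ℝ) (k : ℕ)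
    (idx : Fin k → Fin n) (x : ∀ i, 𝒳 i) : ℝ :=
  ⨆ y : (∀ i, 𝒳 i) × (∀ i, 𝒳 i),
    |∑ S ∈ (Finset.univ : Finset (Fin k)).powerset, (-1 : ℝ) ^ S.card *
      f (fun i => if i ∈ Finset.image idx S then y.2 i
                  else if i ∈ Finset.image idx Finset.univ then y.1 i else x i)|

/-- The `k`-tensor `𝔥^{(k)} f`. -/
def hT {n : ℕ} {𝒳 : Fin n → Type*} (f : (∀ i, 𝒳 i) → ℝ) (k : ℕ)
    (idx : Fin k → Fin n) (x : ∀ i, 𝒳 i) : ℝ :=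
  if Function.Injective idx then hOrd f k idx x else 0

/-- First order difference `𝔥_i f` (sup over both replaced coordinates). -/
def hI {n : ℕ} {𝒳 : Fin n → Type*} (f : (∀ i, 𝒳 i) → ℝ) (i : Fin n) (x : ∀ j, 𝒳 j) : ℝ :=
  ⨆ y : 𝒳 i × 𝒳 i, |f (Function.update x i y.1) - f (Function.update x i y.2)|

/-- `𝔥⁺_i f`. -/
def hPlusI {n : ℕ} {𝒳 : Fin n → Type*} (f : (∀ i, 𝒳 i) → ℝ) (i : Fin n) (x : ∀ j, 𝒳 j) : ℝ :=
  ⨆ y : 𝒳 i, max (f x - f (Function.update x i y)) 0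

/-- `𝔥⁻_i f`. -/
def hMinusI {n : ℕ} {𝒳 : Fin n → Type*} (f : (∀ i, 𝒳 i) → ℝ) (i : Fin n) (x : ∀ j, 𝒳 j) : ℝ :=
  ⨆ y : 𝒳 i, max (f (Function.update x i y) - f x) 0

/-- `L^p(μ)` norm. -/
def lpN {α : Type*} [MeasurableSpace α] (μ : Measure α) (p : ℝ) (g : α → ℝ) : ℝ :=
  (∫ x, |g x| ^ p ∂μ) ^ (1 / p)

/-- Entropy functional `Ent_μ(g)`. -/
def ent {α : Type*} [MeasurableSpace α] (μ : Measure α) (g : α → ℝ) : ℝ :=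
  ∫ x, g x * Real.log (g x) ∂μ - (∫ x, g x ∂μ) * Real.log (∫ x, g x ∂μ)

/-- Variance with respect to a measure. -/
def cVar {β : Type*} [MeasurableSpace β] (ν : Measure β) (g : β → ℝ) : ℝ :=
  ∫ y, (g y - ∫ y', g y' ∂ν) ^ 2 ∂ν

/-- `ν i x` is the conditional distribution of the `i`-th coordinate given the others. -/
def IsCondKernel {n : ℕ} {𝒳 : Fin n → Type*} [∀ i, MeasurableSpace (𝒳 i)]
    (μ : Measure (∀ i, 𝒳 i)) (ν : ∀ i, (∀ j, 𝒳 j) → Measure (𝒳 i)) : Prop :=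
  (∀ i x, IsProbabilityMeasure (ν i x)) ∧
  (∀ i x x', (∀ j, j ≠ i → x j = x' j) → ν i x = ν i x') ∧
  (∀ i (g : (∀ j, 𝒳 j) → ℝ), Measurable g → (∃ M, ∀ x, |g x| ≤ M) →
    ∫ x, ∫ y, g (Function.update x i y) ∂(ν i x) ∂μ = ∫ x, g x ∂μ)

/-- `|𝔡 f|²`. -/
def dSq {n : ℕ} {𝒳 : Fin n → Type*} [∀ i, MeasurableSpace (𝒳 i)]
    (ν : ∀ i, (∀ j, 𝒳 j) → Measure (𝒳 i)) (f : (∀ i, 𝒳 i) → ℝ) (x : ∀ i, 𝒳 i) : ℝ :=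
  ∑ i, cVar (ν i x) (fun y => f (Function.update x i y))

/-- The `𝔡`-logarithmic Sobolev inequality with constant `σ2`. -/
def DLSI {n : ℕ} {𝒳 : Fin n → Type*} [∀ i, MeasurableSpace (𝒳 i)]
    (μ : Measure (∀ i, 𝒳 i)) (ν : ∀ i, (∀ j, 𝒳 j) → Measure (𝒳 i)) (σ2 : ℝ) : Prop :=
  IsCondKernel μ ν ∧
  ∀ f : (∀ i, 𝒳 i) → ℝ, Measurable f → (∃ M, ∀ x, |f x| ≤ M) →
    ent μ (fun x => f x ^ 2) ≤ 2 * σ2 * ∫ x, dSq ν f x ∂μ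

end

/-! ### Random interpolation between two points, subset by subset -/

/-- The probability that a uniformly random ordering of `n` items lists exactly the elements of a
given `s`-element set before a given further item. -/
noncomputable def shapleyWeight (n s : ℕ) : ℝ :=
  (s.factorial : ℝ) * (n - 1 - s).factorial / n.factorial

lemma shapleyWeight_nonneg (n s : ℕ) : 0 ≤ shapleyWeight n s := by
  unfold shapleyWeight; positivity

lemma choose_mul_shapleyWeight {n s : ℕ} (h : s < n) :
    (n.choose s : ℝ) * shapleyWeight n s = 1 / ((n : ℝ) - s) := by
  obtain ⟨j, rfl⟩ : ∃ j, n = s + (j + 1) := ⟨n - s - 1, by omega⟩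
  have e : s + (j + 1) - 1 - s = j := by omega
  rw [shapleyWeight, e, Nat.cast_choose ℝ (by omega), Nat.add_sub_cancel_left]
  push_cast [Nat.factorial_succ]
  field_simp
  ring

lemma choose_pred_mul_shapleyWeight {n s : ℕ} (h : s < n) :
    ((n - 1).choose s : ℝ) * shapleyWeight n s = 1 / n := by
  obtain ⟨j, rfl⟩ : ∃ j, n = s + j + 1 := ⟨n - s - 1, by omega⟩
  have e : s + j + 1 - 1 - s = j := by omega
  rw [shapleyWeight, e, Nat.add_sub_cancel, Nat.cast_choose ℝ (by omega), Nat.add_sub_cancel_left]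
  push_cast [Nat.factorial_succ]
  field_simp

lemma sum_shapleyWeight_mul_sub {n : ℕ} (a : Finset (Fin n) → ℝ) :
    ∑ S : Finset (Fin n), ∑ i ∈ Sᶜ, shapleyWeight n #S * (a S - a (insert i S)) =
      a ∅ - a univ := by
  have h2 : ∑ S : Finset (Fin n), ∑ i ∈ Sᶜ, shapleyWeight n #S * a (insert i S) =
      ∑ S : Finset (Fin n), ∑ i ∈ S, shapleyWeight n (#S - 1) * a S := by
    rw [Finset.sum_sigma', Finset.sum_sigma']
    refine Finset.sum_bij' (fun p _ => ⟨insert p.2 p.1, p.2⟩) (fun p _ => ⟨p.1.erase p.2, p.2⟩)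
      ?_ ?_ ?_ ?_ ?_
    · rintro ⟨S, i⟩ h; simp
    · rintro ⟨S, i⟩ h; simp
    · rintro ⟨S, i⟩ h
      have : i ∉ S := by simpa using h
      simp [Finset.erase_insert this]
    · rintro ⟨S, i⟩ h
      have : i ∈ S := by simp at h; exact h
      simp [Finset.insert_erase this]
    · rintro ⟨S, i⟩ h
      have : i ∉ S := by simpa using h
      simp [Finset.card_insert_of_notMem this]
  simp_rw [mul_sub, Finset.sum_sub_distrib]
  rw [h2, ← Finset.sum_sub_distrib]
  simp_rw [Finset.sum_const, nsmul_eq_mul]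
  have key : ∀ S : Finset (Fin n), (#Sᶜ : ℝ) * (shapleyWeight n #S * a S) -
      #S * (shapleyWeight n (#S - 1) * a S) =
      (if S = ∅ then a S else 0) - (if S = univ then a S else 0) := by
    intro S
    have hS : #S + #Sᶜ = n := by simp
    have hE : S = ∅ ↔ #S = 0 := Finset.card_eq_zero.symm
    have hU : S = univ ↔ #Sᶜ = 0 := by rw [Finset.card_eq_zero, Finset.compl_eq_empty_iff]
    simp only [hE, hU]
    generalize #S = s at *
    generalize #Sᶜ = r at *
    subst hS
    unfold shapleyWeight
    rcases s with _ | s <;> rcases r with _ | r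
    · simp
    · simp [Nat.factorial_succ]
      field_simp
    · simp [Nat.factorial_succ]
      field_simp
    · have e1 : s + 1 + (r + 1) - 1 - (s + 1) = r := by omega
      have e2 : s + 1 + (r + 1) - 1 - (s + 1 - 1) = r + 1 := by omega
      rw [e1, e2]
      simp [Nat.factorial_succ]
      field_simp
      ring
  simp_rw [key, Finset.sum_sub_distrib]
  simp

lemma sum_inv_sqrt_le (n : ℕ) : ∑ j ∈ range n, 1 / √((j : ℝ) + 1) ≤ 2 * √n := by
  induction n with
  | zero => simp
  | succ n ih =>
    rw [Finset.sum_range_succ]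
    have h0 : 0 ≤ √(n : ℝ) := Real.sqrt_nonneg _
    have h1 : 0 < √((n : ℝ) + 1) := Real.sqrt_pos.2 (by positivity)
    have e0 : √(n : ℝ) ^ 2 = n := Real.sq_sqrt (by positivity)
    have e1 : √((n : ℝ) + 1) ^ 2 = n + 1 := Real.sq_sqrt (by positivity)
    have : 1 / √((n : ℝ) + 1) ≤ 2 * √((n : ℝ) + 1) - 2 * √n := by
      rw [div_le_iff₀ h1]
      nlinarith [sq_nonneg (√((n : ℝ) + 1) - √n)]
    push_cast
    linarith

lemma sum_inv_sqrt_reflect_le (n : ℕ) : ∑ s ∈ range n, 1 / (√n * √((n : ℝ) - s)) ≤ 2 := by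
  rcases Nat.eq_zero_or_pos n with rfl | hn
  · simp
  have hpos : 0 < √(n : ℝ) := Real.sqrt_pos.2 (by positivity)
  have : ∑ s ∈ range n, 1 / (√n * √((n : ℝ) - s)) =
      (∑ j ∈ range n, 1 / √((j : ℝ) + 1)) / √n := by
    rw [← Finset.sum_range_reflect, Finset.sum_div]
    refine Finset.sum_congr rfl fun j hj => ?_
    have hj' : j < n := Finset.mem_range.1 hj
    have : (n : ℝ) - ((n - 1 - j : ℕ) : ℝ) = j + 1 := by
      rw [Nat.cast_sub (by omega), Nat.cast_sub (by omega)]; push_cast; ring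
    rw [this, div_div, mul_comm]
  rw [this, div_le_iff₀ hpos]
  exact sum_inv_sqrt_le n

/-- The tilt balancing the two halves of the Cauchy–Schwarz estimate. -/
noncomputable def tilt (n s : ℕ) : ℝ := √((n : ℝ) - s) / √n

lemma sum_shapleyWeight_mul_tilt_le (n : ℕ) :
    ∑ S : Finset (Fin n), shapleyWeight n #S * tilt n #S ≤ 2 := by
  have := Finset.sum_powerset_apply_card (fun s => shapleyWeight n s * tilt n s)
    (x := (univ : Finset (Fin n)))
  rw [Finset.powerset_univ, Finset.card_univ, Fintype.card_fin, Finset.sum_range_succ] at this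
  have hn : tilt n n = 0 := by simp [tilt]
  rw [this, hn]
  simp only [mul_zero, smul_zero, add_zero, nsmul_eq_mul]
  refine le_trans (Finset.sum_le_sum fun s hs => ?_) (sum_inv_sqrt_reflect_le n)
  have hs : s < n := Finset.mem_range.1 hs
  have hpos : (0 : ℝ) < n - s := by rw [sub_pos]; exact_mod_cast hs
  have hsq := Real.sqrt_pos.2 hpos
  rw [← mul_assoc, choose_mul_shapleyWeight hs, tilt]
  nth_rewrite 1 [← Real.sq_sqrt hpos.le]
  apply le_of_eq
  field_simp

lemma sum_shapleyWeight_div_tilt_le {n : ℕ} (i : Fin n) :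
    ∑ S ∈ (univ.erase i).powerset, shapleyWeight n #S / tilt n #S ≤ 2 := by
  have hn : 0 < n := i.pos
  rw [Finset.sum_powerset_apply_card (fun s => shapleyWeight n s / tilt n s),
    Finset.card_erase_of_mem (Finset.mem_univ i), Finset.card_univ, Fintype.card_fin,
    Nat.sub_add_cancel hn]
  simp only [nsmul_eq_mul]
  refine le_trans (Finset.sum_le_sum fun s hs => ?_) (sum_inv_sqrt_reflect_le n)
  have hs : s < n := Finset.mem_range.1 hs
  have hpos : (0 : ℝ) < n - s := by rw [sub_pos]; exact_mod_cast hs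
  have hsq := Real.sqrt_pos.2 hpos
  have hn' : (0 : ℝ) < n := by exact_mod_cast hn
  have hsn := Real.sqrt_pos.2 hn'
  rw [← mul_div_assoc, choose_pred_mul_shapleyWeight hs, tilt]
  nth_rewrite 1 [← Real.sq_sqrt hn'.le]
  apply le_of_eq
  field_simp

/-- Cauchy–Schwarz over the random interpolation. -/
lemma sum_shapleyWeight_mul_mul_le {n : ℕ} (a : Finset (Fin n) → Fin n → ℝ) (b : Fin n → ℝ)
    (A : Finset (Fin n) → ℝ) (B : ℝ) (hA : ∀ S, ∑ i, a S i ^ 2 ≤ A S) (hB : ∑ i, b i ^ 2 ≤ B) :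
    ∑ S : Finset (Fin n), ∑ i ∈ Sᶜ, shapleyWeight n #S * (a S i * b i) ≤
      (∑ S, shapleyWeight n #S * tilt n #S * A S) / 2 + B := by
  have h1 : ∀ S : Finset (Fin n), ∀ i ∈ Sᶜ, shapleyWeight n #S * (a S i * b i) ≤
      shapleyWeight n #S * tilt n #S * a S i ^ 2 / 2 +
        shapleyWeight n #S / tilt n #S * b i ^ 2 / 2 := by
    intro S i hi
    have hs : #S < n := by
      have := Finset.card_add_card_compl S
      have := Finset.card_pos.2 ⟨i, hi⟩
      simp only [Fintype.card_fin] at *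
      omega
    have ht : 0 < tilt n #S := by
      have hpos : (0 : ℝ) < n - #S := by rw [sub_pos]; exact_mod_cast hs
      have hn : (0 : ℝ) < n := by exact_mod_cast i.pos
      unfold tilt; positivity
    have hw := shapleyWeight_nonneg n #S
    generalize tilt n #S = e at *
    have : a S i * b i ≤ (e * a S i ^ 2 + b i ^ 2 / e) / 2 := by
      have : e * a S i ^ 2 + b i ^ 2 / e - 2 * (a S i * b i) = (e * a S i - b i) ^ 2 / e := by
        field_simp; ring
      have : 0 ≤ (e * a S i - b i) ^ 2 / e := by positivity
      linarith
    calc _ ≤ shapleyWeight n #S * ((e * a S i ^ 2 + b i ^ 2 / e) / 2) := by gcongr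
      _ = _ := by ring
  refine le_trans (Finset.sum_le_sum fun S _ => Finset.sum_le_sum (h1 S)) ?_
  simp_rw [Finset.sum_add_distrib]
  refine add_le_add ?_ ?_
  · rw [Finset.sum_div]
    refine Finset.sum_le_sum fun S _ => ?_
    rw [← Finset.sum_div, ← Finset.mul_sum]
    have h0 : 0 ≤ shapleyWeight n #S * tilt n #S :=
      mul_nonneg (shapleyWeight_nonneg _ _) (by unfold tilt; positivity)
    have : ∑ i ∈ Sᶜ, a S i ^ 2 ≤ A S :=
      (Finset.sum_le_univ_sum_of_nonneg fun i => sq_nonneg _).trans (hA S)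
    gcongr
  · have hswap : ∑ S : Finset (Fin n), ∑ i ∈ Sᶜ, shapleyWeight n #S / tilt n #S * b i ^ 2 / 2 =
        ∑ i, ∑ S ∈ (univ.erase i).powerset, shapleyWeight n #S / tilt n #S * b i ^ 2 / 2 := by
      refine Finset.sum_comm' fun S i => ?_
      simp [Finset.subset_erase]
    rw [hswap]
    refine le_trans (Finset.sum_le_sum fun i _ => ?_) hB
    rw [← Finset.sum_div, ← Finset.sum_mul]
    have := sum_shapleyWeight_div_tilt_le i
    nlinarith [sq_nonneg (b i)]

/-! ### Bounded almost everywhere measurable functions -/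

/-- Bounded and almost everywhere strongly measurable. -/
def BddAESM {α : Type*} [MeasurableSpace α] (P : Measure α) (g : α → ℝ) : Prop :=
  AEStronglyMeasurable g P ∧ ∃ C, ∀ x, |g x| ≤ C

namespace BddAESM

variable {α β : Type*} [MeasurableSpace α] [MeasurableSpace β] {P : Measure α} {Q : Measure β}
  {g h : α → ℝ}

lemma integrable [IsFiniteMeasure P] (hg : BddAESM P g) : Integrable g P := by
  obtain ⟨hm, C, hC⟩ := hg
  exact Integrable.of_bound hm C (ae_of_all _ hC)

lemma const (c : ℝ) : BddAESM P (fun _ => c) := ⟨aestronglyMeasurable_const, |c|, fun _ => le_rfl⟩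

lemma add (hg : BddAESM P g) (hh : BddAESM P h) : BddAESM P (fun x => g x + h x) := by
  obtain ⟨hm, C, hC⟩ := hg
  obtain ⟨hm', C', hC'⟩ := hh
  exact ⟨hm.add hm', C + C', fun x => (abs_add_le _ _).trans (add_le_add (hC x) (hC' x))⟩

lemma mul (hg : BddAESM P g) (hh : BddAESM P h) : BddAESM P (fun x => g x * h x) := by
  obtain ⟨hm, C, hC⟩ := hg
  obtain ⟨hm', C', hC'⟩ := hh
  refine ⟨hm.mul hm', C * C', fun x => ?_⟩
  rw [abs_mul]
  exact mul_le_mul (hC x) (hC' x) (abs_nonneg _) ((abs_nonneg _).trans (hC x))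

lemma const_mul (hg : BddAESM P g) (c : ℝ) : BddAESM P (fun x => c * g x) := (const c).mul hg

lemma neg (hg : BddAESM P g) : BddAESM P (fun x => -g x) := by
  simpa using hg.const_mul (-1)

lemma sub (hg : BddAESM P g) (hh : BddAESM P h) : BddAESM P (fun x => g x - h x) := by
  simpa [sub_eq_add_neg] using hg.add hh.neg

lemma pow (hg : BddAESM P g) (k : ℕ) : BddAESM P (fun x => g x ^ k) := by
  induction k with
  | zero => simpa using const 1
  | succ k ih => simpa [pow_succ] using ih.mul hg

lemma posPart (hg : BddAESM P g) : BddAESM P (fun x => max (g x) 0) := by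
  obtain ⟨hm, C, hC⟩ := hg
  refine ⟨hm.sup aestronglyMeasurable_const, C, fun x => ?_⟩
  rw [abs_of_nonneg (le_max_right _ _)]
  exact max_le ((le_abs_self _).trans (hC x)) ((abs_nonneg _).trans (hC x))

lemma sum {ι : Type*} (s : Finset ι) {G : ι → α → ℝ} (hG : ∀ i, BddAESM P (G i)) :
    BddAESM P (fun x => ∑ i ∈ s, G i x) := by
  classical
  induction s using Finset.induction_on with
  | empty => simpa using const 0
  | insert a s ha ih => simpa [Finset.sum_insert ha] using (hG a).add ih

lemma comp {g : β → ℝ} (hg : BddAESM Q g) {τ : α → β} (hτ : MeasurePreserving τ P Q) :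
    BddAESM P (fun x => g (τ x)) := by
  obtain ⟨hm, C, hC⟩ := hg
  exact ⟨hm.comp_measurePreserving hτ, C, fun x => hC _⟩

lemma integral_comp {g : β → ℝ} (hg : BddAESM Q g) {τ : α → β} (hτ : MeasurePreserving τ P Q) :
    ∫ x, g (τ x) ∂P = ∫ y, g y ∂Q := by
  rw [← hτ.map_eq, integral_map hτ.aemeasurable (by rw [hτ.map_eq]; exact hg.1)]

end BddAESM

/-! ### Swapping coordinates of two independent copies -/

section Swap

variable {n : ℕ} {𝒳 : Fin n → Type*}

/-- The point whose coordinates in `S` come from `p.2` and whose other coordinates come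
from `p.1`. -/
def mix (S : Finset (Fin n)) (p : (∀ i, 𝒳 i) × (∀ i, 𝒳 i)) : ∀ i, 𝒳 i :=
  fun i => if i ∈ S then p.2 i else p.1 i

/-- Exchange of the coordinates in `S` between the two points. -/
def swapOn (S : Finset (Fin n)) (p : (∀ i, 𝒳 i) × (∀ i, 𝒳 i)) : (∀ i, 𝒳 i) × (∀ i, 𝒳 i) :=
  (mix S p, mix S p.swap)

lemma mix_empty (p : (∀ i, 𝒳 i) × (∀ i, 𝒳 i)) : mix ∅ p = p.1 := by
  ext i; simp [mix]

lemma mix_univ (p : (∀ i, 𝒳 i) × (∀ i, 𝒳 i)) : mix univ p = p.2 := by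
  ext i; simp [mix]

lemma mix_insert (S : Finset (Fin n)) (i : Fin n) (p : (∀ i, 𝒳 i) × (∀ i, 𝒳 i)) :
    mix (insert i S) p = Function.update (mix S p) i (p.2 i) := by
  ext j
  by_cases h : j = i
  · subst h; simp [mix]
  · simp [mix, h]

lemma mix_swapOn {S : Finset (Fin n)} {i : Fin n} (hi : i ∉ S) (p : (∀ i, 𝒳 i) × (∀ i, 𝒳 i)) :
    mix S (swapOn {i} p) = mix (insert i S) p := by
  ext j
  by_cases h : j = i
  · subst h; simp [mix, swapOn, hi]
  · simp [mix, swapOn, h]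

lemma mix_insert_swapOn {S : Finset (Fin n)} {i : Fin n} (hi : i ∉ S)
    (p : (∀ i, 𝒳 i) × (∀ i, 𝒳 i)) : mix (insert i S) (swapOn {i} p) = mix S p := by
  ext j
  by_cases h : j = i
  · subst h; simp [mix, swapOn, hi]
  · simp [mix, swapOn, h]

variable [∀ i, MeasurableSpace (𝒳 i)] (μi : ∀ i, Measure (𝒳 i)) [∀ i, IsProbabilityMeasure (μi i)]

lemma measurable_mix (S : Finset (Fin n)) : Measurable (mix (𝒳 := 𝒳) S) := by
  refine measurable_pi_lambda _ fun i => ?_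
  unfold mix
  split_ifs <;> fun_prop

lemma measurePreserving_swapOn (S : Finset (Fin n)) :
    MeasurePreserving (swapOn (𝒳 := 𝒳) S) ((Measure.pi μi).prod (Measure.pi μi))
      ((Measure.pi μi).prod (Measure.pi μi)) where
  measurable := (measurable_mix S).prodMk ((measurable_mix S).comp measurable_swap)
  map_eq := by
    have hm : Measurable (swapOn (𝒳 := 𝒳) S) :=
      (measurable_mix S).prodMk ((measurable_mix S).comp measurable_swap)
    symm
    refine Measure.prod_eq_generateFrom generateFrom_pi generateFrom_pi isPiSystem_pi isPiSystem_pi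
      (Measure.FiniteSpanningSetsIn.pi fun i => (μi i).toFiniteSpanningSetsIn)
      (Measure.FiniteSpanningSetsIn.pi fun i => (μi i).toFiniteSpanningSetsIn) ?_
    rintro _ ⟨s, hs, rfl⟩ _ ⟨t, ht, rfl⟩
    have hs' : ∀ i, MeasurableSet (s i) := fun i => hs i (Set.mem_univ i)
    have ht' : ∀ i, MeasurableSet (t i) := fun i => ht i (Set.mem_univ i)
    rw [Measure.map_apply hm ((MeasurableSet.univ_pi hs').prod (MeasurableSet.univ_pi ht'))]
    have : swapOn S ⁻¹' (Set.univ.pi s ×ˢ Set.univ.pi t) =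
        (Set.univ.pi fun i => if i ∈ S then t i else s i) ×ˢ
          (Set.univ.pi fun i => if i ∈ S then s i else t i) := by
      ext p
      simp only [swapOn, mix, Set.mem_preimage, Set.mem_prod, Set.mem_pi, Set.mem_univ,
        forall_true_left, ← forall_and]
      refine forall_congr' fun i => ?_
      by_cases h : i ∈ S <;> simp [h, and_comm]
    rw [this, Measure.prod_prod, Measure.pi_pi, Measure.pi_pi, Measure.pi_pi, Measure.pi_pi,
      ← Finset.prod_mul_distrib, ← Finset.prod_mul_distrib]
    refine Finset.prod_congr rfl fun i _ => ?_
    by_cases h : i ∈ S <;> simp [h, mul_comm]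

lemma measurePreserving_mix (S : Finset (Fin n)) :
    MeasurePreserving (mix (𝒳 := 𝒳) S) ((Measure.pi μi).prod (Measure.pi μi)) (Measure.pi μi) :=
  (measurePreserving_fst (μ := Measure.pi μi) (ν := Measure.pi μi)).comp
    (measurePreserving_swapOn μi S)

end Swap

/-! ### One-sided moment estimate -/

lemma mul_pow_pred_mul_le {a c : ℝ} (ha : 0 ≤ a) (hc : 0 ≤ c) (r : ℕ) :
    ((r : ℝ) + 1) * (a ^ r * c) ≤ r * a ^ (r + 1) + c ^ (r + 1) := by
  rcases ha.eq_or_lt with rfl | ha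
  · rcases r with _ | r
    · simp
    · simp; positivity
  · have h := one_add_mul_le_pow (a := c / a - 1) (by linarith [div_nonneg hc ha.le]) (r + 1)
    have e : c ^ (r + 1) = a ^ (r + 1) * (1 + (c / a - 1)) ^ (r + 1) := by
      rw [← mul_pow]; congr 1; field_simp; ring
    rw [e]
    have h2 := mul_le_mul_of_nonneg_left h (pow_pos ha (r + 1)).le
    have e2 : a ^ (r + 1) * (1 + ((r + 1 : ℕ) : ℝ) * (c / a - 1)) =
        ((r : ℝ) + 1) * (a ^ r * c) - r * a ^ (r + 1) := by
      push_cast; field_simp; ring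
    linarith

lemma posPart_pow_sub_le (a b : ℝ) (r : ℕ) :
    max (max a 0 ^ (r + 1) - max b 0 ^ (r + 1)) 0 ≤
      ((r : ℝ) + 1) * max a 0 ^ r * max (a - b) 0 := by
  have ha : 0 ≤ max a 0 := le_max_right _ _
  have hb : 0 ≤ max b 0 := le_max_right _ _
  have hsub : max a 0 - max b 0 ≤ max (a - b) 0 := by
    rcases le_total a 0 with h | h <;> rcases le_total b 0 with h' | h' <;>
      rcases le_total (a - b) 0 with h'' | h'' <;> simp [h, h', h''] <;> linarith
  have hpos : (0 : ℝ) ≤ ((r : ℝ) + 1) * max a 0 ^ r := by positivity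
  refine max_le ?_ (mul_nonneg hpos (le_max_right _ _))
  have h1 := mul_pow_pred_mul_le ha hb r
  have h2 := mul_le_mul_of_nonneg_left hsub hpos
  have e : ((r : ℝ) + 1) * max a 0 ^ r * (max a 0 - max b 0) =
    ((r : ℝ) + 1) * max a 0 ^ (r + 1) - ((r : ℝ) + 1) * (max a 0 ^ r * max b 0) := by ring
  linarith

section Moment

variable {n : ℕ} {𝒳 : Fin n → Type*} [∀ i, MeasurableSpace (𝒳 i)]
  {μi : ∀ i, Measure (𝒳 i)} [∀ i, IsProbabilityMeasure (μi i)]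

/-- Covariance representation through the random interpolation, followed by symmetrisation in each
coordinate, keeping only increments of equal sign. -/
lemma integral_mul_le_sum_posPart {F φ : (∀ i, 𝒳 i) → ℝ} (hF : BddAESM (Measure.pi μi) F)
    (hφ : BddAESM (Measure.pi μi) φ) (hc : ∫ x, F x ∂Measure.pi μi = 0) :
    ∫ x, F x * φ x ∂Measure.pi μi ≤
      ∫ p, ∑ S : Finset (Fin n), ∑ i ∈ Sᶜ, shapleyWeight n #S *
        (max (F (mix S p) - F (mix (insert i S) p)) 0 *
          max (φ p.1 - φ (mix {i} p)) 0) ∂(Measure.pi μi).prod (Measure.pi μi) := by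
  set μ := Measure.pi μi with hμ
  set P := μ.prod μ with hP
  have hFm : ∀ S, BddAESM P fun p => F (mix S p) := fun S => hF.comp (measurePreserving_mix μi S)
  have hφm : ∀ S, BddAESM P fun p => φ (mix S p) := fun S => hφ.comp (measurePreserving_mix μi S)
  have hφ1 : BddAESM P fun p => φ p.1 := by simpa only [mix_empty] using hφm ∅
  have hF1 : BddAESM P fun p => F p.1 := by simpa only [mix_empty] using hFm ∅
  have hF2 : BddAESM P fun p => F p.2 := by simpa only [mix_univ] using hFm univ
  have h1 : ∫ x, F x * φ x ∂μ = ∫ p, (F p.1 - F p.2) * φ p.1 ∂P := by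
    have e1 : ∫ p, F p.1 * φ p.1 ∂P = ∫ x, F x * φ x ∂μ :=
      (hF.mul hφ).integral_comp measurePreserving_fst
    have e2 : ∫ p, φ p.1 * F p.2 ∂P = 0 := by rw [hP, integral_prod_mul, hc, mul_zero]
    simp_rw [sub_mul, mul_comm (F _) (φ _)] at *
    rw [integral_sub (hφ1.mul hF1).integrable (hφ1.mul hF2).integrable, e1, e2, sub_zero]
  have h2 : ∀ p : (∀ i, 𝒳 i) × (∀ i, 𝒳 i), (F p.1 - F p.2) * φ p.1 =
      ∑ S : Finset (Fin n), ∑ i ∈ Sᶜ, shapleyWeight n #S *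
        ((F (mix S p) - F (mix (insert i S) p)) * φ p.1) := by
    intro p
    have := sum_shapleyWeight_mul_sub (fun S => F (mix S p))
    simp only [mix_empty, mix_univ] at this
    rw [← this, Finset.sum_mul]
    refine Finset.sum_congr rfl fun S _ => ?_
    rw [Finset.sum_mul]
    exact Finset.sum_congr rfl fun i _ => by ring
  have h3 : ∀ (S : Finset (Fin n)), ∀ i ∈ Sᶜ,
      ∫ p, (F (mix S p) - F (mix (insert i S) p)) * φ p.1 ∂P ≤
        ∫ p, max (F (mix S p) - F (mix (insert i S) p)) 0 *
          max (φ p.1 - φ (mix {i} p)) 0 ∂P := by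
    intro S i hi
    have hi : i ∉ S := by simpa using hi
    have hτ := measurePreserving_swapOn μi {i}
    have hm1 : ∀ p : (∀ i, 𝒳 i) × (∀ i, 𝒳 i), (swapOn {i} p).1 = mix {i} p := fun p => rfl
    have hm2 : ∀ p : (∀ i, 𝒳 i) × (∀ i, 𝒳 i), mix {i} (swapOn {i} p) = p.1 := fun p => by
      simpa [mix_empty] using mix_insert_swapOn (Finset.notMem_empty i) p
    have ha := (hFm S).sub (hFm (insert i S))
    have ha' := (hFm (insert i S)).sub (hFm S)
    have hg := hφ1.sub (hφm {i})
    have hg' := (hφm {i}).sub hφ1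
    have e1 := (ha.mul hφ1).integral_comp hτ
    have e2 := (ha.posPart.mul hg.posPart).integral_comp hτ
    simp only [hm1, hm2, mix_swapOn hi, mix_insert_swapOn hi] at e1 e2
    have e3 : ∫ p, (F (mix S p) - F (mix (insert i S) p)) * φ p.1 ∂P +
        ∫ p, (F (mix (insert i S) p) - F (mix S p)) * φ (mix {i} p) ∂P ≤
        ∫ p, max (F (mix S p) - F (mix (insert i S) p)) 0 * max (φ p.1 - φ (mix {i} p)) 0 ∂P +
        ∫ p, max (F (mix (insert i S) p) - F (mix S p)) 0 *
          max (φ (mix {i} p) - φ p.1) 0 ∂P := by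
      rw [← integral_add (ha.mul hφ1).integrable (ha'.mul (hφm {i})).integrable,
        ← integral_add (ha.posPart.mul hg.posPart).integrable
          (ha'.posPart.mul hg'.posPart).integrable]
      refine integral_mono ((ha.mul hφ1).add (ha'.mul (hφm {i}))).integrable
        ((ha.posPart.mul hg.posPart).add (ha'.posPart.mul hg'.posPart)).integrable fun p => ?_
      have key : ∀ u v w z : ℝ, (u - v) * w + (v - u) * z ≤
          max (u - v) 0 * max (w - z) 0 + max (v - u) 0 * max (z - w) 0 := by
        intro u v w z
        rcases le_total u v with h | h <;> rcases le_total w z with h' | h' <;>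
          simp [h, h'] <;> nlinarith
      exact key _ _ _ _
    linarith
  have hI : ∀ S i, BddAESM P fun p => (F (mix S p) - F (mix (insert i S) p)) * φ p.1 :=
    fun S i => ((hFm S).sub (hFm (insert i S))).mul hφ1
  have hJ : ∀ S i, BddAESM P fun p => max (F (mix S p) - F (mix (insert i S) p)) 0 *
      max (φ p.1 - φ (mix {i} p)) 0 :=
    fun S i => ((hFm S).sub (hFm (insert i S))).posPart.mul (hφ1.sub (hφm {i})).posPart
  rw [h1]
  simp_rw [h2]
  rw [integral_finsetSum _ fun S _ =>
      (BddAESM.sum _ fun i => (hI S i).const_mul _).integrable,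
    integral_finsetSum _ fun S _ =>
      (BddAESM.sum _ fun i => (hJ S i).const_mul _).integrable]
  refine Finset.sum_le_sum fun S _ => ?_
  rw [integral_finsetSum _ fun i _ => ((hI S i).const_mul _).integrable,
    integral_finsetSum _ fun i _ => ((hJ S i).const_mul _).integrable]
  refine Finset.sum_le_sum fun i hi => ?_
  rw [integral_const_mul, integral_const_mul]
  exact mul_le_mul_of_nonneg_left (h3 S i hi) (shapleyWeight_nonneg _ _)

/-- Moments of the positive part of a centred function are controlled by those of any function
dominating its one-sided differences. -/
theorem integral_posPart_pow_le {F H : (∀ i, 𝒳 i) → ℝ} (hF : BddAESM (Measure.pi μi) F)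
    (hH : BddAESM (Measure.pi μi) H) (hc : ∫ x, F x ∂Measure.pi μi = 0)
    (hFH : ∀ᵐ x ∂Measure.pi μi, ∀ y : ∀ i, 𝒳 i,
      ∑ i, max (F x - F (Function.update x i (y i))) 0 ^ 2 ≤ H x ^ 2) (r : ℕ) :
    ∫ x, max (F x) 0 ^ (2 * (r + 1)) ∂Measure.pi μi ≤
      (4 * ((r : ℝ) + 1)) ^ (r + 1) * ∫ x, H x ^ (2 * (r + 1)) ∂Measure.pi μi := by
  set μ := Measure.pi μi with hμ
  set P := μ.prod μ with hP
  set m : ℝ := (r : ℝ) + 1 with hm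
  have hm0 : 0 < m := by positivity
  set K : ℝ := 4 * m with hK
  have hFm : ∀ S, BddAESM P fun p => F (mix S p) := fun S => hF.comp (measurePreserving_mix μi S)
  have hHm : ∀ S, BddAESM P fun p => H (mix S p) := fun S => hH.comp (measurePreserving_mix μi S)
  have hF1 : BddAESM P fun p => F p.1 := by simpa only [mix_empty] using hFm ∅
  set φ : (∀ i, 𝒳 i) → ℝ := fun x => max (F x) 0 ^ (2 * r + 1) with hφdef
  have hφ : BddAESM μ φ := hF.posPart.pow _
  have hφm : ∀ S, BddAESM P fun p => φ (mix S p) := fun S => hφ.comp (measurePreserving_mix μi S)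
  have hφ1 : BddAESM P fun p => φ p.1 := by simpa only [mix_empty] using hφm ∅
  set A := ∫ x, max (F x) 0 ^ (2 * (r + 1)) ∂μ with hA
  set B := ∫ x, H x ^ (2 * (r + 1)) ∂μ with hB
  set c : Finset (Fin n) → ℝ := fun S => shapleyWeight n #S * tilt n #S with hcdef
  have hc0 : ∀ S, 0 ≤ c S := fun S =>
    mul_nonneg (shapleyWeight_nonneg _ _) (by unfold tilt; positivity)
  have hcs : ∑ S, c S ≤ 2 := sum_shapleyWeight_mul_tilt_le n
  have hAφ : A = ∫ x, F x * φ x ∂μ := by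
    refine integral_congr_ae (ae_of_all _ fun x => ?_)
    rcases le_total (F x) 0 with h | h
    · simp [hφdef, h]
    · simp only [hφdef, h, sup_of_le_left]; ring
  -- Young's inequality for one interpolation point
  set Y : Finset (Fin n) → ((∀ i, 𝒳 i) × (∀ i, 𝒳 i)) → ℝ := fun S p =>
    (r : ℝ) * max (F p.1) 0 ^ (2 * (r + 1)) + K ^ (r + 1) * H (mix S p) ^ (2 * (r + 1)) with hY
  have hYb : ∀ S, BddAESM P (Y S) := fun S =>
    ((hF1.posPart.pow _).const_mul _).add (((hHm S).pow _).const_mul _)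
  have hYint : ∀ S, ∫ p, Y S p ∂P = r * A + K ^ (r + 1) * B := by
    intro S
    rw [integral_add ((hF1.posPart.pow _).const_mul _).integrable
      (((hHm S).pow _).const_mul _).integrable, integral_const_mul, integral_const_mul,
      (hF.posPart.pow (2 * (r + 1))).integral_comp measurePreserving_fst,
      (hH.pow (2 * (r + 1))).integral_comp (measurePreserving_mix μi S)]
  have hyoung : ∀ S p, m * (max (F p.1) 0 ^ (2 * r) * (K * H (mix S p) ^ 2)) ≤ Y S p := by
    intro S p
    have := mul_pow_pred_mul_le (sq_nonneg (max (F p.1) 0))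
      (mul_nonneg (by positivity : 0 ≤ K) (sq_nonneg (H (mix S p)))) r
    simp only [hY, pow_mul]
    rwa [mul_pow] at this
  -- pointwise bound of the symmetrised covariance
  have hpt : ∀ᵐ p ∂P, ∑ S : Finset (Fin n), ∑ i ∈ Sᶜ, shapleyWeight n #S *
        (max (F (mix S p) - F (mix (insert i S) p)) 0 *
          max (φ p.1 - φ (mix {i} p)) 0) ≤
      (1 / (2 * m)) * ((∑ S, c S * Y S p) / 2 + Y ∅ p) := by
    have hae : ∀ᵐ p ∂P, ∀ S : Finset (Fin n), ∀ y : ∀ i, 𝒳 i,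
        ∑ i, max (F (mix S p) - F (Function.update (mix S p) i (y i))) 0 ^ 2 ≤
          H (mix S p) ^ 2 :=
      ae_all_iff.2 fun S => (measurePreserving_mix μi S).quasiMeasurePreserving.ae hFH
    filter_upwards [hae] with p hp
    set G := max (F p.1) 0 ^ (2 * r) with hG
    have hG0 : 0 ≤ G := pow_nonneg (le_max_right _ _) _
    have hmix : ∀ i, mix {i} p = Function.update p.1 i (p.2 i) := fun i => by
      simpa [mix_empty] using mix_insert ∅ i p
    have hcs := sum_shapleyWeight_mul_mul_le
      (fun S i => max (F (mix S p) - F (mix (insert i S) p)) 0)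
      (fun i => max (F p.1 - F (mix {i} p)) 0) (fun S => H (mix S p) ^ 2) (H p.1 ^ 2)
      (fun S => by simpa only [mix_insert] using hp S p.2)
      (by simpa only [mix_empty, hmix] using hp ∅ p.2)
    have hstep : ∑ S : Finset (Fin n), ∑ i ∈ Sᶜ, shapleyWeight n #S *
        (max (F (mix S p) - F (mix (insert i S) p)) 0 * max (φ p.1 - φ (mix {i} p)) 0) ≤
        (2 * m * G) * ∑ S : Finset (Fin n), ∑ i ∈ Sᶜ, shapleyWeight n #S *
          (max (F (mix S p) - F (mix (insert i S) p)) 0 * max (F p.1 - F (mix {i} p)) 0) := by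
      simp_rw [Finset.mul_sum]
      refine Finset.sum_le_sum fun S _ => Finset.sum_le_sum fun i _ => ?_
      have h1 := posPart_pow_sub_le (F p.1) (F (mix {i} p)) (2 * r)
      have h2 : max (φ p.1 - φ (mix {i} p)) 0 ≤ 2 * m * G * max (F p.1 - F (mix {i} p)) 0 := by
        refine h1.trans ?_
        have : ((2 * r : ℕ) : ℝ) + 1 ≤ 2 * m := by push_cast; linarith
        have h0 : 0 ≤ max (F p.1 - F (mix {i} p)) 0 := le_max_right _ _
        gcongr
      have hw := shapleyWeight_nonneg n #S
      have h0 : 0 ≤ max (F (mix S p) - F (mix (insert i S) p)) 0 := le_max_right _ _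
      calc _ ≤ shapleyWeight n #S * (max (F (mix S p) - F (mix (insert i S) p)) 0 *
            (2 * m * G * max (F p.1 - F (mix {i} p)) 0)) := by gcongr
        _ = _ := by ring
    refine hstep.trans ((mul_le_mul_of_nonneg_left hcs (by positivity)).trans ?_)
    have e1 : ∀ S, G * H (mix S p) ^ 2 ≤ Y S p / (m * K) := by
      intro S
      rw [le_div_iff₀ (by positivity)]
      have := hyoung S p
      linarith
    have e0 := e1 ∅
    rw [mix_empty] at e0
    have e2 : ∑ S, c S * (G * H (mix S p) ^ 2) ≤ ∑ S, c S * (Y S p / (m * K)) :=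
      Finset.sum_le_sum fun S _ => mul_le_mul_of_nonneg_left (e1 S) (hc0 S)
    have e3 : 2 * m * G * ((∑ S, c S * H (mix S p) ^ 2) / 2 + H p.1 ^ 2) =
        2 * m * ((∑ S, c S * (G * H (mix S p) ^ 2)) / 2 + G * H p.1 ^ 2) := by
      have : ∑ S, c S * (G * H (mix S p) ^ 2) = G * ∑ S, c S * H (mix S p) ^ 2 := by
        rw [Finset.mul_sum]; exact Finset.sum_congr rfl fun S _ => by ring
      rw [this]; ring
    have e4 : (1 / (2 * m)) * ((∑ S, c S * Y S p) / 2 + Y ∅ p) =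
        2 * m * ((∑ S, c S * (Y S p / (m * K))) / 2 + Y ∅ p / (m * K)) := by
      have : ∑ S, c S * (Y S p / (m * K)) = (∑ S, c S * Y S p) / (m * K) := by
        rw [Finset.sum_div]; exact Finset.sum_congr rfl fun S _ => by ring
      rw [this, hK]; field_simp; ring
    rw [e3, e4]
    gcongr
  have hZ : BddAESM P fun p => ∑ S, c S * Y S p := BddAESM.sum _ fun S => (hYb S).const_mul _
  have hZ' : BddAESM P fun p => (1 / (2 * m)) * ((∑ S, c S * Y S p) / 2 + Y ∅ p) := by
    simpa only [div_eq_mul_inv, mul_comm _ (2 : ℝ)⁻¹] using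
      ((hZ.const_mul (2 : ℝ)⁻¹).add (hYb ∅)).const_mul (1 / (2 * m))
  have hL : BddAESM P fun p => ∑ S : Finset (Fin n), ∑ i ∈ Sᶜ, shapleyWeight n #S *
        (max (F (mix S p) - F (mix (insert i S) p)) 0 *
          max (φ p.1 - φ (mix {i} p)) 0) :=
    BddAESM.sum _ fun S => BddAESM.sum _ fun i =>
      (((hFm S).sub (hFm (insert i S))).posPart.mul (hφ1.sub (hφm {i})).posPart).const_mul _
  have hmain : A ≤ (1 / (2 * m)) * ((∑ S, c S) * (r * A + K ^ (r + 1) * B) / 2 +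
      (r * A + K ^ (r + 1) * B)) := by
    rw [hAφ]
    refine (integral_mul_le_sum_posPart hF hφ hc).trans
      ((integral_mono_ae hL.integrable hZ'.integrable hpt).trans (le_of_eq ?_))
    rw [integral_const_mul, integral_add (hZ.integrable.div_const 2) (hYb ∅).integrable,
      integral_div, integral_finsetSum _ fun S _ => ((hYb S).const_mul _).integrable]
    simp_rw [integral_const_mul, hYint, ← hAφ]
    rw [Finset.sum_mul]
  have hA0 : 0 ≤ A := integral_nonneg fun x => pow_nonneg (le_max_right _ _) _
  have hB0 : 0 ≤ B := integral_nonneg fun x => by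
    rw [pow_mul]; exact pow_nonneg (sq_nonneg _) _
  set J := r * A + K ^ (r + 1) * B with hJ
  have hJ0 : 0 ≤ J := by positivity
  have h5 : A ≤ (1 / (2 * m)) * (2 * J / 2 + J) := by
    refine hmain.trans ?_
    gcongr
  have h6 : m * A ≤ J := by
    calc m * A ≤ m * ((1 / (2 * m)) * (2 * J / 2 + J)) := by gcongr
      _ = J := by field_simp; ring
  rw [hJ, hm] at h6
  linarith

end Moment

/-! ### Operator norms of difference tensors -/

section Tensor

variable {n k : ℕ}

lemma abs_le_one_of_sum_sq_le_one {v : Fin n → ℝ} (h : ∑ i, v i ^ 2 ≤ 1) (i : Fin n) :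
    |v i| ≤ 1 := by
  rw [← sq_le_one_iff_abs_le_one]
  exact (Finset.single_le_sum (fun j _ => sq_nonneg (v j)) (Finset.mem_univ i)).trans h

lemma sum_prod_mul_le_sum_abs (A : (Fin k → Fin n) → ℝ) {v : Fin k → Fin n → ℝ}
    (hv : ∀ j, ∑ i, v j i ^ 2 ≤ 1) :
    ∑ idx : Fin k → Fin n, (∏ j, v j (idx j)) * A idx ≤ ∑ idx, |A idx| := by
  refine Finset.sum_le_sum fun idx _ => (le_abs_self _).trans ?_
  rw [abs_mul, Finset.abs_prod]
  exact mul_le_of_le_one_left (abs_nonneg _)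
    (Finset.prod_le_one (fun _ _ => abs_nonneg _) fun j _ => abs_le_one_of_sum_sq_le_one (hv j) _)

lemma bddAbove_tOp (A : (Fin k → Fin n) → ℝ) :
    BddAbove (Set.range fun v : {v : Fin k → Fin n → ℝ // ∀ j, ∑ i, (v j i) ^ 2 ≤ 1} =>
      ∑ idx : Fin k → Fin n, (∏ j, v.1 j (idx j)) * A idx) :=
  ⟨∑ idx, |A idx|, by rintro _ ⟨v, rfl⟩; exact sum_prod_mul_le_sum_abs A v.2⟩

lemma le_tOp (A : (Fin k → Fin n) → ℝ) {v : Fin k → Fin n → ℝ} (hv : ∀ j, ∑ i, v j i ^ 2 ≤ 1) :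
    ∑ idx : Fin k → Fin n, (∏ j, v j (idx j)) * A idx ≤ tOp A :=
  le_ciSup (bddAbove_tOp A) ⟨v, hv⟩

instance : Nonempty {v : Fin k → Fin n → ℝ // ∀ j, ∑ i, (v j i) ^ 2 ≤ 1} :=
  ⟨⟨fun _ _ => 0, fun _ => by simp⟩⟩

lemma tOp_le_sum_abs (A : (Fin k → Fin n) → ℝ) : tOp A ≤ ∑ idx, |A idx| :=
  ciSup_le fun v => sum_prod_mul_le_sum_abs A v.2

lemma tOp_nonneg {A : (Fin k → Fin n) → ℝ} (hA : ∀ idx, 0 ≤ A idx) : 0 ≤ tOp A :=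
  (Finset.sum_nonneg fun idx _ => mul_nonneg (Finset.prod_nonneg fun _ _ => le_rfl) (hA idx)).trans
    (le_tOp A (v := fun _ _ => 0) fun _ => by simp)

lemma exists_lt_of_lt_tOp {A : (Fin k → Fin n) → ℝ} {b : ℝ} (hb : b < tOp A) :
    ∃ v : Fin k → Fin n → ℝ, (∀ j, ∑ i, v j i ^ 2 ≤ 1) ∧
      b < ∑ idx : Fin k → Fin n, (∏ j, v j (idx j)) * A idx := by
  obtain ⟨v, hv⟩ := exists_lt_of_lt_ciSup hb
  exact ⟨v.1, v.2, hv⟩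

lemma sum_sq_le_of_dual {D : Fin n → ℝ} {T : ℝ}
    (h : ∀ u : Fin n → ℝ, (∀ i, 0 ≤ u i) → ∑ i, u i ^ 2 ≤ 1 → ∑ i, u i * D i ≤ T)
    (hD : ∀ i, 0 ≤ D i) : ∑ i, D i ^ 2 ≤ T ^ 2 := by
  set s := ∑ i, D i ^ 2 with hs
  have hs0 : 0 ≤ s := Finset.sum_nonneg fun i _ => sq_nonneg _
  rcases hs0.eq_or_lt with h0 | h0
  · rw [← h0]; positivity
  · have hq : 0 < √s := Real.sqrt_pos.2 h0
    have hqs : √s ^ 2 = s := Real.sq_sqrt hs0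
    have := h (fun i => D i / √s) (fun i => div_nonneg (hD i) hq.le) (by
      simp_rw [div_pow, ← Finset.sum_div, hqs, ← hs]
      rw [div_self h0.ne'])
    have e : ∑ i, D i / √s * D i = √s := by
      have : ∀ i, D i / √s * D i = D i ^ 2 / √s := fun i => by ring
      simp_rw [this, ← Finset.sum_div, ← hs]
      rw [div_eq_iff hq.ne', ← sq, hqs]
    rw [e] at this
    calc s = √s ^ 2 := hqs.symm
      _ ≤ T ^ 2 := by gcongr

lemma sum_mul_sum_cons_le_tOp (B : (Fin (k + 1) → Fin n) → ℝ) {u : Fin n → ℝ}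
    {v : Fin k → Fin n → ℝ} (hu : ∑ i, u i ^ 2 ≤ 1) (hv : ∀ j, ∑ i, v j i ^ 2 ≤ 1) :
    ∑ i, u i * ∑ idx : Fin k → Fin n, (∏ j, v j (idx j)) * B (Fin.cons i idx) ≤ tOp B := by
  refine le_trans (le_of_eq ?_) (le_tOp B (v := Fin.cons u v) (Fin.cases hu hv))
  rw [← (Fin.consEquiv fun _ => Fin n).sum_comp, Fintype.sum_prod_type]
  refine Finset.sum_congr rfl fun i _ => ?_
  rw [Finset.mul_sum]
  refine Finset.sum_congr rfl fun idx _ => ?_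
  simp [Fin.prod_univ_succ, mul_assoc, Fin.consEquiv]

/-- The one-sided increments of `tOp` are dominated by the norm of a tensor of one order more. -/
lemma sum_sq_posPart_tOp_sub_le {A : (Fin k → Fin n) → ℝ} {A' : Fin n → (Fin k → Fin n) → ℝ}
    {B : (Fin (k + 1) → Fin n) → ℝ} (h : ∀ i idx, |A idx - A' i idx| ≤ B (Fin.cons i idx)) :
    ∑ i, max (tOp A - tOp (A' i)) 0 ^ 2 ≤ tOp B ^ 2 := by
  refine sum_sq_le_of_dual (fun u hu0 hu => ?_) fun i => le_max_right _ _
  refine le_of_forall_pos_le_add fun ε hε => ?_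
  have hε' : 0 < ε / (n + 1) := by positivity
  obtain ⟨v, hv, hlt⟩ := exists_lt_of_lt_tOp (sub_lt_self (tOp A) hε')
  have hv' : ∀ j, ∑ i, |v j i| ^ 2 ≤ 1 := fun j => by simpa using hv j
  have h1 : ∀ i, max (tOp A - tOp (A' i)) 0 ≤
      ε / (n + 1) + ∑ idx : Fin k → Fin n, (∏ j, |v j (idx j)|) * B (Fin.cons i idx) := by
    intro i
    have hB : ∀ idx, 0 ≤ (∏ j, |v j (idx j)|) * B (Fin.cons i idx) := fun idx =>
      mul_nonneg (Finset.prod_nonneg fun _ _ => abs_nonneg _) ((abs_nonneg _).trans (h i idx))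
    refine max_le ?_ (add_nonneg hε'.le (Finset.sum_nonneg fun idx _ => hB idx))
    have h2 := le_tOp (A' i) hv
    have h3 : ∑ idx : Fin k → Fin n, (∏ j, v j (idx j)) * A idx -
        ∑ idx : Fin k → Fin n, (∏ j, v j (idx j)) * A' i idx ≤
        ∑ idx : Fin k → Fin n, (∏ j, |v j (idx j)|) * B (Fin.cons i idx) := by
      rw [← Finset.sum_sub_distrib]
      refine Finset.sum_le_sum fun idx _ => ?_
      rw [← mul_sub]
      refine (le_abs_self _).trans ?_
      rw [abs_mul, Finset.abs_prod]
      exact mul_le_mul_of_nonneg_left (h i idx) (Finset.prod_nonneg fun _ _ => abs_nonneg _)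
    linarith
  have h4 : ∑ i, u i ≤ n := by
    calc ∑ i, u i ≤ ∑ _i : Fin n, (1 : ℝ) :=
          Finset.sum_le_sum fun i _ => (le_abs_self _).trans (abs_le_one_of_sum_sq_le_one hu i)
      _ = n := by simp
  calc ∑ i, u i * max (tOp A - tOp (A' i)) 0
      ≤ ∑ i, u i * (ε / (n + 1) +
          ∑ idx : Fin k → Fin n, (∏ j, |v j (idx j)|) * B (Fin.cons i idx)) :=
        Finset.sum_le_sum fun i _ => mul_le_mul_of_nonneg_left (h1 i) (hu0 i)
    _ = (∑ i, u i) * (ε / (n + 1)) +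
          ∑ i, u i * ∑ idx : Fin k → Fin n, (∏ j, |v j (idx j)|) * B (Fin.cons i idx) := by
        simp_rw [mul_add, Finset.sum_add_distrib, Finset.sum_mul]
    _ ≤ n * (ε / (n + 1)) + tOp B := by
        have := sum_mul_sum_cons_le_tOp B hu hv'
        gcongr
    _ ≤ tOp B + ε := by
        have : n * (ε / (n + 1)) ≤ ε := by
          rw [mul_div_assoc', div_le_iff₀ (by positivity)]; nlinarith
        linarith

end Tensor

section Difference

variable {n : ℕ} {𝒳 : Fin n → Type*}

/-- The signed `k`-th order difference whose supremum over `y` in absolute value is `hOrd`. -/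
def signedDiff (f : (∀ i, 𝒳 i) → ℝ) (k : ℕ) (idx : Fin k → Fin n) (x : ∀ i, 𝒳 i)
    (y : (∀ i, 𝒳 i) × (∀ i, 𝒳 i)) : ℝ :=
  ∑ S ∈ (univ : Finset (Fin k)).powerset, (-1 : ℝ) ^ #S *
    f (fun i => if i ∈ Finset.image idx S then y.2 i
      else if i ∈ Finset.image idx univ then y.1 i else x i)

lemma hOrd_eq (f : (∀ i, 𝒳 i) → ℝ) (k : ℕ) (idx : Fin k → Fin n) (x : ∀ i, 𝒳 i) :
    hOrd f k idx x = ⨆ y, |signedDiff f k idx x y| := rfl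

lemma hOrd_neg (f : (∀ i, 𝒳 i) → ℝ) (k : ℕ) (idx : Fin k → Fin n) (x : ∀ i, 𝒳 i) :
    hOrd (fun x => -f x) k idx x = hOrd f k idx x := by
  have : ∀ y, signedDiff (fun x => -f x) k idx x y = -signedDiff f k idx x y := fun y => by
    simp [signedDiff]
  simp_rw [hOrd_eq, this, abs_neg]

lemma hT_neg (f : (∀ i, 𝒳 i) → ℝ) (k : ℕ) (idx : Fin k → Fin n) (x : ∀ i, 𝒳 i) :
    hT (fun x => -f x) k idx x = hT f k idx x := by
  simp_rw [hT, hOrd_neg]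

lemma abs_signedDiff_le {f : (∀ i, 𝒳 i) → ℝ} {M : ℝ} (hM : ∀ x, |f x| ≤ M) (k : ℕ)
    (idx : Fin k → Fin n) (x : ∀ i, 𝒳 i) (y : (∀ i, 𝒳 i) × (∀ i, 𝒳 i)) :
    |signedDiff f k idx x y| ≤ 2 ^ k * M := by
  refine (Finset.abs_sum_le_sum_abs _ _).trans ?_
  refine (Finset.sum_le_sum (g := fun _ => M) fun S _ => ?_).trans (by simp)
  rw [abs_mul, abs_pow, abs_neg, abs_one, one_pow, one_mul]
  exact hM _

lemma bddAbove_signedDiff {f : (∀ i, 𝒳 i) → ℝ} {M : ℝ} (hM : ∀ x, |f x| ≤ M) (k : ℕ)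
    (idx : Fin k → Fin n) (x : ∀ i, 𝒳 i) :
    BddAbove (Set.range fun y => |signedDiff f k idx x y|) :=
  ⟨2 ^ k * M, by rintro _ ⟨y, rfl⟩; exact abs_signedDiff_le hM k idx x y⟩

lemma hOrd_nonneg (f : (∀ i, 𝒳 i) → ℝ) (k : ℕ) (idx : Fin k → Fin n) (x : ∀ i, 𝒳 i) :
    0 ≤ hOrd f k idx x :=
  Real.iSup_nonneg fun _ => abs_nonneg _

lemma hT_nonneg (f : (∀ i, 𝒳 i) → ℝ) (k : ℕ) (idx : Fin k → Fin n) (x : ∀ i, 𝒳 i) :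
    0 ≤ hT f k idx x := by
  unfold hT
  split_ifs
  exacts [hOrd_nonneg f k idx x, le_rfl]

lemma hT_le {f : (∀ i, 𝒳 i) → ℝ} {M : ℝ} (hM : ∀ x, |f x| ≤ M) (k : ℕ) (idx : Fin k → Fin n)
    (x : ∀ i, 𝒳 i) : hT f k idx x ≤ 2 ^ k * M := by
  have hM0 : 0 ≤ M := (abs_nonneg _).trans (hM x)
  unfold hT
  split_ifs
  · have : Nonempty ((∀ i, 𝒳 i) × (∀ i, 𝒳 i)) := ⟨(x, x)⟩
    exact ciSup_le fun y => abs_signedDiff_le hM k idx x y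
  · positivity

lemma signedDiff_update_of_mem (f : (∀ i, 𝒳 i) → ℝ) {k : ℕ} {idx : Fin k → Fin n} {i : Fin n}
    (hi : i ∈ Set.range idx) (x : ∀ i, 𝒳 i) (z : 𝒳 i) (y : (∀ i, 𝒳 i) × (∀ i, 𝒳 i)) :
    signedDiff f k idx (Function.update x i z) y = signedDiff f k idx x y := by
  unfold signedDiff
  refine Finset.sum_congr rfl fun S _ => ?_
  congr 2
  ext j
  by_cases hj : j = i
  · subst hj
    have : j ∈ Finset.image idx univ := by simpa using hi
    simp [this]
  · simp [hj]

lemma signedDiff_sub_update (f : (∀ i, 𝒳 i) → ℝ) {k : ℕ} {idx : Fin k → Fin n} {i : Fin n}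
    (hi : i ∉ Set.range idx) (x : ∀ i, 𝒳 i) (z : 𝒳 i) (y : (∀ i, 𝒳 i) × (∀ i, 𝒳 i)) :
    signedDiff f k idx x y - signedDiff f k idx (Function.update x i z) y =
      signedDiff f (k + 1) (Fin.cons i idx) x
        (Function.update y.1 i (x i), Function.update y.2 i z) := by
  have hi' : ∀ a, idx a ≠ i := fun a h => hi ⟨a, h⟩
  have huniv : (univ : Finset (Fin (k + 1))) = insert 0 (univ.map (Fin.succEmb k)) := by
    ext j; refine Fin.cases ?_ (fun j => ?_) j <;> simp
  have h0 : ∀ S : Finset (Fin k), (0 : Fin (k + 1)) ∉ S.map (Fin.succEmb k) := fun S => by simp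
  have hp : ∀ g : Finset (Fin (k + 1)) → ℝ,
      ∑ S ∈ (univ : Finset (Fin (k + 1))).powerset, g S =
        ∑ S ∈ (univ : Finset (Fin k)).powerset, g (S.map (Fin.succEmb k)) +
        ∑ S ∈ (univ : Finset (Fin k)).powerset, g (insert 0 (S.map (Fin.succEmb k))) := by
    intro g
    have hpm : (univ.map (Fin.succEmb k)).powerset =
        (univ : Finset (Fin k)).powerset.map (Finset.mapEmbedding (Fin.succEmb k)).toEmbedding := by
      rw [Finset.map_eq_image, Finset.powerset_image, Finset.map_eq_image]
      refine Finset.image_congr fun S _ => ?_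
      simp [Finset.map_eq_image]
    rw [huniv, Finset.sum_powerset_insert (h0 _), hpm, Finset.sum_map, Finset.sum_map]
    rfl
  have hcons : ∀ S : Finset (Fin k), Finset.image (Fin.cons i idx : Fin (k + 1) → Fin n)
      (S.map (Fin.succEmb k)) = Finset.image idx S := fun S => by
    rw [Finset.map_eq_image, Finset.image_image]; rfl
  have hcons' : ∀ S : Finset (Fin k), Finset.image (Fin.cons i idx : Fin (k + 1) → Fin n)
      (insert 0 (S.map (Fin.succEmb k))) = insert i (Finset.image idx S) := fun S => by
    rw [Finset.image_insert, hcons]; rfl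
  have hconsu : Finset.image (Fin.cons i idx : Fin (k + 1) → Fin n) univ =
      insert i (Finset.image idx univ) := by rw [huniv, hcons']
  unfold signedDiff
  rw [hp, sub_eq_add_neg, ← Finset.sum_neg_distrib]
  congr 1
  · refine Finset.sum_congr rfl fun S _ => ?_
    rw [hcons, hconsu, Finset.card_map]
    congr 2
    ext j
    by_cases hj : j = i
    · subst hj; simp [hi']
    · simp [hj]
  · refine Finset.sum_congr rfl fun S _ => ?_
    rw [hcons', hconsu, Finset.card_insert_of_notMem (h0 S), Finset.card_map, pow_succ,
      mul_neg_one, neg_mul]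
    congr 3
    ext j
    by_cases hj : j = i
    · subst hj; simp [hi']
    · simp [hj]

lemma abs_iSup_abs_sub_le {ι : Type*} [Nonempty ι] {a b : ι → ℝ} {c : ℝ}
    (ha : BddAbove (Set.range fun y => |a y|)) (hb : BddAbove (Set.range fun y => |b y|))
    (h : ∀ y, |a y - b y| ≤ c) : |(⨆ y, |a y|) - (⨆ y, |b y|)| ≤ c := by
  rw [abs_sub_le_iff]
  constructor
  · rw [sub_le_iff_le_add]
    refine ciSup_le fun y => ?_
    have h1 := le_ciSup hb y
    have h2 := abs_sub_abs_le_abs_sub (a y) (b y)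
    have h3 := h y
    linarith
  · rw [sub_le_iff_le_add]
    refine ciSup_le fun y => ?_
    have h1 := le_ciSup ha y
    have h2 := abs_sub_abs_le_abs_sub (b y) (a y)
    have h3 := h y
    rw [abs_sub_comm] at h3
    linarith

lemma abs_hT_sub_update_le {f : (∀ i, 𝒳 i) → ℝ} {M : ℝ} (hM : ∀ x, |f x| ≤ M) {k : ℕ}
    (idx : Fin k → Fin n) (i : Fin n) (x : ∀ i, 𝒳 i) (z : 𝒳 i) :
    |hT f k idx x - hT f k idx (Function.update x i z)| ≤ hT f (k + 1) (Fin.cons i idx) x := by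
  have : Nonempty ((∀ i, 𝒳 i) × (∀ i, 𝒳 i)) := ⟨(x, x)⟩
  by_cases hinj : Function.Injective idx
  · by_cases hi : i ∈ Set.range idx
    · have : hT f k idx (Function.update x i z) = hT f k idx x := by
        simp_rw [hT, hOrd_eq, signedDiff_update_of_mem f hi x z]
      rw [this, sub_self, abs_zero]
      exact hT_nonneg _ _ _ _
    · have hc : Function.Injective (Fin.cons i idx : Fin (k + 1) → Fin n) :=
        Fin.cons_injective_iff.2 ⟨hi, hinj⟩
      rw [hT, hT, hT, if_pos hinj, if_pos hinj, if_pos hc, hOrd_eq, hOrd_eq, hOrd_eq]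
      refine abs_iSup_abs_sub_le (bddAbove_signedDiff hM _ _ _) (bddAbove_signedDiff hM _ _ _)
        fun y => ?_
      rw [signedDiff_sub_update f hi x z y]
      exact le_ciSup (bddAbove_signedDiff hM (k + 1) (Fin.cons i idx) x) _
  · simp only [hT, if_neg hinj, sub_self, abs_zero]
    exact hT_nonneg f (k + 1) _ x

lemma sum_sq_posPart_tOp_hT_sub_le {f : (∀ i, 𝒳 i) → ℝ} {M : ℝ} (hM : ∀ x, |f x| ≤ M) (k : ℕ)
    (x y : ∀ i, 𝒳 i) :
    ∑ i, max (tOp (fun idx : Fin k → Fin n => hT f k idx x) -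
      tOp (fun idx : Fin k → Fin n => hT f k idx (Function.update x i (y i)))) 0 ^ 2 ≤
      tOp (fun idx : Fin (k + 1) → Fin n => hT f (k + 1) idx x) ^ 2 :=
  sum_sq_posPart_tOp_sub_le fun i idx => abs_hT_sub_update_le hM idx i x (y i)

lemma sum_sq_posPart_sub_le {f : (∀ i, 𝒳 i) → ℝ} {M : ℝ} (hM : ∀ x, |f x| ≤ M)
    (x y : ∀ i, 𝒳 i) :
    ∑ i, max (f x - f (Function.update x i (y i))) 0 ^ 2 ≤
      tOp (fun idx : Fin 1 → Fin n => hT f 1 idx x) ^ 2 := by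
  have htOp : ∀ a : ℝ, tOp (fun _ : Fin 0 → Fin n => a) = a := fun a => by simp [tOp]
  have h := sum_sq_posPart_tOp_sub_le (k := 0) (A := fun _ => f x)
    (A' := fun i _ => f (Function.update x i (y i)))
    (B := fun idx : Fin 1 → Fin n => hT f 1 idx x) fun i idx => by
      have hi : i ∉ Set.range idx := by simp
      have h0 : ∀ x' : ∀ i, 𝒳 i, signedDiff f 0 idx x' (x, x) = f x' := fun x' => by
        simp [signedDiff]
      have h1 := signedDiff_sub_update f hi x (y i) (x, x)
      have hc : Function.Injective (Fin.cons i idx : Fin 1 → Fin n) :=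
        Fin.cons_injective_iff.2 ⟨hi, Function.injective_of_subsingleton _⟩
      rw [h0, h0] at h1
      rw [h1, hT, if_pos hc, hOrd_eq]
      exact le_ciSup (bddAbove_signedDiff hM 1 (Fin.cons i idx) x) _
  simpa only [htOp] using h

lemma tOp_hT_nonneg (f : (∀ i, 𝒳 i) → ℝ) (k : ℕ) (x : ∀ i, 𝒳 i) :
    0 ≤ tOp (fun idx : Fin k → Fin n => hT f k idx x) :=
  tOp_nonneg fun idx => hT_nonneg f k idx x

lemma tOp_hT_le {f : (∀ i, 𝒳 i) → ℝ} {M : ℝ} (hM : ∀ x, |f x| ≤ M) (k : ℕ) (x : ∀ i, 𝒳 i) :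
    tOp (fun idx : Fin k → Fin n => hT f k idx x) ≤ ∑ _idx : Fin k → Fin n, 2 ^ k * M :=
  (tOp_le_sum_abs _).trans <| Finset.sum_le_sum fun idx _ => by
    rw [abs_of_nonneg (hT_nonneg f k idx x)]
    exact hT_le hM k idx x

end Difference

/-! ### From moments to tails -/

section Tail

/-- Minkowski's inequality with a constant, in the form needed for iterating moment bounds. -/
lemma integral_pow_le_of_le_add {α : Type*} [MeasurableSpace α] {P : Measure α}
    [IsProbabilityMeasure P] {g G : α → ℝ} {a s : ℝ} {p : ℕ} (ha : 0 ≤ a) (hs : 0 < s)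
    (hg : BddAESM P g) (hG : BddAESM P G) (hg0 : ∀ x, 0 ≤ g x) (hG0 : ∀ x, 0 ≤ G x)
    (h : ∀ x, g x ≤ a + G x) (hGp : ∫ x, G x ^ p ∂P ≤ (a * s) ^ p) :
    ∫ x, g x ^ p ∂P ≤ (a * (s + 1)) ^ p := by
  have hs1 : 0 < s + 1 := by linarith
  have hpt : ∀ x, g x ^ p ≤ (s + 1) ^ p * (a ^ p / (s + 1) + (s ^ p)⁻¹ * s / (s + 1) * G x ^ p) := by
    intro x
    have hcv := (convexOn_pow (𝕜 := ℝ) p).2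
    have hconv := hcv (Set.mem_Ici.2 ha) (Set.mem_Ici.2 (div_nonneg (hG0 x) hs.le))
      (show 0 ≤ 1 / (s + 1) by positivity) (show 0 ≤ s / (s + 1) by positivity)
      (by rw [← add_div, add_comm, div_self hs1.ne'])
    simp only [smul_eq_mul] at hconv
    have e : 1 / (s + 1) * a + s / (s + 1) * (G x / s) = (a + G x) / (s + 1) := by
      field_simp
    rw [e, div_pow, div_le_iff₀ (by positivity)] at hconv
    refine (pow_le_pow_left₀ (hg0 x) (h x) p).trans (hconv.trans (le_of_eq ?_))
    rw [div_pow]; ring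
  have hb : BddAESM P fun x =>
      (s + 1) ^ p * (a ^ p / (s + 1) + (s ^ p)⁻¹ * s / (s + 1) * G x ^ p) :=
    (((BddAESM.const _).add ((hG.pow p).const_mul _))).const_mul _
  refine (integral_mono (hg.pow p).integrable hb.integrable hpt).trans ?_
  rw [integral_const_mul, integral_add (BddAESM.const _).integrable
    ((hG.pow p).const_mul _).integrable, integral_const_mul]
  simp only [integral_const, probReal_univ, one_smul]
  calc _ ≤ (s + 1) ^ p * (a ^ p / (s + 1) + (s ^ p)⁻¹ * s / (s + 1) * (a * s) ^ p) := by gcongr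
    _ = (a * (s + 1)) ^ p := by rw [mul_pow, mul_pow]; field_simp; ring

variable {n : ℕ} {𝒳 : Fin n → Type*} [∀ i, MeasurableSpace (𝒳 i)]
  {μi : ∀ i, Measure (𝒳 i)} {f : (∀ i, 𝒳 i) → ℝ} {M : ℝ}

lemma bddAESM_tOp_hT (hM : ∀ x, |f x| ≤ M) {k : ℕ}
    (h : AEStronglyMeasurable (fun x => tOp (fun idx : Fin k → Fin n => hT f k idx x))
      (Measure.pi μi)) :
    BddAESM (Measure.pi μi) fun x => tOp (fun idx : Fin k → Fin n => hT f k idx x) :=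
  ⟨h, _, fun x => by rw [abs_of_nonneg (tOp_hT_nonneg f k x)]; exact tOp_hT_le hM k x⟩

variable [∀ i, IsProbabilityMeasure (μi i)]

/-- The moment estimate for a function that is not centred, with its bounds in scaled form. -/
lemma integral_posPart_sub_pow_le {g H : (∀ i, 𝒳 i) → ℝ} (hg : BddAESM (Measure.pi μi) g)
    (hH : BddAESM (Measure.pi μi) H)
    (hgH : ∀ᵐ x ∂Measure.pi μi, ∀ y : ∀ i, 𝒳 i,
      ∑ i, max (g x - g (Function.update x i (y i))) 0 ^ 2 ≤ H x ^ 2)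
    {r : ℕ} {K b : ℝ} (hK : K ^ 2 = 4 * ((r : ℝ) + 1))
    (hb : ∫ x, H x ^ (2 * (r + 1)) ∂Measure.pi μi ≤ b ^ (2 * (r + 1))) :
    ∫ x, max (g x - ∫ z, g z ∂Measure.pi μi) 0 ^ (2 * (r + 1)) ∂Measure.pi μi ≤
      (K * b) ^ (2 * (r + 1)) := by
  have h := integral_posPart_pow_le (hg.sub (BddAESM.const (∫ z, g z ∂Measure.pi μi))) hH
    (by rw [integral_sub hg.integrable (BddAESM.const _).integrable]; simp)
    (by simpa only [sub_sub_sub_cancel_right] using hgH) r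
  refine h.trans ?_
  rw [mul_pow K b, pow_mul K, hK]
  gcongr

variable {d r : ℕ} {t q K : ℝ}

/-- Iterating the moment estimate downwards from the highest order. -/
lemma exists_moment_bound (hM : ∀ x, |f x| ≤ M) (ht : 0 ≤ t) (hq : 0 ≤ q) (hK0 : 0 ≤ K)
    (hK : K ^ 2 = 4 * ((r : ℝ) + 1)) (hKq : K * q ≤ 1)
    (hmeas : ∀ k, 1 ≤ k → k < d →
      AEStronglyMeasurable (fun x => tOp (fun idx : Fin k → Fin n => hT f k idx x))
        (Measure.pi μi))
    (hint : ∀ k, 1 ≤ k → k < d →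
      ∫ x, tOp (fun idx : Fin k → Fin n => hT f k idx x) ∂Measure.pi μi ≤ t * q ^ k)
    (hsup : ∀ᵐ x ∂Measure.pi μi, tOp (fun idx : Fin d → Fin n => hT f d idx x) ≤ t * q ^ d)
    (j k : ℕ) (hk : 1 ≤ k) (hkd : k + j = d) :
    ∃ H : (∀ i, 𝒳 i) → ℝ, BddAESM (Measure.pi μi) H ∧
      (∀ᵐ x ∂Measure.pi μi, tOp (fun idx : Fin k → Fin n => hT f k idx x) ≤ H x) ∧
      ∫ x, H x ^ (2 * (r + 1)) ∂Measure.pi μi ≤ (t * q ^ k * (j + 1)) ^ (2 * (r + 1)) := by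
  induction j generalizing k with
  | zero =>
    obtain rfl : k = d := by omega
    exact ⟨fun _ => t * q ^ k, BddAESM.const _, hsup, by simp⟩
  | succ j ih =>
    obtain ⟨H, hH, hle, hHp⟩ := ih (k + 1) (by omega) (by omega)
    have hg := bddAESM_tOp_hT hM (hmeas k hk (by omega))
    refine ⟨_, hg, ae_of_all _ fun x => le_rfl, ?_⟩
    have h1 := integral_posPart_sub_pow_le hg hH (by
      filter_upwards [hle] with x hx y
      exact (sum_sq_posPart_tOp_hT_sub_le hM k x y).trans
        (pow_le_pow_left₀ (tOp_hT_nonneg f (k + 1) x) hx 2)) hK hHp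
    have hstep : K * (t * q ^ (k + 1) * (j + 1)) ≤ t * q ^ k * (j + 1) := by
      calc K * (t * q ^ (k + 1) * (j + 1)) = (K * q) * (t * q ^ k * (j + 1)) := by ring
        _ ≤ 1 * (t * q ^ k * (j + 1)) := by gcongr
        _ = _ := one_mul _
    have h2 := h1.trans (pow_le_pow_left₀ (by positivity) hstep (2 * (r + 1)))
    push_cast
    refine integral_pow_le_of_le_add (s := (j : ℝ) + 1) (by positivity) (by positivity) hg
      (hg.sub (BddAESM.const _)).posPart (tOp_hT_nonneg f k) (fun x => le_max_right _ _)
      (fun x => ?_) h2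
    have h3 := hint k hk (by omega)
    have h4 := le_max_left (tOp (fun idx : Fin k → Fin n => hT f k idx x) -
      ∫ z, tOp (fun idx : Fin k → Fin n => hT f k idx z) ∂Measure.pi μi) 0
    linarith

/-- The upper tail at level `t` when all orders are bounded by `t * q ^ k`. -/
lemma upper_tail_le (hf : Measurable f) (hM : ∀ x, |f x| ≤ M) (hd : 1 ≤ d) (ht : 0 < t)
    (hq : 0 ≤ q) (hK0 : 0 ≤ K) (hK : K ^ 2 = 4 * ((r : ℝ) + 1)) (hKq : K * q * d ≤ 1 / 3)
    (hmeas : ∀ k, 1 ≤ k → k < d →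
      AEStronglyMeasurable (fun x => tOp (fun idx : Fin k → Fin n => hT f k idx x))
        (Measure.pi μi))
    (hint : ∀ k, 1 ≤ k → k < d →
      ∫ x, tOp (fun idx : Fin k → Fin n => hT f k idx x) ∂Measure.pi μi ≤ t * q ^ k)
    (hsup : ∀ᵐ x ∂Measure.pi μi, tOp (fun idx : Fin d → Fin n => hT f d idx x) ≤ t * q ^ d) :
    (Measure.pi μi).real {x | t ≤ f x - ∫ y, f y ∂Measure.pi μi} ≤
      Real.exp (-(2 * ((r : ℝ) + 1))) := by
  have hd' : (1 : ℝ) ≤ d := by exact_mod_cast hd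
  have hKq0 : 0 ≤ K * q := by positivity
  obtain ⟨H, hH, hle, hHp⟩ := exists_moment_bound hM ht.le hq hK0 hK (by nlinarith) hmeas hint hsup
    (d - 1) 1 le_rfl (by omega)
  have hfb : BddAESM (Measure.pi μi) f := ⟨hf.aestronglyMeasurable, M, hM⟩
  have h1 := integral_posPart_sub_pow_le hfb hH (by
    filter_upwards [hle] with x hx y
    exact (sum_sq_posPart_sub_le hM x y).trans
      (pow_le_pow_left₀ (tOp_hT_nonneg f 1 x) hx 2)) hK hHp
  have hcast : ((d - 1 : ℕ) : ℝ) + 1 = d := by rw [Nat.cast_sub hd]; simp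
  have hstep : K * (t * q ^ 1 * (((d - 1 : ℕ) : ℝ) + 1)) ≤ t * (1 / 3) := by
    rw [hcast]
    calc K * (t * q ^ 1 * d) = t * (K * q * d) := by ring
      _ ≤ t * (1 / 3) := by gcongr
  have h2 := h1.trans (pow_le_pow_left₀ (by positivity) hstep (2 * (r + 1)))
  have hF := (hfb.sub (BddAESM.const (∫ y, f y ∂Measure.pi μi))).posPart.pow (2 * (r + 1))
  have h3 := mul_meas_ge_le_integral_of_nonneg
    (ae_of_all _ fun x => pow_nonneg (le_max_right (f x - ∫ y, f y ∂Measure.pi μi) 0) _)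
    hF.integrable (t ^ (2 * (r + 1)))
  have hsub : (Measure.pi μi).real {x | t ≤ f x - ∫ y, f y ∂Measure.pi μi} ≤
      (Measure.pi μi).real {x | t ^ (2 * (r + 1)) ≤
        max (f x - ∫ y, f y ∂Measure.pi μi) 0 ^ (2 * (r + 1))} :=
    measureReal_mono fun x hx => pow_le_pow_left₀ ht.le (le_trans hx (le_max_left _ _)) _
  have htp : 0 < t ^ (2 * (r + 1)) := pow_pos ht _
  have h4 := h3.trans h2
  rw [mul_pow] at h4
  refine hsub.trans ((le_of_mul_le_mul_left h4 htp).trans ?_)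
  have he : (1 / 3 : ℝ) ≤ Real.exp (-1) := by
    rw [Real.exp_neg, ← one_div]
    exact one_div_le_one_div_of_le (Real.exp_pos 1) (by linarith [Real.exp_one_lt_d9])
  calc (1 / 3 : ℝ) ^ (2 * (r + 1)) ≤ Real.exp (-1) ^ (2 * (r + 1)) := by gcongr
    _ = Real.exp (-(2 * ((r : ℝ) + 1))) := by
      rw [← Real.exp_nat_mul]; push_cast; ring_nf

/-- Both tails together, with the exponential rate `V = q⁻²` normalised by the order. -/
lemma two_sided_tail_le (hf : Measurable f) (hM : ∀ x, |f x| ≤ M) (hd : 1 ≤ d) (ht : 0 < t)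
    {V : ℝ} (hV : 0 < V) (hq : 0 ≤ q) (hqV : q ^ 2 * V = 1)
    (hmeas : ∀ k, 1 ≤ k → k < d →
      AEStronglyMeasurable (fun x => tOp (fun idx : Fin k → Fin n => hT f k idx x))
        (Measure.pi μi))
    (hint : ∀ k, 1 ≤ k → k < d →
      ∫ x, tOp (fun idx : Fin k → Fin n => hT f k idx x) ∂Measure.pi μi ≤ t * q ^ k)
    (hsup : ∀ᵐ x ∂Measure.pi μi, tOp (fun idx : Fin d → Fin n => hT f d idx x) ≤ t * q ^ d) :
    (Measure.pi μi).real {x | t ≤ |f x - ∫ y, f y ∂Measure.pi μi|} ≤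
      2 * Real.exp (-(1 / (217 * (d : ℝ) ^ 2)) * V) := by
  have hd' : (1 : ℝ) ≤ d := by exact_mod_cast hd
  set s := V / (d : ℝ) ^ 2 with hs
  have hs0 : 0 < s := by positivity
  have hVs : -(1 / (217 * (d : ℝ) ^ 2)) * V = -(s / 217) := by rw [hs]; field_simp
  rw [hVs]
  rcases lt_or_ge s 36 with hlt | hge
  · refine (measureReal_le_one).trans ?_
    have := Real.add_one_le_exp (-(s / 217))
    linarith
  · obtain ⟨r, hr⟩ : ∃ r, ⌊s / 36⌋₊ = r + 1 := Nat.exists_eq_succ_of_ne_zero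
      (Nat.pos_iff_ne_zero.1 (Nat.floor_pos.2 (by linarith)))
    have hr1 : (r : ℝ) + 1 ≤ s / 36 := by
      have := Nat.floor_le (show 0 ≤ s / 36 by positivity)
      rw [hr] at this; exact_mod_cast this
    have hr2 : s / 36 < (r : ℝ) + 1 + 1 := by
      have := Nat.lt_floor_add_one (s / 36)
      rw [hr] at this; exact_mod_cast this
    set K := √(4 * ((r : ℝ) + 1)) with hKdef
    have hK : K ^ 2 = 4 * ((r : ℝ) + 1) := Real.sq_sqrt (by positivity)
    have hK0 : 0 ≤ K := Real.sqrt_nonneg _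
    have hKq : K * q * d ≤ 1 / 3 := by
      refine (abs_le_of_sq_le_sq' ?_ (by norm_num)).2
      have hsd : s * (d : ℝ) ^ 2 = V := by rw [hs]; field_simp
      calc (K * q * d) ^ 2 = 4 * ((r : ℝ) + 1) * (q ^ 2 * (d : ℝ) ^ 2) := by
            rw [mul_pow, mul_pow, hK]; ring
        _ ≤ 4 * (s / 36) * (q ^ 2 * (d : ℝ) ^ 2) := by gcongr
        _ = (q ^ 2 * (s * (d : ℝ) ^ 2)) / 9 := by ring
        _ = (1 / 3) ^ 2 := by rw [hsd, hqV]; norm_num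
    have hup := upper_tail_le hf hM hd ht hq hK0 hK hKq hmeas hint hsup
    have hlo := upper_tail_le (f := fun x => -f x) hf.neg (fun x => by simpa using hM x) hd ht hq
      hK0 hK hKq (by simpa only [hT_neg] using hmeas) (by simpa only [hT_neg] using hint)
      (by simpa only [hT_neg] using hsup)
    have hsub : {x | t ≤ |f x - ∫ y, f y ∂Measure.pi μi|} ⊆
        {x | t ≤ f x - ∫ y, f y ∂Measure.pi μi} ∪
          {x | t ≤ -f x - ∫ y, -f y ∂Measure.pi μi} := by
      intro x hx
      rcases le_abs.1 (show t ≤ |f x - ∫ y, f y ∂Measure.pi μi| from hx) with h | h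
      · exact Or.inl h
      · refine Or.inr ?_
        show t ≤ -f x - ∫ y, -f y ∂Measure.pi μi
        rw [integral_neg]
        linarith
    have he : Real.exp (-(2 * ((r : ℝ) + 1))) ≤ Real.exp (-(s / 217)) := by
      apply Real.exp_le_exp.2
      have : (0 : ℝ) ≤ r := Nat.cast_nonneg r
      linarith
    have := (measureReal_mono hsub).trans (measureReal_union_le (μ := Measure.pi μi) _ _)
    linarith

lemma le_mul_pow_of_le_rpow {N V : ℝ} {k : ℕ} (hk : 1 ≤ k) (ht : 0 ≤ t) (hN : 0 ≤ N) (hV : 0 < V)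
    (h : V ≤ (t / N) ^ ((2 : ℝ) / k)) : 0 < t ∧ 0 < N ∧ N ≤ t * (√V)⁻¹ ^ k := by
  have hk' : (k : ℝ) ≠ 0 := by positivity
  have hne : t / N ≠ 0 := by
    intro h0
    rw [h0, Real.zero_rpow (by positivity)] at h
    linarith
  have ht' : 0 < t := lt_of_le_of_ne ht fun h0 => hne (by rw [← h0, zero_div])
  have hN' : 0 < N := lt_of_le_of_ne hN fun h0 => hne (by rw [← h0, div_zero])
  refine ⟨ht', hN', ?_⟩
  have hb : 0 ≤ t / N := by positivity
  have hsq : (√V ^ k) ^ 2 ≤ (t / N) ^ 2 := by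
    calc (√V ^ k) ^ 2 = V ^ k := by rw [← pow_mul, mul_comm, pow_mul, Real.sq_sqrt hV.le]
      _ ≤ ((t / N) ^ ((2 : ℝ) / k)) ^ k := by gcongr
      _ = (t / N) ^ 2 := by
        rw [← Real.rpow_natCast, ← Real.rpow_mul hb, div_mul_cancel₀ _ hk']
        exact_mod_cast Real.rpow_natCast (t / N) 2
  have h1 := (abs_le_of_sq_le_sq' hsq hb).2
  have hp : 0 < √V ^ k := pow_pos (Real.sqrt_pos.2 hV) k
  rw [le_div_iff₀ hN'] at h1
  rw [inv_pow, ← div_eq_mul_inv, le_div_iff₀ hp]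
  linarith

end Tail

/-- multilevel concentration for bounded functionals of independent random
variables (Theorem 1 / `theorem:Lpnormestimates`). -/
theorem stmt0 {n : ℕ} {𝒳 : Fin n → Type*} [∀ i, MeasurableSpace (𝒳 i)]
    (μi : ∀ i, Measure (𝒳 i)) (hμi : ∀ i, IsProbabilityMeasure (μi i))
    (f : (∀ i, 𝒳 i) → ℝ) (hf : Measurable f) (hbd : ∃ M, ∀ x, |f x| ≤ M)
    (d : ℕ) (hd : 1 ≤ d) (t : ℝ) (ht : 0 ≤ t) :
    (Measure.pi μi) {x | t ≤ |f x - ∫ y, f y ∂(Measure.pi μi)|} ≤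
      ENNReal.ofReal (2 * Real.exp (-(1 / (217 * (d : ℝ) ^ 2)) *
        (Finset.Icc 1 d).inf' ⟨d, Finset.mem_Icc.mpr ⟨hd, le_rfl⟩⟩ (fun k =>
          (t / (if k = d
            then (eLpNorm (fun x => tOp (fun idx : Fin d → Fin n => hT f d idx x)) ⊤
                    (Measure.pi μi)).toReal
            else ∫ x, tOp (fun idx : Fin k → Fin n => hT f k idx x) ∂(Measure.pi μi))) ^
              ((2 : ℝ) / k)))) := by
  have := hμi
  obtain ⟨M, hM⟩ := hbd
  set N : ℕ → ℝ := fun k => if k = d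
      then (eLpNorm (fun x => tOp (fun idx : Fin d → Fin n => hT f d idx x)) ⊤
        (Measure.pi μi)).toReal
      else ∫ x, tOp (fun idx : Fin k → Fin n => hT f k idx x) ∂(Measure.pi μi) with hN
  have hN0 : ∀ k, 0 ≤ N k := fun k => by
    simp only [hN]
    split_ifs
    · exact ENNReal.toReal_nonneg
    · exact integral_nonneg fun x => tOp_hT_nonneg f k x
  set V := (Finset.Icc 1 d).inf' ⟨d, Finset.mem_Icc.mpr ⟨hd, le_rfl⟩⟩
    fun k => (t / N k) ^ ((2 : ℝ) / k) with hVdef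
  rcases le_or_gt V 0 with hV | hV
  · refine prob_le_one.trans (ENNReal.one_le_ofReal.2 ?_)
    have h1 : 0 ≤ -(1 / (217 * (d : ℝ) ^ 2)) * V :=
      mul_nonneg_of_nonpos_of_nonpos (neg_nonpos.2 (by positivity)) hV
    linarith [Real.one_le_exp h1]
  · have hkey : ∀ k, 1 ≤ k → k ≤ d → 0 < t ∧ 0 < N k ∧ N k ≤ t * (√V)⁻¹ ^ k :=
      fun k hk hkd => le_mul_pow_of_le_rpow hk ht (hN0 k) hV
        (Finset.inf'_le _ (Finset.mem_Icc.2 ⟨hk, hkd⟩))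
    have hNlt : ∀ k, k < d →
        N k = ∫ x, tOp (fun idx : Fin k → Fin n => hT f k idx x) ∂(Measure.pi μi) :=
      fun k hk => if_neg hk.ne
    have hsup : ∀ᵐ x ∂Measure.pi μi, tOp (fun idx : Fin d → Fin n => hT f d idx x) ≤ N d := by
      rw [show N d = _ from if_pos rfl, eLpNorm_exponent_top]
      have hfin := eLpNormEssSup_lt_top_of_ae_bound (μ := Measure.pi μi)
        (ae_of_all _ fun x => (Real.norm_of_nonneg (tOp_hT_nonneg f d x)).trans_le
          (tOp_hT_le hM d x))
      filter_upwards [ae_le_eLpNormEssSup (μ := Measure.pi μi)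
        (f := fun x => tOp (fun idx : Fin d → Fin n => hT f d idx x))] with x hx
      have h1 := ENNReal.toReal_mono hfin.ne hx
      rwa [toReal_enorm, Real.norm_of_nonneg (tOp_hT_nonneg f d x)] at h1
    have hreal := two_sided_tail_le (μi := μi) hf hM hd (hkey d hd le_rfl).1 hV
      (inv_nonneg.2 (Real.sqrt_nonneg V))
      (by rw [inv_pow, Real.sq_sqrt hV.le, inv_mul_cancel₀ hV.ne'])
      (fun k hk hkd => by
        by_contra hna
        have := (hkey k hk hkd.le).2.1
        rw [hNlt k hkd, integral_non_aestronglyMeasurable hna] at this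
        exact this.false)
      (fun k hk hkd => hNlt k hkd ▸ (hkey k hk hkd.le).2.2)
      (hsup.mono fun x hx => hx.trans (hkey d hd le_rfl).2.2)
    rw [← ofReal_measureReal (μ := Measure.pi μi)]
    exact ENNReal.ofReal_le_ofReal hreal
end

section
/- Let X_1,…,X_n be independent random variables with 𝔼X_i = 0, 𝔼X_i² = 1 and |X_i| ≤ M almost surely, let a_{ij} ∈ ℝ for i < j, and let f(X) = Σ_{i<j} a_{ij} X_i X_j = XᵀAX, where A is the symmetric matrix with zero diagonal and entries A_{ij} = a_{ij}/2 for i < j. Let A^{abs} be the matrix with entries (A^{abs})_{ij} = |a_{ij}| for i ≠ j and zero diagonal. Then with C = 217·2² = 868, for all t ≥ 0, ℙ(|f(X) − 𝔼f(X)| ≥ t) ≤ 2 exp( −(1/(C M²)) · min( t² / |A|_HS² , t / |A^{abs}|_op ) ). -/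
open MeasureTheory Finset Real

noncomputable section

/-- Operator norm of an `n × n` matrix as a bilinear form over Euclidean unit balls. -/
def mOp {n : ℕ} (A : Fin n → Fin n → ℝ) : ℝ :=
  ⨆ vw : {vw : (Fin n → ℝ) × (Fin n → ℝ) // (∑ i, vw.1 i ^ 2 ≤ 1) ∧ (∑ i, vw.2 i ^ 2 ≤ 1)},
    ∑ i, ∑ j, vw.1.1 i * vw.1.2 j * A i j

/-- The symmetric matrix `A` with zero diagonal and `A_{ij} = a_{ij}/2` for `i < j`. -/
def Amat {n : ℕ} (a : Fin n → Fin n → ℝ) (i j : Fin n) : ℝ :=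
  if i < j then a i j / 2 else if j < i then a j i / 2 else 0

/-- The matrix `A^{abs}` with zero diagonal and entries `|a_{ij}|` off the diagonal. -/
def Aabs {n : ℕ} (a : Fin n → Fin n → ℝ) (i j : Fin n) : ℝ :=
  if i < j then |a i j| else if j < i then |a j i| else 0

section ProductMeasure

variable {ι : Type*} [Fintype ι] [DecidableEq ι]

/-- Coordinatewise exponential moment bounds tensorize, conditionally on the coordinates
outside `I`. -/
theorem lintegral_exp_sum_le (μ : ι → Measure ℝ) [∀ i, IsProbabilityMeasure (μ i)] (I : Finset ι)
    (φ : ι → (ι → ℝ) → ℝ → ℝ) (ψ : ι → (ι → ℝ) → ℝ)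
    (hφm : ∀ i, Measurable fun x ↦ φ i x (x i)) (hψm : ∀ i, Measurable (ψ i))
    (hle : ∀ i ∈ I, ∀ x, ∫⁻ y, ENNReal.ofReal (rexp (φ i x y)) ∂μ i ≤
      ENNReal.ofReal (rexp (ψ i x)))
    (hφ : ∀ i ∈ I, ∀ k ∈ I, ∀ x y, φ i (Function.update x k y) = φ i x)
    (hψ : ∀ i ∈ I, ∀ k ∈ I, ∀ x y, ψ i (Function.update x k y) = ψ i x) :
    ∫⁻ x, ENNReal.ofReal (rexp (∑ i ∈ I, φ i x (x i))) ∂Measure.pi μ ≤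
      ∫⁻ x, ENNReal.ofReal (rexp (∑ i ∈ I, ψ i x)) ∂Measure.pi μ := by
  suffices H : ∀ s ⊆ I, ∀ g : (ι → ℝ) → ℝ, Measurable g →
      (∀ k ∈ s, ∀ x y, g (Function.update x k y) = g x) →
      ∫⁻ x, ENNReal.ofReal (rexp (g x + ∑ i ∈ s, φ i x (x i))) ∂Measure.pi μ ≤
        ∫⁻ x, ENNReal.ofReal (rexp (g x + ∑ i ∈ s, ψ i x)) ∂Measure.pi μ by
    simpa using H I subset_rfl (fun _ ↦ 0) measurable_const (by simp)
  intro s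
  induction s using Finset.induction_on with
  | empty => intros; simp
  | insert a s ha ih =>
    intro hs g hg hgs
    have haI : a ∈ I := hs (mem_insert_self a s)
    have hsI : s ⊆ I := fun i hi ↦ hs (mem_insert_of_mem hi)
    have hsm : Measurable fun x ↦ ∑ i ∈ s, ψ i x := Finset.measurable_sum s fun i _ ↦ hψm i
    have h1 := ih hsI (fun x ↦ g x + φ a x (x a)) (hg.add (hφm a)) (by
      intro k hk x y
      have hka : a ≠ k := fun h ↦ ha (h ▸ hk)
      simp only [hgs k (mem_insert_of_mem hk), hφ a haI k (hsI hk),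
        Function.update_of_ne hka])
    simp only [sum_insert ha, ← add_assoc]
    refine h1.trans ?_
    refine lintegral_le_of_lmarginal_le {a} ?_ ?_ ?_
    · exact ENNReal.measurable_ofReal.comp
        (measurable_exp.comp ((hg.add (hφm a)).add hsm))
    · exact ENNReal.measurable_ofReal.comp
        (measurable_exp.comp ((hg.add (hψm a)).add hsm))
    · intro x
      simp only [lmarginal_singleton]
      have hs' : ∀ y, ∑ i ∈ s, ψ i (Function.update x a y) = ∑ i ∈ s, ψ i x := fun y ↦
        sum_congr rfl fun i hi ↦ hψ i (hsI hi) a haI x y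
      simp only [hgs a (mem_insert_self a s), hφ a haI a haI, hψ a haI a haI, hs',
        Function.update_self]
      have hsplit : ∀ u v w : ℝ, ENNReal.ofReal (rexp (u + v + w)) =
          ENNReal.ofReal (rexp (u + w)) * ENNReal.ofReal (rexp v) := fun u v w ↦ by
        rw [← ENNReal.ofReal_mul (exp_pos _).le, ← exp_add]
        congr 2
        ring
      simp only [hsplit _ (φ a x _), hsplit _ (ψ a x)]
      rw [lintegral_const_mul' _ _ ENNReal.ofReal_ne_top, lintegral_const, measure_univ, mul_one]
      exact mul_le_mul_right (hle a haI x) _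

/-- A uniformly random subset separates two distinct points `i`, `j` with `i` inside with
probability `1/4`. -/
theorem four_mul_card_mem_notMem {i j : ι} (hij : i ≠ j) :
    4 * ∑ I : Finset ι, (if i ∈ I ∧ j ∉ I then (1 : ℝ) else 0) = 2 ^ Fintype.card ι := by
  have h := Fintype.prod_add (fun k : ι ↦ if k = j then (0 : ℝ) else 1)
    (fun k ↦ if k = i then (0 : ℝ) else 1)
  have h2 : ∀ I : Finset ι, (∏ k ∈ I, if k = j then (0 : ℝ) else 1) *
      (∏ k ∈ Iᶜ, if k = i then (0 : ℝ) else 1) = if i ∈ I ∧ j ∉ I then (1 : ℝ) else 0 := by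
    intro I
    have e1 : (∏ k ∈ I, if k = j then (0 : ℝ) else 1) = if j ∈ I then 0 else 1 := by
      rw [prod_ite_eq' I j fun _ ↦ (0 : ℝ)]
    have e2 : (∏ k ∈ Iᶜ, if k = i then (0 : ℝ) else 1) = if i ∈ Iᶜ then 0 else 1 := by
      rw [prod_ite_eq' Iᶜ i fun _ ↦ (0 : ℝ)]
    rw [e1, e2]
    by_cases h1 : i ∈ I <;> by_cases h2 : j ∈ I <;> simp [h1, h2]
  have h3 : ∀ k : ι, ((if k = j then (0 : ℝ) else 1) + if k = i then (0 : ℝ) else 1) =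
      2 * ((if k = j then (1 / 2 : ℝ) else 1) * if k = i then (1 / 2 : ℝ) else 1) := by
    intro k
    by_cases h1 : k = i <;> by_cases h2 : k = j <;> simp [h1, h2] <;> grind
  simp only [h2] at h
  simp only [h3, prod_mul_distrib, prod_ite_eq', prod_const] at h
  rw [← h]
  simp
  ring

/-- Decoupling of off-diagonal quadratic forms inside the exponential. -/
theorem exists_decoupling (μ : Measure (ι → ℝ)) (G : ι → ι → ℝ) :
    ∃ I : Finset ι,
      ∫⁻ x, ENNReal.ofReal (rexp (∑ i, ∑ j, if i = j then 0 else G i j * x i * x j)) ∂μ ≤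
      ∫⁻ x, ENNReal.ofReal (rexp (∑ i ∈ I, (4 * ∑ j ∈ Iᶜ, G i j * x j) * x i)) ∂μ := by
  obtain ⟨I, -, hI⟩ := Finset.exists_max_image (univ : Finset (Finset ι))
    (fun I ↦ ∫⁻ x, ENNReal.ofReal (rexp (∑ i ∈ I, (4 * ∑ j ∈ Iᶜ, G i j * x j) * x i)) ∂μ)
    ⟨∅, mem_univ _⟩
  refine ⟨I, ?_⟩
  set N : ℝ := 2 ^ Fintype.card ι with hN
  have hNpos : 0 < N := by positivity
  have hw : ∑ _J : Finset ι, N⁻¹ = 1 := by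
    simp [hN]
  have havg : ∀ x : ι → ℝ, (∑ i, ∑ j, if i = j then 0 else G i j * x i * x j) =
      ∑ J : Finset ι, N⁻¹ • ∑ i ∈ J, (4 * ∑ j ∈ Jᶜ, G i j * x j) * x i := by
    intro x
    have hJ : ∀ J : Finset ι, ∑ i ∈ J, (4 * ∑ j ∈ Jᶜ, G i j * x j) * x i =
        ∑ i, ∑ j, G i j * x i * x j * (4 * if i ∈ J ∧ j ∉ J then (1 : ℝ) else 0) := by
      intro J
      rw [← sum_subset (subset_univ J) fun i _ hi ↦ by simp [hi]]
      refine sum_congr rfl fun i hi ↦ ?_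
      rw [← sum_subset (subset_univ Jᶜ) fun j _ hj ↦ by simp_all, mul_sum, sum_mul]
      refine sum_congr rfl fun j hj ↦ ?_
      rw [if_pos ⟨hi, mem_compl.1 hj⟩]
      ring
    simp only [hJ, smul_eq_mul]
    rw [← mul_sum, sum_comm (s := (univ : Finset (Finset ι))), mul_sum]
    refine sum_congr rfl fun i _ ↦ ?_
    rw [sum_comm (s := (univ : Finset (Finset ι))), mul_sum]
    refine sum_congr rfl fun j _ ↦ ?_
    rw [← mul_sum, ← mul_sum]
    split_ifs with h
    · subst h; simp
    · rw [four_mul_card_mem_notMem h]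
      rw [← hN]
      field_simp
  have hle : ∀ x : ι → ℝ, ENNReal.ofReal
      (rexp (∑ i, ∑ j, if i = j then 0 else G i j * x i * x j)) ≤
      ∑ J : Finset ι, ENNReal.ofReal N⁻¹ *
        ENNReal.ofReal (rexp (∑ i ∈ J, (4 * ∑ j ∈ Jᶜ, G i j * x j) * x i)) := by
    intro x
    rw [havg]
    have h := convexOn_exp.map_sum_le (t := (univ : Finset (Finset ι))) (w := fun _ ↦ N⁻¹)
      (p := fun J ↦ ∑ i ∈ J, (4 * ∑ j ∈ Jᶜ, G i j * x j) * x i)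
      (fun _ _ ↦ by positivity) hw (fun _ _ ↦ Set.mem_univ _)
    refine (ENNReal.ofReal_le_ofReal h).trans ?_
    rw [ENNReal.ofReal_sum_of_nonneg fun _ _ ↦ by positivity]
    refine le_of_eq (sum_congr rfl fun J _ ↦ ?_)
    rw [smul_eq_mul, ENNReal.ofReal_mul (by positivity)]
  refine (lintegral_mono hle).trans ?_
  rw [lintegral_finsetSum _ fun J _ ↦ by fun_prop]
  calc _ = ∑ J : Finset ι, ENNReal.ofReal N⁻¹ * ∫⁻ x, ENNReal.ofReal
          (rexp (∑ i ∈ J, (4 * ∑ j ∈ Jᶜ, G i j * x j) * x i)) ∂μ :=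
        sum_congr rfl fun J _ ↦ lintegral_const_mul' _ _ ENNReal.ofReal_ne_top
    _ ≤ ∑ J : Finset ι, ENNReal.ofReal N⁻¹ * ∫⁻ x, ENNReal.ofReal
          (rexp (∑ i ∈ I, (4 * ∑ j ∈ Iᶜ, G i j * x j) * x i)) ∂μ := by
        exact sum_le_sum fun J _ ↦ mul_le_mul_right (hI J (mem_univ _)) _
    _ = _ := by
        rw [← sum_mul, ← ENNReal.ofReal_sum_of_nonneg fun _ _ ↦ by positivity, hw]
        simp

end ProductMeasure

section OneDimensional

variable (ν : Measure ℝ) [IsProbabilityMeasure ν] {M : ℝ}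

theorem lintegral_exp_mul_le (hmean : ∫ x, x ∂ν = 0) (hbdd : ∀ᵐ x ∂ν, |x| ≤ M) (c : ℝ) :
    ∫⁻ y, ENNReal.ofReal (rexp (c * y)) ∂ν ≤ ENNReal.ofReal (rexp (M ^ 2 / 2 * c ^ 2)) := by
  have h := ProbabilityTheory.hasSubgaussianMGF_of_mem_Icc_of_integral_eq_zero
    (μ := ν) (X := fun x ↦ x) (a := -M) (b := M) aemeasurable_id
    (hbdd.mono fun x hx ↦ abs_le.1 hx) hmean
  rw [← ofReal_integral_eq_lintegral_ofReal (h.integrable_exp_mul c)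
    (Filter.Eventually.of_forall fun _ ↦ (exp_pos _).le)]
  refine ENNReal.ofReal_le_ofReal ((h.mgf_le c).trans (exp_le_exp.2 (le_of_eq ?_)))
  have : (|M - -M| / 2) ^ 2 = M ^ 2 := by
    rw [div_pow, sq_abs]; ring
  simp only [NNReal.coe_pow, NNReal.coe_div, coe_nnnorm, norm_eq_abs, NNReal.coe_ofNat, this]
  ring

theorem lintegral_exp_mul_sq_le (hvar : ∫ x, x ^ 2 ∂ν = 1) (hbdd : ∀ᵐ x ∂ν, |x| ≤ M)
    {u : ℝ} (hu : 0 ≤ u) (huM : u * M ^ 2 ≤ 1) :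
    ∫⁻ y, ENNReal.ofReal (rexp (u * y ^ 2)) ∂ν ≤ ENNReal.ofReal (rexp (2 * u)) := by
  have hint : Integrable (fun x : ℝ ↦ x ^ 2) ν := by
    by_contra h
    simp [integral_undef h] at hvar
  have hle : ∀ᵐ y ∂ν, ENNReal.ofReal (rexp (u * y ^ 2)) ≤
      ENNReal.ofReal (1 + 2 * u * y ^ 2) := by
    filter_upwards [hbdd] with y hy
    refine ENNReal.ofReal_le_ofReal ?_
    have hy2 : y ^ 2 ≤ M ^ 2 := sq_le_sq' (abs_le.1 hy).1 (abs_le.1 hy).2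
    have h0 : 0 ≤ u * y ^ 2 := by positivity
    have h1 : u * y ^ 2 ≤ 1 := (mul_le_mul_of_nonneg_left hy2 hu).trans huM
    have h2 := (abs_le.1 (abs_exp_sub_one_sub_id_le (x := u * y ^ 2)
      (by rwa [abs_of_nonneg h0]))).2
    nlinarith
  refine (lintegral_mono_ae hle).trans ?_
  rw [← ofReal_integral_eq_lintegral_ofReal (f := fun y ↦ 1 + 2 * u * y ^ 2)
    ((integrable_const _).add (hint.const_mul _)) (Filter.Eventually.of_forall fun y ↦ by dsimp; positivity),
    integral_add (integrable_const _) (hint.const_mul _), integral_const_mul, hvar]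
  refine ENNReal.ofReal_le_ofReal ?_
  simpa [add_comm] using add_one_le_exp (2 * u)

end OneDimensional

theorem ae_pi_abs_le {ι : Type*} [Fintype ι] (μ : ι → Measure ℝ) [∀ i, IsProbabilityMeasure (μ i)]
    {M : ℝ} (hbdd : ∀ i, ∀ᵐ x ∂μ i, |x| ≤ M) : ∀ᵐ x ∂Measure.pi μ, ∀ i, |x i| ≤ M :=
  ae_all_iff.2 fun i ↦ (measurePreserving_eval μ i).quasiMeasurePreserving.ae (hbdd i)

section QuadraticForm

variable {ι : Type*} [Fintype ι] [DecidableEq ι] (μ : ι → Measure ℝ)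
  [∀ i, IsProbabilityMeasure (μ i)] {M : ℝ}

/-- Exponential moments of off-diagonal quadratic forms in centered bounded variables are
controlled by those of a sum of squares of linear forms. -/
theorem exists_lintegral_exp_offDiag_le (hmean : ∀ i, ∫ x, x ∂μ i = 0)
    (hbdd : ∀ i, ∀ᵐ x ∂μ i, |x| ≤ M) (G : ι → ι → ℝ) :
    ∃ I : Finset ι, ∫⁻ x, ENNReal.ofReal
        (rexp (∑ i, ∑ j, if i = j then 0 else G i j * x i * x j)) ∂Measure.pi μ ≤
      ∫⁻ x, ENNReal.ofReal
        (rexp (8 * M ^ 2 * ∑ i ∈ I, (∑ j ∈ Iᶜ, G i j * x j) ^ 2)) ∂Measure.pi μ := by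
  obtain ⟨I, hI⟩ := exists_decoupling (Measure.pi μ) G
  refine ⟨I, hI.trans ?_⟩
  have hupd : ∀ i, ∀ k ∈ I, ∀ (x : ι → ℝ) (y : ℝ),
      ∑ j ∈ Iᶜ, G i j * Function.update x k y j = ∑ j ∈ Iᶜ, G i j * x j := by
    intro i k hk x y
    refine sum_congr rfl fun j hj ↦ ?_
    rw [Function.update_of_ne]
    rintro rfl
    exact (mem_compl.1 hj) hk
  refine (lintegral_exp_sum_le μ I (fun i x y ↦ (4 * ∑ j ∈ Iᶜ, G i j * x j) * y)
    (fun i x ↦ M ^ 2 / 2 * (4 * ∑ j ∈ Iᶜ, G i j * x j) ^ 2) (fun i ↦ by fun_prop)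
    (fun i ↦ by fun_prop) (fun i _ x ↦ lintegral_exp_mul_le _ (hmean i) (hbdd i) _)
    (fun i _ k hk x y ↦ by simp only [hupd i k hk])
    (fun i _ k hk x y ↦ by simp only [hupd i k hk])).trans (le_of_eq ?_)
  refine lintegral_congr fun x ↦ ?_
  rw [mul_sum]
  congr 2
  refine sum_congr rfl fun i _ ↦ ?_
  ring

theorem sum_sq_sum_finset_le {A : ι → ι → ℝ} {κ : ℝ}
    (hop : ∀ x : ι → ℝ, ∑ i, (∑ j, A i j * x j) ^ 2 ≤ κ * ∑ j, x j ^ 2)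
    (J : Finset ι) (x : ι → ℝ) :
    ∑ i, (∑ j ∈ J, A i j * x j) ^ 2 ≤ κ * ∑ j ∈ J, x j ^ 2 := by
  simpa [sum_ite_mem] using hop fun j ↦ if j ∈ J then x j else 0

/-- Expansion of `|A P_J x|²` into its diagonal and off-diagonal parts. -/
theorem sum_sq_sum_eq_diag_add_offDiag (A : ι → ι → ℝ) (J : Finset ι) (x : ι → ℝ) :
    ∑ k, (∑ j ∈ J, A k j * x j) ^ 2 = ∑ i ∈ J, (∑ k, A k i ^ 2) * x i ^ 2 +
      ∑ i, ∑ j, if i = j then 0 else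
        (if i ∈ J ∧ j ∈ J then ∑ k, A k i * A k j else 0) * x i * x j := by
  have h1 : ∑ k, (∑ j ∈ J, A k j * x j) ^ 2 =
      ∑ i, ∑ j, (if i ∈ J ∧ j ∈ J then ∑ k, A k i * A k j else 0) * x i * x j := by
    simp only [sq, sum_mul_sum]
    rw [sum_comm, ← sum_subset (subset_univ J) fun i _ hi ↦ by simp [hi]]
    refine sum_congr rfl fun i hi ↦ ?_
    rw [sum_comm, ← sum_subset (subset_univ J) fun j _ hj ↦ by simp [hj]]
    refine sum_congr rfl fun j hj ↦ ?_
    rw [if_pos ⟨hi, hj⟩, sum_mul, sum_mul]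
    exact sum_congr rfl fun k _ ↦ by ring
  have h2 : ∑ i ∈ J, (∑ k, A k i ^ 2) * x i ^ 2 =
      ∑ i, ∑ j, if i = j then
        (if i ∈ J ∧ j ∈ J then ∑ k, A k i * A k j else 0) * x i * x j else 0 := by
    simp only [sum_ite_eq, mem_univ, if_true, and_self]
    rw [← sum_subset (subset_univ J) fun i _ hi ↦ by simp [hi]]
    refine sum_congr rfl fun i hi ↦ ?_
    rw [if_pos hi]
    simp only [sq]
    ring
  rw [h1, h2, ← sum_add_distrib]
  refine sum_congr rfl fun i _ ↦ ?_
  rw [← sum_add_distrib]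
  refine sum_congr rfl fun j _ ↦ ?_
  split_ifs <;> simp

/-- Exponential moments of `|A P_J x|²` for bounded centered variables of unit variance. -/
theorem lintegral_exp_sum_sq_le (hmean : ∀ i, ∫ x, x ∂μ i = 0)
    (hvar : ∀ i, ∫ x, x ^ 2 ∂μ i = 1) (hbdd : ∀ i, ∀ᵐ x ∂μ i, |x| ≤ M)
    {A : ι → ι → ℝ} (hA : ∀ i j, A i j = A j i) {κ : ℝ} (hκ : 0 ≤ κ)
    (hop : ∀ x : ι → ℝ, ∑ i, (∑ j, A i j * x j) ^ 2 ≤ κ * ∑ j, x j ^ 2)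
    {θ : ℝ} (hθ : 0 ≤ θ) (hθκ : 32 * θ * M ^ 2 * κ ≤ 1) (J : Finset ι) :
    ∫⁻ x, ENNReal.ofReal (rexp (θ * ∑ k, (∑ j ∈ J, A k j * x j) ^ 2)) ∂Measure.pi μ ≤
      ENNReal.ofReal (rexp (4 * θ * ∑ i, ∑ j, A i j ^ 2)) := by
  set Φ : Finset ι → ENNReal := fun J ↦
    ∫⁻ x, ENNReal.ofReal (rexp (θ * ∑ k, (∑ j ∈ J, A k j * x j) ^ 2)) ∂Measure.pi μ with hΦ
  obtain ⟨J₀, -, hJ₀⟩ := Finset.exists_max_image (univ : Finset (Finset ι)) Φ ⟨∅, mem_univ _⟩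
  refine (hJ₀ J (mem_univ _)).trans ?_
  have hfin : Φ J₀ ≠ ⊤ := by
    refine ne_top_of_le_ne_top
      (ENNReal.ofReal_ne_top (r := rexp (θ * (κ * ∑ j ∈ J₀, M ^ 2)))) ?_
    have : ∀ᵐ x ∂Measure.pi μ,
        ENNReal.ofReal (rexp (θ * ∑ k, (∑ j ∈ J₀, A k j * x j) ^ 2)) ≤
          ENNReal.ofReal (rexp (θ * (κ * ∑ j ∈ J₀, M ^ 2))) := by
      filter_upwards [ae_pi_abs_le μ hbdd] with x hx
      gcongr
      refine (sum_sq_sum_finset_le hop J₀ x).trans ?_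
      gcongr κ * ∑ j ∈ J₀, ?_ with j
      exact sq_le_sq' (abs_le.1 (hx j)).1 (abs_le.1 (hx j)).2
    exact (lintegral_mono_ae this).trans (by simp)
  set K : ι → ι → ℝ := fun i j ↦ if i ∈ J₀ ∧ j ∈ J₀ then ∑ k, A k i * A k j else 0 with hK
  have hdiag : ∫⁻ x, ENNReal.ofReal
      (rexp (∑ i ∈ J₀, 2 * θ * (∑ k, A k i ^ 2) * x i ^ 2)) ∂Measure.pi μ ≤
      ENNReal.ofReal (rexp (4 * θ * ∑ i, ∑ j, A i j ^ 2)) := by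
    refine (lintegral_exp_sum_le μ J₀ (fun i _ y ↦ 2 * θ * (∑ k, A k i ^ 2) * y ^ 2)
      (fun i _ ↦ 2 * (2 * θ * ∑ k, A k i ^ 2)) (fun i ↦ by fun_prop) (fun i ↦ by fun_prop)
      (fun i _ _ ↦ lintegral_exp_mul_sq_le _ (hvar i) (hbdd i) (by positivity) ?_)
      (fun _ _ _ _ _ _ ↦ rfl) (fun _ _ _ _ _ _ ↦ rfl)).trans ?_
    · have h := hop (Pi.single i 1)
      simp only [Pi.single_apply, mul_ite, mul_one, mul_zero, sum_ite_eq', mem_univ, if_true,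
        ite_pow, one_pow, ne_eq, OfNat.ofNat_ne_zero, not_false_eq_true, zero_pow] at h
      have h2 : θ * M ^ 2 * ∑ k, A k i ^ 2 ≤ θ * M ^ 2 * κ := by gcongr
      have h3 : 0 ≤ θ * M ^ 2 * κ := by positivity
      linarith
    · rw [lintegral_const, measure_univ, mul_one]
      gcongr
      rw [sum_comm, mul_sum]
      refine (sum_le_univ_sum_of_nonneg fun i ↦ by positivity).trans (le_of_eq ?_)
      exact sum_congr rfl fun i _ ↦ by ring
  have hoff : ∫⁻ x, ENNReal.ofReal
      (rexp (∑ i, ∑ j, if i = j then 0 else 2 * θ * K i j * x i * x j)) ∂Measure.pi μ ≤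
      Φ J₀ := by
    obtain ⟨I, hI⟩ := exists_lintegral_exp_offDiag_le μ hmean hbdd fun i j ↦ 2 * θ * K i j
    refine hI.trans (le_trans (lintegral_mono fun x ↦ ?_) (hJ₀ (J₀ \ I) (mem_univ _)))
    refine ENNReal.ofReal_le_ofReal (exp_le_exp.2 ?_)
    set y : ι → ℝ := fun k ↦ ∑ j ∈ J₀ \ I, A k j * x j with hy
    have hrow : ∀ i ∈ I, (∑ j ∈ Iᶜ, 2 * θ * K i j * x j) ^ 2 ≤
        4 * θ ^ 2 * (∑ k, A i k * y k) ^ 2 := by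
      intro i _
      by_cases hi : i ∈ J₀
      · refine le_of_eq ?_
        have : ∑ j ∈ Iᶜ, 2 * θ * K i j * x j = 2 * θ * ∑ k, A i k * y k := by
          have hsub : J₀ \ I ⊆ Iᶜ := fun j hj ↦ mem_compl.2 (mem_sdiff.1 hj).2
          rw [← sum_subset hsub fun j hj hj' ↦ by
            have : j ∉ J₀ := fun h ↦ hj' (mem_sdiff.2 ⟨h, mem_compl.1 hj⟩)
            simp [hK, this]]
          simp only [hy, mul_sum]
          rw [sum_comm]
          refine sum_congr rfl fun j hj ↦ ?_
          simp only [hK]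
          rw [if_pos ⟨hi, (mem_sdiff.1 hj).1⟩, mul_sum, sum_mul]
          refine sum_congr rfl fun k _ ↦ ?_
          rw [hA i k]
          ring
        rw [this]
        ring
      · simp only [hK, hi, false_and, if_false, mul_zero, zero_mul, sum_const_zero]
        rw [zero_pow two_ne_zero]
        positivity
    have h0 : 0 ≤ ∑ k, y k ^ 2 := sum_nonneg fun k _ ↦ sq_nonneg _
    calc 8 * M ^ 2 * ∑ i ∈ I, (∑ j ∈ Iᶜ, 2 * θ * K i j * x j) ^ 2
        ≤ 8 * M ^ 2 * ∑ i, 4 * θ ^ 2 * (∑ k, A i k * y k) ^ 2 := by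
          gcongr
          exact (sum_le_sum hrow).trans (sum_le_univ_sum_of_nonneg fun i ↦ by positivity)
      _ = 32 * M ^ 2 * θ ^ 2 * ∑ i, (∑ k, A i k * y k) ^ 2 := by rw [← mul_sum]; ring
      _ ≤ 32 * M ^ 2 * θ ^ 2 * (κ * ∑ k, y k ^ 2) := by gcongr; exact hop y
      _ = (32 * θ * M ^ 2 * κ) * (θ * ∑ k, y k ^ 2) := by ring
      _ ≤ 1 * (θ * ∑ k, y k ^ 2) := by gcongr
      _ = _ := one_mul _
  have hsplit : ∀ x : ι → ℝ,
      2 * ENNReal.ofReal (rexp (θ * ∑ k, (∑ j ∈ J₀, A k j * x j) ^ 2)) ≤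
      ENNReal.ofReal (rexp (∑ i ∈ J₀, 2 * θ * (∑ k, A k i ^ 2) * x i ^ 2)) +
      ENNReal.ofReal (rexp (∑ i, ∑ j, if i = j then 0 else 2 * θ * K i j * x i * x j)) := by
    intro x
    have e1 : ∑ i ∈ J₀, 2 * θ * (∑ k, A k i ^ 2) * x i ^ 2 =
        2 * (θ * ∑ i ∈ J₀, (∑ k, A k i ^ 2) * x i ^ 2) := by
      simp only [mul_sum]
      exact sum_congr rfl fun i _ ↦ by simp only [mul_sum, sum_mul, mul_assoc]
    have e2 : (∑ i, ∑ j, if i = j then 0 else 2 * θ * K i j * x i * x j) =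
        2 * (θ * ∑ i, ∑ j, if i = j then 0 else K i j * x i * x j) := by
      simp only [mul_sum]
      exact sum_congr rfl fun i _ ↦ sum_congr rfl fun j _ ↦ by split_ifs <;> ring
    have hexp : ∀ a b : ℝ, 2 * rexp (a + b) ≤ rexp (2 * a) + rexp (2 * b) := fun a b ↦ by
      rw [exp_add, two_mul a, two_mul b, exp_add, exp_add]
      nlinarith [sq_nonneg (rexp a - rexp b)]
    rw [sum_sq_sum_eq_diag_add_offDiag, e1, e2, mul_add,
      ← ENNReal.ofReal_add (exp_pos _).le (exp_pos _).le, ← ENNReal.ofReal_ofNat 2,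
      ← ENNReal.ofReal_mul zero_le_two]
    exact ENNReal.ofReal_le_ofReal (hexp _ _)
  have hmeas : Measurable fun x : ι → ℝ ↦ ENNReal.ofReal
      (rexp (∑ i ∈ J₀, 2 * θ * (∑ k, A k i ^ 2) * x i ^ 2)) := by fun_prop
  have h2 : Φ J₀ + Φ J₀ ≤ ENNReal.ofReal (rexp (4 * θ * ∑ i, ∑ j, A i j ^ 2)) + Φ J₀ := by
    rw [← two_mul, hΦ, ← lintegral_const_mul' _ _ ENNReal.ofNat_ne_top]
    refine (lintegral_mono hsplit).trans ?_
    rw [lintegral_add_left hmeas]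
    exact add_le_add hdiag hoff
  exact (ENNReal.add_le_add_iff_right hfin).1 h2

/-- Moment generating function of an off-diagonal quadratic form. -/
theorem lintegral_exp_quadratic_le (hmean : ∀ i, ∫ x, x ∂μ i = 0)
    (hvar : ∀ i, ∫ x, x ^ 2 ∂μ i = 1) (hbdd : ∀ i, ∀ᵐ x ∂μ i, |x| ≤ M)
    {A : ι → ι → ℝ} (hA : ∀ i j, A i j = A j i) {κ : ℝ} (hκ : 0 ≤ κ)
    (hop : ∀ x : ι → ℝ, ∑ i, (∑ j, A i j * x j) ^ 2 ≤ κ * ∑ j, x j ^ 2)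
    {l : ℝ} (hl : 256 * l ^ 2 * M ^ 4 * κ ≤ 1) :
    ∫⁻ x, ENNReal.ofReal
        (rexp (∑ i, ∑ j, if i = j then 0 else l * A i j * x i * x j)) ∂Measure.pi μ ≤
      ENNReal.ofReal (rexp (32 * l ^ 2 * M ^ 2 * ∑ i, ∑ j, A i j ^ 2)) := by
  obtain ⟨I, hI⟩ := exists_lintegral_exp_offDiag_le μ hmean hbdd fun i j ↦ l * A i j
  have h := lintegral_exp_sum_sq_le μ hmean hvar hbdd hA hκ hop
    (θ := 8 * M ^ 2 * l ^ 2) (by positivity) (by linarith) Iᶜ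
  refine (hI.trans (lintegral_mono fun x ↦ ?_)).trans (h.trans (le_of_eq (by ring_nf)))
  refine ENNReal.ofReal_le_ofReal (exp_le_exp.2 ?_)
  rw [mul_assoc _ (l ^ 2)]
  gcongr
  rw [mul_sum]
  refine le_trans (le_of_eq ?_) (sum_le_univ_sum_of_nonneg (s := I) fun i ↦ by positivity)
  refine sum_congr rfl fun i _ ↦ ?_
  simp only [mul_assoc, ← mul_sum, mul_pow]

end QuadraticForm

section MatrixFacts

variable {n : ℕ}

theorem bddAbove_mOp (B : Fin n → Fin n → ℝ) :
    BddAbove (Set.range fun vw : {vw : (Fin n → ℝ) × (Fin n → ℝ) //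
      (∑ i, vw.1 i ^ 2 ≤ 1) ∧ (∑ i, vw.2 i ^ 2 ≤ 1)} ↦
        ∑ i, ∑ j, vw.1.1 i * vw.1.2 j * B i j) := by
  have hle : ∀ v : Fin n → ℝ, ∑ i, v i ^ 2 ≤ 1 → ∀ i, |v i| ≤ 1 := fun v hv i ↦
    (sq_le_one_iff_abs_le_one _).1
      ((single_le_sum (f := fun i ↦ v i ^ 2) (fun i _ ↦ sq_nonneg _) (mem_univ i)).trans hv)
  refine ⟨∑ i, ∑ j, |B i j|, ?_⟩
  rintro _ ⟨⟨⟨v, w⟩, hv, hw⟩, rfl⟩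
  refine sum_le_sum fun i _ ↦ sum_le_sum fun j _ ↦ (le_abs_self _).trans ?_
  rw [abs_mul, abs_mul]
  exact mul_le_of_le_one_left (abs_nonneg _)
    (mul_le_one₀ (hle v hv i) (abs_nonneg _) (hle w hw j))

theorem sum_mul_mul_le_mOp (B : Fin n → Fin n → ℝ) {v w : Fin n → ℝ}
    (hv : 0 < ∑ i, v i ^ 2) (hw : 0 < ∑ i, w i ^ 2) :
    ∑ i, ∑ j, v i * w j * B i j ≤ mOp B * (√(∑ i, v i ^ 2) * √(∑ i, w i ^ 2)) := by
  set a := √(∑ i, v i ^ 2) with ha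
  set b := √(∑ i, w i ^ 2) with hb
  have ha0 : 0 < a := sqrt_pos.2 hv
  have hb0 : 0 < b := sqrt_pos.2 hw
  have ha2 : ∑ i, v i ^ 2 = a ^ 2 := (sq_sqrt hv.le).symm
  have hb2 : ∑ i, w i ^ 2 = b ^ 2 := (sq_sqrt hw.le).symm
  have h := le_ciSup (bddAbove_mOp B) ⟨(fun i ↦ v i / a, fun i ↦ w i / b), by
    simp only [div_pow, ← sum_div, ha2]
    exact (div_self (by positivity)).le, by
    simp only [div_pow, ← sum_div, hb2]
    exact (div_self (by positivity)).le⟩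
  rw [← div_le_iff₀ (by positivity)]
  refine le_trans (le_of_eq ?_) h
  simp only [sum_div]
  refine sum_congr rfl fun i _ ↦ sum_congr rfl fun j _ ↦ ?_
  field_simp

/-- A matrix dominated entrywise by `B` has Euclidean operator norm at most `mOp B`. -/
theorem sum_sq_sum_le_mOp_sq {A B : Fin n → Fin n → ℝ} (hAB : ∀ i j, |A i j| ≤ B i j)
    (x : Fin n → ℝ) : ∑ i, (∑ j, A i j * x j) ^ 2 ≤ mOp B ^ 2 * ∑ j, x j ^ 2 := by
  set z : Fin n → ℝ := fun i ↦ ∑ j, A i j * x j with hz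
  have hZ0 : 0 ≤ ∑ i, z i ^ 2 := sum_nonneg fun i _ ↦ sq_nonneg _
  have hX0 : 0 ≤ ∑ i, x i ^ 2 := sum_nonneg fun i _ ↦ sq_nonneg _
  rcases hZ0.eq_or_lt with hZ | hZ
  · rw [← hZ]; positivity
  rcases hX0.eq_or_lt with hX | hX
  · have hx : ∀ j, x j = 0 := fun j ↦ by
      simpa using (sum_eq_zero_iff_of_nonneg fun i _ ↦ sq_nonneg (x i)).1 hX.symm j (mem_univ j)
    simp [hx]
  have h := sum_mul_mul_le_mOp B (v := fun i ↦ |z i|) (w := fun j ↦ |x j|)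
    (by simpa using hZ) (by simpa using hX)
  simp only [sq_abs] at h
  have h1 : ∑ i, z i ^ 2 ≤ ∑ i, ∑ j, |z i| * |x j| * B i j := by
    refine sum_le_sum fun i _ ↦ ?_
    have : z i ^ 2 = ∑ j, z i * x j * A i j := by
      rw [sq]
      nth_rewrite 2 [hz]
      rw [mul_sum]
      exact sum_congr rfl fun j _ ↦ by ring
    rw [this]
    refine sum_le_sum fun j _ ↦ (le_abs_self _).trans ?_
    rw [abs_mul, abs_mul]
    exact mul_le_mul_of_nonneg_left (hAB i j) (by positivity)
  have h2 := pow_le_pow_left₀ hZ.le (h1.trans h) 2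
  rw [mul_pow, mul_pow, sq_sqrt hZ0, sq_sqrt hX0, sq (∑ i, z i ^ 2)] at h2
  refine le_of_mul_le_mul_right (h2.trans (le_of_eq ?_)) hZ
  ring

theorem Amat_comm (a : Fin n → Fin n → ℝ) (i j : Fin n) : Amat a i j = Amat a j i := by
  unfold Amat
  grind

theorem abs_Amat_le_Aabs (a : Fin n → Fin n → ℝ) (i j : Fin n) : |Amat a i j| ≤ Aabs a i j := by
  unfold Amat Aabs
  split_ifs
  · rw [abs_div, abs_two]; linarith [abs_nonneg (a i j)]
  · rw [abs_div, abs_two]; linarith [abs_nonneg (a j i)]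
  · simp

theorem sum_Ioi_eq_sum_Amat (a : Fin n → Fin n → ℝ) (x : Fin n → ℝ) (l : ℝ) :
    (∑ i, ∑ j, if i = j then 0 else l * Amat a i j * x i * x j) =
      l * ∑ i, ∑ j ∈ Ioi i, a i j * x i * x j := by
  have h1 : ∑ i, ∑ j ∈ Ioi i, a i j * x i * x j =
      ∑ i, ∑ j, if i < j then a i j * x i * x j else 0 := by
    refine sum_congr rfl fun i _ ↦ ?_
    rw [← sum_filter]
    congr 1
    ext j
    simp
  have h2 : (∑ i, ∑ j, if i = j then 0 else l * Amat a i j * x i * x j) =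
      (∑ i, ∑ j, l / 2 * if i < j then a i j * x i * x j else 0) +
      ∑ i, ∑ j, l / 2 * if j < i then a j i * x j * x i else 0 := by
    rw [← sum_add_distrib]
    refine sum_congr rfl fun i _ ↦ ?_
    rw [← sum_add_distrib]
    refine sum_congr rfl fun j _ ↦ ?_
    unfold Amat
    rcases lt_trichotomy i j with h | h | h
    · simp only [h, h.ne, h.not_gt, if_true, if_false]; ring
    · simp [h]
    · simp only [h, h.ne', h.not_gt, if_true, if_false]; ring
  rw [h2, sum_comm (f := fun i j ↦ l / 2 * if j < i then a j i * x j * x i else 0), h1]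
  simp only [← mul_sum]
  ring

end MatrixFacts

theorem integral_sum_Ioi_eq_zero {n : ℕ} (μ : Fin n → Measure ℝ)
    [∀ i, IsProbabilityMeasure (μ i)] {M : ℝ} (hmean : ∀ i, ∫ x, x ∂μ i = 0)
    (hbdd : ∀ i, ∀ᵐ x ∂μ i, |x| ≤ M) (a : Fin n → Fin n → ℝ) :
    ∫ y, (∑ i, ∑ j ∈ Ioi i, a i j * y i * y j) ∂Measure.pi μ = 0 := by
  have hint : ∀ i j, Integrable (fun y : Fin n → ℝ ↦ a i j * y i * y j) (Measure.pi μ) := by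
    intro i j
    refine Integrable.of_bound (by fun_prop) (|a i j| * M * M) ?_
    filter_upwards [ae_pi_abs_le μ hbdd] with y hy
    have hM : 0 ≤ M := (abs_nonneg _).trans (hy i)
    rw [norm_eq_abs, abs_mul, abs_mul]
    gcongr
    · exact hy i
    · exact hy j
  rw [integral_finsetSum _ fun i _ ↦ integrable_finsetSum _ fun j _ ↦ hint i j]
  refine sum_eq_zero fun i _ ↦ ?_
  rw [integral_finsetSum _ fun j _ ↦ hint i j]
  refine sum_eq_zero fun j hj ↦ ?_
  have hind := (ProbabilityTheory.iIndepFun_pi (μ := μ) (X := fun _ x ↦ x)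
    fun _ ↦ aemeasurable_id).indepFun (mem_Ioi.1 hj).ne
  simp only [mul_assoc]
  rw [integral_const_mul, hind.integral_fun_mul_eq_mul_integral
    (measurable_pi_apply i).aestronglyMeasurable (measurable_pi_apply j).aestronglyMeasurable,
    integral_comp_eval (μ := μ) (i := i) (f := fun x ↦ x) measurable_id.aestronglyMeasurable,
    hmean]
  simp

/-- One-sided Chernoff bound for the off-diagonal quadratic form scaled by `l`. -/
theorem measure_le_quadratic_le {n : ℕ} (μ : Fin n → Measure ℝ)
    [∀ i, IsProbabilityMeasure (μ i)] {M : ℝ} (hmean : ∀ i, ∫ x, x ∂μ i = 0)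
    (hvar : ∀ i, ∫ x, x ^ 2 ∂μ i = 1) (hbdd : ∀ i, ∀ᵐ x ∂μ i, |x| ≤ M)
    (a : Fin n → Fin n → ℝ) {l : ℝ} (hl : 256 * l ^ 2 * M ^ 4 * mOp (Aabs a) ^ 2 ≤ 1) (r : ℝ) :
    Measure.pi μ {x | r ≤ l * ∑ i, ∑ j ∈ Ioi i, a i j * x i * x j} ≤
      ENNReal.ofReal (rexp (32 * l ^ 2 * M ^ 2 * ∑ i, ∑ j, Amat a i j ^ 2 - r)) := by
  have hmgf := lintegral_exp_quadratic_le μ hmean hvar hbdd (Amat_comm a) (sq_nonneg _)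
    (sum_sq_sum_le_mOp_sq (abs_Amat_le_Aabs a)) hl
  simp only [sum_Ioi_eq_sum_Amat] at hmgf
  refine (meas_le_lintegral₀ (f := fun x ↦ ENNReal.ofReal
    (rexp (l * ∑ i, ∑ j ∈ Ioi i, a i j * x i * x j)) * ENNReal.ofReal (rexp (-r)))
    (by fun_prop) fun x hx ↦ ?_).trans ?_
  · rw [← ENNReal.ofReal_mul (exp_pos _).le, ← exp_add, ENNReal.one_le_ofReal, one_le_exp_iff]
    have : r ≤ l * ∑ i, ∑ j ∈ Ioi i, a i j * x i * x j := hx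
    linarith
  · rw [lintegral_mul_const' _ _ ENNReal.ofReal_ne_top, sub_eq_add_neg, exp_add,
      ENNReal.ofReal_mul (exp_pos _).le]
    gcongr

/-- a Hanson–Wright type inequality for quadratic forms in independent
bounded random variables. -/
theorem stmt1 {n : ℕ} (μi : Fin n → Measure ℝ) (hprob : ∀ i, IsProbabilityMeasure (μi i))
    (M : ℝ) (hmean : ∀ i, ∫ x, x ∂(μi i) = 0) (hvar : ∀ i, ∫ x, x ^ 2 ∂(μi i) = 1)
    (hbdd : ∀ i, ∀ᵐ x ∂(μi i), |x| ≤ M)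
    (a : Fin n → Fin n → ℝ) (t : ℝ) (ht : 0 ≤ t) :
    (Measure.pi μi) {x | t ≤
        |(∑ i, ∑ j ∈ Finset.Ioi i, a i j * x i * x j) -
          ∫ y, (∑ i, ∑ j ∈ Finset.Ioi i, a i j * y i * y j) ∂(Measure.pi μi)|} ≤
      ENNReal.ofReal (2 * Real.exp (-(1 / (868 * M ^ 2)) *
        min (t ^ 2 / ∑ i, ∑ j, Amat a i j ^ 2) (t / mOp (Aabs a)))) := by
  rw [integral_sum_Ioi_eq_zero μi hmean hbdd a]
  simp only [sub_zero]
  set S := ∑ i, ∑ j, Amat a i j ^ 2 with hS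
  set L := mOp (Aabs a) with hL
  set m := min (t ^ 2 / S) (t / L) with hm
  have htriv : 1 / (868 * M ^ 2) * m ≤ 0 → (Measure.pi μi)
      {x | t ≤ |∑ i, ∑ j ∈ Finset.Ioi i, a i j * x i * x j|} ≤
      ENNReal.ofReal (2 * Real.exp (-(1 / (868 * M ^ 2)) * m)) := by
    intro h
    refine prob_le_one.trans (ENNReal.one_le_ofReal.2 ?_)
    have := one_le_exp (x := -(1 / (868 * M ^ 2)) * m) (by linarith)
    linarith
  have hc : 0 ≤ 1 / (868 * M ^ 2) := by positivity
  have hS0 : 0 ≤ S := sum_nonneg fun i _ ↦ sum_nonneg fun j _ ↦ sq_nonneg _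
  rcases (sq_nonneg M).eq_or_lt with hM | hM
  · exact htriv (by simp [← hM])
  rcases ht.eq_or_lt with rfl | ht
  · exact htriv (mul_nonpos_of_nonneg_of_nonpos hc ((min_le_left _ _).trans (by simp)))
  rcases hS0.eq_or_lt with hS0 | hS0
  · exact htriv (mul_nonpos_of_nonneg_of_nonpos hc ((min_le_left _ _).trans (by simp [← hS0])))
  rcases le_or_gt L 0 with hL0 | hL0
  · exact htriv (mul_nonpos_of_nonneg_of_nonpos hc
      ((min_le_right _ _).trans (div_nonpos_of_nonneg_of_nonpos ht.le hL0)))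
  have hM0 : M ≠ 0 := (pow_ne_zero_iff two_ne_zero).1 hM.ne'
  have hm0 : 0 < m := lt_min (by positivity) (by positivity)
  set l := m / (434 * M ^ 2 * t) with hl
  have hl0 : 0 < l := by positivity
  have hlt : l * t = 1 / (434 * M ^ 2) * m := by
    rw [hl]; field_simp
  have hlS : 434 * l * M ^ 2 * S ≤ t := by
    have h : m * S ≤ t ^ 2 := (le_div_iff₀ hS0).1 (min_le_left _ _)
    have e : 434 * l * M ^ 2 * S = m * S / t := by rw [hl]; field_simp
    rw [e, div_le_iff₀ ht]
    linarith
  have hlL : 434 * l * M ^ 2 * L ≤ 1 := by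
    have h : m * L ≤ t := (le_div_iff₀ hL0).1 (min_le_right _ _)
    have e : 434 * l * M ^ 2 * L = m * L / t := by rw [hl]; field_simp
    rw [e, div_le_iff₀ ht]
    linarith
  have hl256 : 256 * l ^ 2 * M ^ 4 * L ^ 2 ≤ 1 := by
    have h0 : 0 ≤ l * M ^ 2 * L := by positivity
    have h1 : l * M ^ 2 * L ≤ 1 / 434 := by linarith
    have h2 := pow_le_pow_left₀ h0 h1 2
    have e : 256 * l ^ 2 * M ^ 4 * L ^ 2 = 256 * (l * M ^ 2 * L) ^ 2 := by ring
    rw [e]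
    linarith
  have hexp : 32 * l ^ 2 * M ^ 2 * S - l * t ≤ -(1 / (868 * M ^ 2)) * m := by
    have h1 : 1 / (868 * M ^ 2) * m = l * t / 2 := by
      rw [hlt]; field_simp; norm_num
    have h2 := mul_le_mul_of_nonneg_left hlS hl0.le
    have h3 : 0 < l * t := by positivity
    nlinarith
  have hpos := measure_le_quadratic_le μi hmean hvar hbdd a (l := l) hl256 (l * t)
  have hneg := measure_le_quadratic_le μi hmean hvar hbdd a (l := -l)
    (by rwa [neg_sq]) (l * t)
  rw [neg_sq] at hneg
  have hsub : {x : Fin n → ℝ | t ≤ |∑ i, ∑ j ∈ Finset.Ioi i, a i j * x i * x j|} ⊆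
      {x | l * t ≤ l * ∑ i, ∑ j ∈ Ioi i, a i j * x i * x j} ∪
      {x | l * t ≤ -l * ∑ i, ∑ j ∈ Ioi i, a i j * x i * x j} := by
    intro x hx
    rcases le_abs.1 (show t ≤ |_| from hx) with h | h
    · exact Or.inl (mul_le_mul_of_nonneg_left h hl0.le)
    · exact Or.inr ((mul_le_mul_of_nonneg_left h hl0.le).trans (le_of_eq (by ring)))
  refine (measure_mono hsub).trans ((measure_union_le _ _).trans
    ((add_le_add hpos hneg).trans ?_))
  rw [← ENNReal.ofReal_add (exp_pos _).le (exp_pos _).le, ← two_mul]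
  gcongr

end
end

section
/- Let X = (X_1,…,X_n) be a random vector with values in a finite product space 𝒴 = 𝒳_1 × ⋯ × 𝒳_n satisfying a 𝔡-LSI(σ²), let f : 𝒴 → ℝ be measurable with f(X) ∈ L^∞(ℙ), let d ∈ ℕ and set C := 15 σ² d². Then for all t ≥ 0, ℙ(|f(X) − 𝔼f(X)| ≥ t) ≤ 2 exp( −(1/C) · min( min_{k=1,…,d−1} ( t / ‖𝔥^{(k)} f‖_{op,1} )^{2/k} , ( t / ‖𝔥^{(d)} f‖_{op,∞} )^{2/d} ) ). -/
open MeasureTheory Finset Real Filter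

lemma exists_abs_le_of_finite {Ω : Type*} [Finite Ω] (g : Ω → ℝ) : ∃ C, ∀ x, |g x| ≤ C :=
  (Finite.bddAbove_range fun x => |g x|).imp fun _ hC x => hC ⟨x, rfl⟩

section Moments

variable {Ω : Type*} [MeasurableSpace Ω] [Finite Ω] {μ : Measure Ω}

lemma Measurable.integrable_of_finite [IsFiniteMeasure μ] {g : Ω → ℝ} (hg : Measurable g) :
    Integrable g μ := by
  obtain ⟨C, hC⟩ := exists_abs_le_of_finite g
  exact Integrable.of_bound hg.aestronglyMeasurable C (.of_forall hC)

lemma Measurable.memLp_of_finite [IsFiniteMeasure μ] {g : Ω → ℝ} (hg : Measurable g)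
    (p : ENNReal) : MemLp g p μ := by
  obtain ⟨C, hC⟩ := exists_abs_le_of_finite g
  exact MemLp.of_bound hg.aestronglyMeasurable C (.of_forall hC)

lemma integral_add_const_of_finite [IsProbabilityMeasure μ] {g : Ω → ℝ} (hg : Measurable g)
    (e : ℝ) : ∫ x, (g x + e) ∂μ = ∫ x, g x ∂μ + e := by
  rw [integral_add hg.integrable_of_finite (integrable_const _)]
  simp

lemma integral_add_const_sq_of_finite [IsProbabilityMeasure μ] {g : Ω → ℝ} (hg : Measurable g)
    (e : ℝ) : ∫ x, (g x + e) ^ 2 ∂μ = ∫ x, g x ^ 2 ∂μ + 2 * e * ∫ x, g x ∂μ + e ^ 2 := by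
  have h : ∀ x, (g x + e) ^ 2 = g x ^ 2 + 2 * e * g x + e ^ 2 := fun x => by ring
  simp only [h]
  rw [integral_add_const_of_finite (g := fun x => g x ^ 2 + 2 * e * g x) (by fun_prop),
    integral_add (hg.pow_const 2).integrable_of_finite (hg.const_mul _).integrable_of_finite,
    integral_const_mul]

lemma integral_pos_of_pos_of_finite [IsProbabilityMeasure μ] {g : Ω → ℝ} (hg : Measurable g)
    (h : ∀ x, 0 < g x) : 0 < ∫ x, g x ∂μ := by
  rw [integral_pos_iff_support_of_nonneg (fun x => (h x).le) hg.integrable_of_finite]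
  have : Function.support g = Set.univ := Set.eq_univ_of_forall fun x => (h x).ne'
  simp [this]

/-- The entropy of the square of a positive function dominates its variance. -/
lemma integral_sq_sub_sq_integral_le_ent [IsProbabilityMeasure μ] {u : Ω → ℝ}
    (hu : Measurable u) (h : ∀ x, 0 < u x) :
    ∫ x, u x ^ 2 ∂μ - (∫ x, u x ∂μ) ^ 2 ≤ ent μ (fun x => u x ^ 2) := by
  have ha : 0 < ∫ x, u x ∂μ := integral_pos_of_pos_of_finite hu h
  have hm : 0 < ∫ x, u x ^ 2 ∂μ := integral_pos_of_pos_of_finite (hu.pow_const 2)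
    fun x => pow_pos (h x) 2
  set a := ∫ x, u x ∂μ with ha_def
  set m := ∫ x, u x ^ 2 ∂μ with hm_def
  have hpt : ∀ x, 2 * (1 + Real.log m - Real.log a) * u x ^ 2 - 2 * (m / a) * u x ≤
      u x ^ 2 * Real.log (u x ^ 2) := by
    intro x
    have hx := h x
    have h1 := Real.one_sub_inv_le_log_of_pos (x := u x * a / m) (by positivity)
    rw [Real.log_div (by positivity) hm.ne', Real.log_mul hx.ne' ha.ne'] at h1
    have h2 := mul_le_mul_of_nonneg_left h1 (show 0 ≤ 2 * u x ^ 2 by positivity)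
    have h3 : 2 * u x ^ 2 * (1 - (u x * a / m)⁻¹) = 2 * u x ^ 2 - 2 * (m / a) * u x := by
      field_simp
    rw [Real.log_pow]
    push_cast
    linarith
  have h_int := integral_mono (μ := μ)
    (((hu.pow_const 2).const_mul _).sub (hu.const_mul _)).integrable_of_finite
    ((hu.pow_const 2).mul (hu.pow_const 2).log).integrable_of_finite hpt
  simp only [Pi.sub_apply, Pi.mul_apply] at h_int
  rw [integral_sub ((hu.pow_const 2).const_mul _).integrable_of_finite
    (hu.const_mul _).integrable_of_finite, integral_const_mul, integral_const_mul,
    ← ha_def, ← hm_def, mul_assoc 2 (m / a) a, div_mul_cancel₀ _ ha.ne'] at h_int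
  have h4 := Real.one_sub_inv_le_log_of_pos (x := m / a ^ 2) (by positivity)
  rw [Real.log_div hm.ne' (by positivity), Real.log_pow] at h4
  have h5 := mul_le_mul_of_nonneg_left h4 hm.le
  have h6 : m * (1 - (m / a ^ 2)⁻¹) = m - a ^ 2 := by field_simp
  push_cast at h5
  simp only [ent]
  rw [← hm_def]
  linarith

lemma rpow_sub_rpow_le_mul_sub {a b s : ℝ} (ha : 0 < a) (hb : 0 ≤ b) (hs : 1 ≤ s) :
    a ^ s - b ^ s ≤ s * a ^ (s - 1) * (a - b) := by
  have h1 := one_add_mul_self_le_rpow_one_add (s := b / a - 1) (by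
    have : 0 ≤ b / a := by positivity
    linarith) hs
  rw [add_sub_cancel, Real.div_rpow hb ha.le] at h1
  have has : 0 < a ^ s := Real.rpow_pos_of_pos ha s
  rw [le_div_iff₀ has] at h1
  have h2 : a ^ s = a ^ (s - 1) * a := by
    rw [← Real.rpow_add_one ha.ne', sub_add_cancel]
  have h3 : (1 + s * (b / a - 1)) * a ^ s = a ^ s - s * a ^ (s - 1) * (a - b) := by
    rw [h2]; field_simp; ring
  linarith

open ProbabilityTheory in
lemma hasDerivAt_integral_rpow [IsProbabilityMeasure μ] {g : Ω → ℝ} (hg : Measurable g)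
    (hpos : ∀ x, 0 < g x) (q : ℝ) :
    HasDerivAt (fun r : ℝ => ∫ x, g x ^ r ∂μ) (∫ x, g x ^ q * Real.log (g x) ∂μ) q := by
  have h1 : (fun r : ℝ => ∫ x, g x ^ r ∂μ) = mgf (fun x => Real.log (g x)) μ := by
    funext r
    simp only [mgf]
    exact integral_congr_ae (.of_forall fun x => by
      simp only [Real.rpow_def_of_pos (hpos x), mul_comm])
  have h2 : integrableExpSet (fun x => Real.log (g x)) μ = Set.univ :=
    Set.eq_univ_of_forall fun r => (hg.log.const_mul r).exp.integrable_of_finite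
  have h3 := hasDerivAt_mgf (X := fun x => Real.log (g x)) (μ := μ) (t := q)
    (by rw [h2]; simp)
  rw [h1]
  convert h3 using 1
  exact integral_congr_ae (.of_forall fun x => by
    simp only [Real.rpow_def_of_pos (hpos x), mul_comm])

/-- The derivative of `q ↦ ‖g‖_q ^ 2` in terms of the entropy of `g ^ q`. -/
lemma hasDerivAt_integral_rpow_rpow [IsProbabilityMeasure μ] {g : Ω → ℝ} (hg : Measurable g)
    (hpos : ∀ x, 0 < g x) {q : ℝ} (hq : 0 < q) :
    HasDerivAt (fun r : ℝ => (∫ x, g x ^ r ∂μ) ^ (2 / r))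
      (2 / q ^ 2 * (∫ x, g x ^ q ∂μ) ^ (2 / q - 1) * ent μ (fun x => g x ^ q)) q := by
  have hI : 0 < ∫ x, g x ^ q ∂μ := integral_pos_of_pos_of_finite (hg.pow_const q)
    fun x => Real.rpow_pos_of_pos (hpos x) q
  have h1 := hasDerivAt_integral_rpow (μ := μ) hg hpos q
  have h2 : HasDerivAt (fun r : ℝ => 2 / r) (-2 / q ^ 2) q := by
    simpa [div_eq_mul_inv, neg_mul] using (hasDerivAt_inv hq.ne').const_mul 2
  convert h1.rpow h2 hI using 1
  have h3 : ent μ (fun x => g x ^ q) = q * ∫ x, g x ^ q * Real.log (g x) ∂μ -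
      (∫ x, g x ^ q ∂μ) * Real.log (∫ x, g x ^ q ∂μ) := by
    rw [ent, ← integral_const_mul]
    congr 1
    exact integral_congr_ae (.of_forall fun x => by
      simp only [Real.log_rpow (hpos x)]; ring)
  rw [h3, Real.rpow_sub hI, Real.rpow_one]
  field_simp
  ring

lemma integral_rpow_rpow_le_of_le [IsProbabilityMeasure μ] {H : Ω → ℝ} (hH : Measurable H)
    (hH0 : ∀ x, 0 ≤ H x) {q p : ℝ} (hq : 0 < q) (hqp : q ≤ p) :
    (∫ x, H x ^ q ∂μ) ^ (2 / q) ≤ (∫ x, H x ^ p ∂μ) ^ (2 / p) := by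
  rcases hqp.eq_or_lt with rfl | hlt
  · rfl
  have hp : 0 < p := hq.trans hlt
  have hconj : (p / q).HolderConjugate (p / q).conjExponent :=
    Real.HolderConjugate.conjExponent ((one_lt_div hq).2 hlt)
  have h1 := integral_mul_le_Lp_mul_Lq_of_nonneg (μ := μ) hconj
    (f := fun x => H x ^ q) (g := fun _ => (1 : ℝ))
    (.of_forall fun x => Real.rpow_nonneg (hH0 x) q) (.of_forall fun _ => zero_le_one)
    ((hH.pow_const q).memLp_of_finite _) (measurable_const.memLp_of_finite _)
  have h2 : ∀ x, (H x ^ q) ^ (p / q) = H x ^ p := fun x => by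
    rw [← Real.rpow_mul (hH0 x), mul_div_cancel₀ _ hq.ne']
  simp only [h2, mul_one, Real.one_rpow, integral_const, probReal_univ, smul_eq_mul] at h1
  have hI : 0 ≤ ∫ x, H x ^ q ∂μ := integral_nonneg fun x => Real.rpow_nonneg (hH0 x) q
  have hJ : 0 ≤ ∫ x, H x ^ p ∂μ := integral_nonneg fun x => Real.rpow_nonneg (hH0 x) p
  have h3 := Real.rpow_le_rpow hI h1 (show 0 ≤ 2 / q by positivity)
  rwa [← Real.rpow_mul hJ, show 1 / (p / q) * (2 / q) = 2 / p by field_simp] at h3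

lemma integral_rpow_mul_sq_le [IsProbabilityMeasure μ] {g H : Ω → ℝ} (hg : Measurable g)
    (hg0 : ∀ x, 0 ≤ g x) (hH : Measurable H) (hH0 : ∀ x, 0 ≤ H x) {q : ℝ} (hq : 2 < q) :
    ∫ x, g x ^ (q - 2) * H x ^ 2 ∂μ ≤
      (∫ x, g x ^ q ∂μ) ^ (1 - 2 / q) * (∫ x, H x ^ q ∂μ) ^ (2 / q) := by
  have hq0 : 0 < q := by linarith
  have hq2 : 0 < q - 2 := by linarith
  have hconj : (q / (q - 2)).HolderConjugate (q / 2) := by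
    rw [Real.holderConjugate_iff]
    refine ⟨(one_lt_div hq2).2 (by linarith), ?_⟩
    field_simp
    ring
  have h1 := integral_mul_le_Lp_mul_Lq_of_nonneg (μ := μ) hconj
    (f := fun x => g x ^ (q - 2)) (g := fun x => H x ^ 2)
    (.of_forall fun x => Real.rpow_nonneg (hg0 x) _) (.of_forall fun x => sq_nonneg _)
    ((hg.pow_const _).memLp_of_finite _) ((hH.pow_const 2).memLp_of_finite _)
  have h2 : ∀ x, (g x ^ (q - 2)) ^ (q / (q - 2)) = g x ^ q := fun x => by
    rw [← Real.rpow_mul (hg0 x), mul_div_cancel₀ _ hq2.ne']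
  have h3 : ∀ x, (H x ^ 2) ^ (q / 2) = H x ^ q := fun x => by
    rw [← Real.rpow_natCast, ← Real.rpow_mul (hH0 x)]
    congr 1
    push_cast
    field_simp
  simp only [h2, h3] at h1
  rwa [show 1 / (q / (q - 2)) = 1 - 2 / q by field_simp, one_div_div] at h1

/-- Moment growth: an entropy bound for the powers of `g` controls the growth of `‖g‖_p ^ 2`. -/
lemma integral_rpow_rpow_le_of_ent_le [IsProbabilityMeasure μ] {g H : Ω → ℝ}
    (hg : Measurable g) (hpos : ∀ x, 0 < g x) (hH : Measurable H) (hH0 : ∀ x, 0 ≤ H x)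
    {σ2 p : ℝ} (hσ : 0 ≤ σ2) (hp : 2 ≤ p)
    (hent : ∀ q, 2 < q → ent μ (fun x => g x ^ q) ≤
      σ2 * q ^ 2 / 2 * ∫ x, g x ^ (q - 2) * H x ^ 2 ∂μ) :
    (∫ x, g x ^ p ∂μ) ^ (2 / p) ≤
      ∫ x, g x ^ 2 ∂μ + σ2 * (p - 2) * (∫ x, H x ^ p ∂μ) ^ (2 / p) := by
  have hd := fun q (hq : 0 < q) => hasDerivAt_integral_rpow_rpow (μ := μ) hg hpos hq
  have key := (convex_Icc (2 : ℝ) p).image_sub_le_mul_sub_of_deriv_le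
    (f := fun r : ℝ => (∫ x, g x ^ r ∂μ) ^ (2 / r))
    (fun q hq => (hd q (by linarith [hq.1])).continuousAt.continuousWithinAt)
    (fun q hq => (hd q (by rw [interior_Icc] at hq; linarith [hq.1])).differentiableAt
      |>.differentiableWithinAt)
    (C := σ2 * (∫ x, H x ^ p ∂μ) ^ (2 / p)) (by
      intro q hq
      rw [interior_Icc] at hq
      have hq0 : 0 < q := by linarith [hq.1]
      rw [(hd q hq0).deriv]
      have hI : 0 < ∫ x, g x ^ q ∂μ := integral_pos_of_pos_of_finite (hg.pow_const q)
        fun x => Real.rpow_pos_of_pos (hpos x) q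
      have h1 := integral_rpow_mul_sq_le (μ := μ) hg (fun x => (hpos x).le) hH hH0 hq.1
      have h2 := integral_rpow_rpow_le_of_le (μ := μ) hH hH0 hq0 hq.2.le
      set I := ∫ x, g x ^ q ∂μ
      have hc : 0 ≤ 2 / q ^ 2 * I ^ (2 / q - 1) := by positivity
      have hmul : I ^ (2 / q - 1) * I ^ (1 - 2 / q) = 1 := by
        rw [← Real.rpow_add hI]; simp
      calc _ ≤ 2 / q ^ 2 * I ^ (2 / q - 1) *
            (σ2 * q ^ 2 / 2 * (I ^ (1 - 2 / q) * (∫ x, H x ^ q ∂μ) ^ (2 / q))) := by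
            refine mul_le_mul_of_nonneg_left ((hent q hq.1).trans ?_) hc
            exact mul_le_mul_of_nonneg_left h1 (by positivity)
        _ = (I ^ (2 / q - 1) * I ^ (1 - 2 / q)) * (σ2 * (∫ x, H x ^ q ∂μ) ^ (2 / q)) := by
            field_simp
        _ ≤ _ := by
            rw [hmul, one_mul]
            exact mul_le_mul_of_nonneg_left h2 hσ)
    2 (by simp [hp]) p (by simp [hp]) hp
  simp only [div_self (two_ne_zero' ℝ), Real.rpow_one, Real.rpow_two] at key
  linarith

end Moments

section LogSobolev

variable {n : ℕ} {𝒳 : Fin n → Type*}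

/-- `H` bounds, at every point, the Euclidean norm of the vector of one-sided differences
`sup_{x_i'} (g(x) - g(x_{i^c}, x_i'))_+`. -/
def HasUpperGradient (g H : (∀ i, 𝒳 i) → ℝ) : Prop :=
  ∀ x y : ∀ i, 𝒳 i, ∑ i, (max (g x - g (Function.update x i (y i))) 0) ^ 2 ≤ H x ^ 2

lemma HasUpperGradient.add_const {g H : (∀ i, 𝒳 i) → ℝ} (h : HasUpperGradient g H) (c : ℝ) :
    HasUpperGradient (fun x => g x + c) H := fun x y => by
  simpa only [add_sub_add_right_eq_sub] using h x y

variable [∀ i, MeasurableSpace (𝒳 i)]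

lemma cVar_le_integral_sub_sq {β : Type*} [MeasurableSpace β] [Finite β] {ρ : Measure β}
    [IsProbabilityMeasure ρ] {u : β → ℝ} (hu : Measurable u) (c : ℝ) :
    cVar ρ u ≤ ∫ y, (u y - c) ^ 2 ∂ρ := by
  have h := fun e : ℝ => integral_add_const_sq_of_finite (μ := ρ) hu (-e)
  simp only [← sub_eq_add_neg] at h
  rw [cVar, h, h]
  nlinarith [sq_nonneg (∫ y, u y ∂ρ - c)]

variable [∀ i, Fintype (𝒳 i)] {μ : Measure (∀ i, 𝒳 i)}
  {ν : ∀ i, (∀ j, 𝒳 j) → Measure (𝒳 i)}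

lemma IsCondKernel.integrable_integral_update [IsProbabilityMeasure μ] (h : IsCondKernel μ ν)
    (i : Fin n) {W : (∀ j, 𝒳 j) → ℝ} (hW : Measurable W) :
    Integrable (fun x => ∫ y, W (Function.update x i y) ∂(ν i x)) μ := by
  have := h.1 i
  by_contra hcon
  have h0 := h.2.2 i W hW (exists_abs_le_of_finite W)
  have h1 := h.2.2 i (fun x => W x + 1) (hW.add_const 1) (exists_abs_le_of_finite _)
  have hadd : ∀ x, ∫ y, (W (Function.update x i y) + 1) ∂(ν i x) =
      ∫ y, W (Function.update x i y) ∂(ν i x) + 1 := fun x => by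
    have hWx : Measurable fun y => W (Function.update x i y) := hW.comp (measurable_update x)
    exact integral_add_const_of_finite hWx 1
  simp only [hadd] at h1
  rw [integral_undef hcon] at h0
  rw [integral_add hW.integrable_of_finite (integrable_const _), ← h0,
    integral_undef (fun hc => hcon ((integrable_add_const_iff).1 hc))] at h1
  simp at h1

/-- If every conditional variance of `u` is dominated by the conditional mean of `W i`, then
the expectation of `|𝔡u|²` is dominated by that of `∑ i, W i`. -/
lemma IsCondKernel.integral_dSq_le [IsProbabilityMeasure μ] (h : IsCondKernel μ ν)
    {u : (∀ j, 𝒳 j) → ℝ} {W : Fin n → (∀ j, 𝒳 j) → ℝ} (hW : ∀ i, Measurable (W i))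
    (hle : ∀ i x, cVar (ν i x) (fun y => u (Function.update x i y)) ≤
      ∫ y, W i (Function.update x i y) ∂(ν i x)) :
    ∫ x, dSq ν u x ∂μ ≤ ∫ x, ∑ i, W i x ∂μ := by
  have h_int := fun i => h.integrable_integral_update i (hW i)
  calc ∫ x, dSq ν u x ∂μ ≤ ∫ x, ∑ i, ∫ y, W i (Function.update x i y) ∂(ν i x) ∂μ := by
        refine integral_mono_of_nonneg (.of_forall fun x => ?_)
          (integrable_finsetSum _ fun i _ => h_int i)
          (.of_forall fun x => Finset.sum_le_sum fun i _ => hle i x)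
        exact Finset.sum_nonneg fun i _ => integral_nonneg fun y => sq_nonneg _
    _ = ∑ i, ∫ x, W i x ∂μ := by
        rw [integral_finsetSum _ fun i _ => h_int i]
        exact Finset.sum_congr rfl fun i _ =>
          h.2.2 i (W i) (hW i) (exists_abs_le_of_finite _)
    _ = _ := (integral_finsetSum _ fun i _ => (hW i).integrable_of_finite).symm

/-- Chain rule for the difference operator `𝔡` and powers of positive functions. -/
lemma IsCondKernel.integral_dSq_rpow_le [IsProbabilityMeasure μ] (h : IsCondKernel μ ν)
    {g H : (∀ j, 𝒳 j) → ℝ} (hg : Measurable g) (hpos : ∀ x, 0 < g x) (hH : Measurable H)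
    (hgH : HasUpperGradient g H) {s : ℝ} (hs : 1 ≤ s) :
    ∫ x, dSq ν (fun x => g x ^ s) x ∂μ ≤ s ^ 2 * ∫ x, g x ^ (2 * s - 2) * H x ^ 2 ∂μ := by
  have hne : Nonempty (∀ i, 𝒳 i) := nonempty_of_isProbabilityMeasure μ
  have hne' : ∀ i, Nonempty (𝒳 i) := fun i => hne.map fun x => x i
  have := h.1
  have hexp : ∀ x, g x ^ (2 * s - 2) = (g x ^ (s - 1)) ^ 2 := fun x => by
    rw [← Real.rpow_natCast, ← Real.rpow_mul (hpos x).le]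
    congr 1
    push_cast
    ring
  choose z hz using fun (i : Fin n) (x : ∀ j, 𝒳 j) =>
    Finite.exists_min fun y => g (Function.update x i y)
  have hinf : ∀ i x, ⨅ y, g (Function.update x i y) = g (Function.update x i (z i x)) :=
    fun i x => le_antisymm (ciInf_le (Finite.bddBelow_range _) _) (le_ciInf (hz i x))
  have hzmin : ∀ i x, g (Function.update x i (z i x)) ≤ g x := fun i x => by
    simpa using hz i x (x i)
  let W : Fin n → (∀ j, 𝒳 j) → ℝ := fun i x =>
    s ^ 2 * (g x ^ (2 * s - 2) * (g x - ⨅ y, g (Function.update x i y)) ^ 2)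
  have hW : ∀ i, Measurable (W i) := fun i =>
    ((hg.pow_const _).mul ((hg.sub (Measurable.iInf fun y =>
      hg.comp measurable_update_left)).pow_const 2)).const_mul _
  refine (h.integral_dSq_le hW fun i x => ?_).trans ?_
  · have hgu : Measurable fun y => g (Function.update x i y) := hg.comp (measurable_update x)
    refine (cVar_le_integral_sub_sq (hgu.pow_const s)
      (g (Function.update x i (z i x)) ^ s)).trans ?_
    refine integral_mono (((hgu.pow_const s).sub_const _).pow_const 2).integrable_of_finite
      ((hW i).comp (measurable_update x)).integrable_of_finite fun y => ?_
    simp only [W, Function.update_idem]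
    rw [hinf, hexp]
    set a := g (Function.update x i y)
    set b := g (Function.update x i (z i x))
    have hb : 0 < b := hpos _
    have h1 : a ^ s - b ^ s ≤ s * a ^ (s - 1) * (a - b) :=
      rpow_sub_rpow_le_mul_sub (hpos _) hb.le hs
    have h2 : 0 ≤ a ^ s - b ^ s :=
      sub_nonneg.2 (Real.rpow_le_rpow hb.le (hz i x y) (by linarith))
    calc (a ^ s - b ^ s) ^ 2 ≤ (s * a ^ (s - 1) * (a - b)) ^ 2 := pow_le_pow_left₀ h2 h1 2
      _ = _ := by ring
  · rw [← integral_const_mul]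
    refine integral_mono (Finset.measurable_fun_sum _ fun i _ => hW i).integrable_of_finite
      (((hg.pow_const _).mul (hH.pow_const 2)).const_mul _).integrable_of_finite fun x => ?_
    simp only [W, ← Finset.mul_sum, hinf]
    have h1 : 0 ≤ g x ^ (2 * s - 2) := Real.rpow_nonneg (hpos x).le _
    gcongr
    refine le_of_eq_of_le (Finset.sum_congr rfl fun i _ => ?_) (hgH x fun i => z i x)
    rw [max_eq_left (sub_nonneg.2 (hzmin i x))]

/-- A `𝔡`-LSI implies a Poincaré-type inequality. -/
lemma DLSI.integral_sq_sub_sq_integral_le [IsProbabilityMeasure μ] {σ2 : ℝ} (hσ : 0 ≤ σ2)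
    (h : DLSI μ ν σ2) {g H : (∀ j, 𝒳 j) → ℝ} (hg : Measurable g) (hH : Measurable H)
    (hgH : HasUpperGradient g H) :
    ∫ x, g x ^ 2 ∂μ - (∫ x, g x ∂μ) ^ 2 ≤ 2 * σ2 * ∫ x, H x ^ 2 ∂μ := by
  obtain ⟨C, hC⟩ := exists_abs_le_of_finite g
  let u := fun x => g x + (C + 1)
  have hu : Measurable u := hg.add_const _
  have hupos : ∀ x, 0 < u x := fun x => by
    have := neg_le_of_abs_le (hC x)
    simp only [u]; linarith
  have h1 := integral_sq_sub_sq_integral_le_ent (μ := μ) hu hupos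
  have h2 := h.1.integral_dSq_rpow_le hu hupos hH (hgH.add_const _) le_rfl
  have h3 := h.2 u hu (exists_abs_le_of_finite u)
  have h4 : ∫ x, u x ^ 2 ∂μ - (∫ x, u x ∂μ) ^ 2 =
      ∫ x, g x ^ 2 ∂μ - (∫ x, g x ∂μ) ^ 2 := by
    simp only [u]
    rw [integral_add_const_sq_of_finite hg, integral_add_const_of_finite hg]
    ring
  norm_num at h2
  have h5 := mul_le_mul_of_nonneg_left h2 (show 0 ≤ 2 * σ2 by positivity)
  linarith

/-- A `𝔡`-LSI implies moment bounds for nonnegative functions. -/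
lemma DLSI.integral_rpow_rpow_le [IsProbabilityMeasure μ] {σ2 : ℝ} (hσ : 0 ≤ σ2)
    (h : DLSI μ ν σ2) {g H : (∀ j, 𝒳 j) → ℝ} (hg : Measurable g) (hg0 : ∀ x, 0 ≤ g x)
    (hH : Measurable H) (hH0 : ∀ x, 0 ≤ H x) (hgH : HasUpperGradient g H)
    {p : ℝ} (hp : 2 ≤ p) :
    (∫ x, g x ^ p ∂μ) ^ (2 / p) ≤
      ∫ x, g x ^ 2 ∂μ + σ2 * (p - 2) * (∫ x, H x ^ p ∂μ) ^ (2 / p) := by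
  have hshift : ∀ ε : ℝ, 0 < ε → (∫ x, g x ^ p ∂μ) ^ (2 / p) ≤
      ∫ x, (g x + ε) ^ 2 ∂μ + σ2 * (p - 2) * (∫ x, H x ^ p ∂μ) ^ (2 / p) := by
    intro ε hε
    have hm : Measurable fun x => g x + ε := hg.add_const ε
    have hpos : ∀ x, 0 < g x + ε := fun x => by linarith [hg0 x]
    refine le_trans ?_ (integral_rpow_rpow_le_of_ent_le (μ := μ) hm hpos hH hH0 hσ hp
      fun q hq => ?_)
    · refine Real.rpow_le_rpow (integral_nonneg fun x => Real.rpow_nonneg (hg0 x) p)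
        (integral_mono (hg.pow_const p).integrable_of_finite
          (hm.pow_const p).integrable_of_finite fun x => ?_) (by positivity)
      exact Real.rpow_le_rpow (hg0 x) (by linarith) (by linarith)
    · have h1 := h.1.integral_dSq_rpow_le hm hpos hH (hgH.add_const ε) (s := q / 2)
        (by linarith)
      have h2 := h.2 (fun x => (g x + ε) ^ (q / 2)) (hm.pow_const _)
        (exists_abs_le_of_finite _)
      have h3 : ∀ x, ((g x + ε) ^ (q / 2)) ^ 2 = (g x + ε) ^ q := fun x => by
        rw [← Real.rpow_natCast, ← Real.rpow_mul (hpos x).le]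
        congr 1
        push_cast
        ring
      simp only [h3] at h2
      rw [mul_div_cancel₀ q (two_ne_zero' ℝ)] at h1
      have h5 := mul_le_mul_of_nonneg_left h1 (show 0 ≤ 2 * σ2 by positivity)
      linarith
  simp only [integral_add_const_sq_of_finite hg] at hshift
  have hcont : Continuous fun ε : ℝ => ∫ x, g x ^ 2 ∂μ + 2 * ε * ∫ x, g x ∂μ + ε ^ 2 +
      σ2 * (p - 2) * (∫ x, H x ^ p ∂μ) ^ (2 / p) := by fun_prop
  have hlim := (hcont.tendsto 0).mono_left (nhdsWithin_le_nhds (s := Set.Ioi 0))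
  refine (ge_of_tendsto hlim (eventually_nhdsWithin_of_forall hshift)).trans_eq ?_
  ring

end LogSobolev

section Tensor

variable {n k : ℕ}

lemma abs_le_one_of_sum_sq_le_one_s2 {ι : Type*} [Fintype ι] {w : ι → ℝ} (hw : ∑ i, w i ^ 2 ≤ 1)
    (i : ι) : |w i| ≤ 1 := by
  rw [← sq_le_one_iff_abs_le_one]
  exact (Finset.single_le_sum (fun j _ => sq_nonneg (w j)) (Finset.mem_univ i)).trans hw

lemma tOp_zero_order (A : (Fin 0 → Fin n) → ℝ) : tOp A = A default := by
  have : Nonempty {v : Fin 0 → Fin n → ℝ // ∀ j, ∑ i, (v j i) ^ 2 ≤ 1} :=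
    ⟨⟨fun _ _ => 0, by simp⟩⟩
  simp [tOp]

lemma measurable_tOp : Measurable (tOp : ((Fin k → Fin n) → ℝ) → ℝ) := by
  refine (lowerSemicontinuous_ciSup (fun A => bddAbove_tOp A) fun v => ?_).measurable
  exact Continuous.lowerSemicontinuous (by fun_prop)

/-- The operator norm of a nonnegative tensor is attained at nonnegative vectors. -/
lemma exists_nonneg_tOp_eq {A : (Fin k → Fin n) → ℝ} (hA : ∀ idx, 0 ≤ A idx) :
    ∃ v : Fin k → Fin n → ℝ, (∀ j, ∑ i, v j i ^ 2 ≤ 1) ∧ (∀ j i, 0 ≤ v j i) ∧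
      tOp A = ∑ idx : Fin k → Fin n, (∏ j, v j (idx j)) * A idx := by
  let K : Set (Fin k → Fin n → ℝ) := {v | ∀ j, ∑ i, v j i ^ 2 ≤ 1}
  have hK : IsCompact K := by
    refine (isCompact_Icc (a := fun _ _ => (-1 : ℝ)) (b := fun _ _ => (1 : ℝ))).of_isClosed_subset
      ?_ fun v hv => ?_
    · simp only [K, Set.ofPred_forall]
      exact isClosed_iInter fun j => isClosed_le (by fun_prop) continuous_const
    · exact ⟨fun j i => (abs_le.1 (abs_le_one_of_sum_sq_le_one_s2 (hv j) i)).1,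
        fun j i => (abs_le.1 (abs_le_one_of_sum_sq_le_one_s2 (hv j) i)).2⟩
  obtain ⟨v, hv, hmax⟩ := hK.exists_isMaxOn ⟨fun _ _ => 0, by simp [K]⟩
    (f := fun v => ∑ idx : Fin k → Fin n, (∏ j, v j (idx j)) * A idx)
    (Continuous.continuousOn (by fun_prop))
  have habs : ∀ j, ∑ i, |v j i| ^ 2 ≤ 1 := fun j => by
    simpa only [sq_abs] using hv j
  refine ⟨fun j i => |v j i|, habs, fun j i => abs_nonneg _, le_antisymm ?_ (le_tOp A habs)⟩
  have : Nonempty {v : Fin k → Fin n → ℝ // ∀ j, ∑ i, (v j i) ^ 2 ≤ 1} := ⟨⟨v, hv⟩⟩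
  refine ciSup_le fun w => (hmax w.2).trans (Finset.sum_le_sum fun idx _ => ?_)
  rw [← Finset.abs_prod]
  exact mul_le_mul_of_nonneg_right (le_abs_self _) (hA idx)

/-- Contracting all but one slot of a nonnegative tensor with unit vectors yields a vector whose
Euclidean norm is at most the operator norm. -/
lemma sum_sq_contract_le_tOp_sq {B : (Fin (k + 1) → Fin n) → ℝ} (hB : ∀ idx, 0 ≤ B idx)
    {v : Fin k → Fin n → ℝ} (hv : ∀ j, ∑ i, v j i ^ 2 ≤ 1) :
    ∑ i, (∑ idx : Fin k → Fin n, (∏ j, v j (idx j)) * B (Fin.cons i idx)) ^ 2 ≤ tOp B ^ 2 := by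
  set c : Fin n → ℝ := fun i => ∑ idx : Fin k → Fin n, (∏ j, v j (idx j)) * B (Fin.cons i idx)
    with hc
  change ∑ i, c i ^ 2 ≤ _
  set r := √(∑ i, c i ^ 2) with hr
  have hsum : 0 ≤ ∑ i, c i ^ 2 := Finset.sum_nonneg fun i _ => sq_nonneg _
  have hr2 : r ^ 2 = ∑ i, c i ^ 2 := Real.sq_sqrt hsum
  rw [← hr2]
  refine pow_le_pow_left₀ (Real.sqrt_nonneg _) ?_ 2
  rcases (Real.sqrt_nonneg (∑ i, c i ^ 2)).eq_or_lt with h0 | h0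
  · rw [← h0]; exact tOp_nonneg hB
  have hle := le_tOp B (v := Fin.cons (fun i => c i / r) v) (by
    refine Fin.cases ?_ fun j => ?_
    · simp only [Fin.cons_zero, div_pow, ← Finset.sum_div, hr2]
      exact div_self_le_one _
    · simpa using hv j)
  refine le_of_eq_of_le ?_ hle
  rw [← (Fin.consEquiv fun _ => Fin n).sum_comp, Fintype.sum_prod_type]
  simp only [Fin.consEquiv_apply, Fin.prod_univ_succ, Fin.cons_zero, Fin.cons_succ, mul_assoc,
    ← Finset.mul_sum]
  change r = ∑ i, c i / r * c i
  have h1 : ∀ i, c i / r * c i = c i ^ 2 / r := fun i => by ring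
  simp only [h1, ← Finset.sum_div, ← hr2]
  rw [sq, mul_div_cancel_right₀ _ h0.ne']

end Tensor

section HigherDifferences

variable {n : ℕ} {𝒳 : Fin n → Type*}

/-- The `k`-fold difference `∏ (Id - T_{i_s}) f`, with the two resampled values of the coordinates
`i_s` given by `y`. -/
def altDiff (f : (∀ i, 𝒳 i) → ℝ) (k : ℕ) (idx : Fin k → Fin n) (x : ∀ i, 𝒳 i)
    (y : (∀ i, 𝒳 i) × (∀ i, 𝒳 i)) : ℝ :=
  ∑ S ∈ (Finset.univ : Finset (Fin k)).powerset, (-1 : ℝ) ^ S.card *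
    f (fun i => if i ∈ Finset.image idx S then y.2 i
                else if i ∈ Finset.image idx Finset.univ then y.1 i else x i)

lemma hOrd_eq_iSup (f : (∀ i, 𝒳 i) → ℝ) (k : ℕ) (idx : Fin k → Fin n) (x : ∀ i, 𝒳 i) :
    hOrd f k idx x = ⨆ y, |altDiff f k idx x y| := rfl

lemma altDiff_sub_altDiff_update (f : (∀ i, 𝒳 i) → ℝ) {k : ℕ} {idx : Fin k → Fin n}
    (x : ∀ i, 𝒳 i) (y : (∀ i, 𝒳 i) × (∀ i, 𝒳 i)) {i : Fin n} (hi : i ∉ Set.range idx) (z : 𝒳 i) :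
    altDiff f k idx x y - altDiff f k idx (Function.update x i z) y =
      altDiff f (k + 1) (Fin.cons i idx) x
        (Function.update y.1 i (x i), Function.update y.2 i z) := by
  have hi' : ∀ s, idx s ≠ i := fun s hs => hi ⟨s, hs⟩
  have huniv : (Finset.univ : Finset (Fin (k + 1))) =
      insert 0 (Finset.univ.image Fin.succ) := by
    rw [Fin.univ_succ, Finset.cons_eq_insert, Finset.map_eq_image]; rfl
  have hcons : ∀ S : Finset (Fin k), (S.image Fin.succ).image (Fin.cons i idx : Fin (k + 1) → Fin n)
      = S.image idx := fun S => by
    rw [Finset.image_image]; rfl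
  have h0 : ∀ S : Finset (Fin k), (0 : Fin (k + 1)) ∉ S.image Fin.succ := fun S => by simp
  have hinj : Set.InjOn (fun S : Finset (Fin k) => S.image Fin.succ)
      ((Finset.univ : Finset (Fin k)).powerset : Set (Finset (Fin k))) :=
    (Finset.image_injective (Fin.succ_injective k)).injOn
  unfold altDiff
  rw [huniv, Finset.sum_powerset_insert (h0 _), Finset.powerset_image, Finset.sum_image hinj,
    Finset.sum_image hinj, sub_eq_add_neg, ← Finset.sum_neg_distrib]
  congr 1
  · refine Finset.sum_congr rfl fun S _ => ?_
    rw [Finset.card_image_of_injective _ (Fin.succ_injective k)]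
    congr 2
    funext j
    rw [Finset.image_insert, hcons, hcons, Fin.cons_zero]
    by_cases hj : j = i
    · subst hj; simp [hi']
    · simp [hj]
  · refine Finset.sum_congr rfl fun S _ => ?_
    rw [Finset.card_insert_of_notMem (h0 S),
      Finset.card_image_of_injective _ (Fin.succ_injective k), pow_succ, mul_neg_one, neg_mul]
    congr 3
    funext j
    rw [Finset.image_insert, Finset.image_insert, hcons, hcons, Fin.cons_zero]
    by_cases hj : j = i
    · subst hj; simp [hi']
    · simp [hj]

lemma altDiff_update_of_mem_range (f : (∀ i, 𝒳 i) → ℝ) {k : ℕ} {idx : Fin k → Fin n}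
    (x : ∀ i, 𝒳 i) (y : (∀ i, 𝒳 i) × (∀ i, 𝒳 i)) {i : Fin n} (hi : i ∈ Set.range idx) (z : 𝒳 i) :
    altDiff f k idx (Function.update x i z) y = altDiff f k idx x y := by
  obtain ⟨s, rfl⟩ := hi
  refine Finset.sum_congr rfl fun S _ => ?_
  congr 2
  funext j
  by_cases hj : j = idx s
  · subst hj; simp
  · simp [hj]

lemma altDiff_add_const (f : (∀ i, 𝒳 i) → ℝ) (c : ℝ) {k : ℕ} (hk : k ≠ 0) (idx : Fin k → Fin n)
    (x : ∀ i, 𝒳 i) (y : (∀ i, 𝒳 i) × (∀ i, 𝒳 i)) :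
    altDiff (fun x => f x + c) k idx x y = altDiff f k idx x y := by
  have : NeZero k := ⟨hk⟩
  have h := Finset.sum_powerset_neg_one_pow_card_of_nonempty
    (Finset.univ_nonempty (α := Fin k))
  have h' : ∑ S ∈ (Finset.univ : Finset (Fin k)).powerset, (-1 : ℝ) ^ S.card = 0 := by
    exact_mod_cast h
  simp only [altDiff, mul_add, Finset.sum_add_distrib, ← Finset.sum_mul, h', zero_mul, add_zero]

lemma hT_add_const (f : (∀ i, 𝒳 i) → ℝ) (c : ℝ) {k : ℕ} (hk : k ≠ 0) (idx : Fin k → Fin n)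
    (x : ∀ i, 𝒳 i) : hT (fun x => f x + c) k idx x = hT f k idx x := by
  simp only [hT, hOrd_eq_iSup, altDiff_add_const f c hk]

lemma hT_zero_order (f : (∀ i, 𝒳 i) → ℝ) (idx : Fin 0 → Fin n) (x : ∀ i, 𝒳 i) :
    hT f 0 idx x = |f x| := by
  have : Nonempty ((∀ i, 𝒳 i) × (∀ i, 𝒳 i)) := ⟨(x, x)⟩
  rw [hT, if_pos (Function.injective_of_subsingleton idx), hOrd_eq_iSup]
  simp [altDiff]

/-- The operator norm of the tensor of `k`-th order differences of `f`, as a function of the point.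
-/
noncomputable def diffOp (f : (∀ i, 𝒳 i) → ℝ) (k : ℕ) (x : ∀ i, 𝒳 i) : ℝ :=
  tOp fun idx : Fin k → Fin n => hT f k idx x

lemma diffOp_nonneg (f : (∀ i, 𝒳 i) → ℝ) (k : ℕ) (x : ∀ i, 𝒳 i) : 0 ≤ diffOp f k x :=
  tOp_nonneg fun idx => hT_nonneg f k idx x

lemma diffOp_zero_order (f : (∀ i, 𝒳 i) → ℝ) (x : ∀ i, 𝒳 i) : diffOp f 0 x = |f x| := by
  rw [diffOp, tOp_zero_order, hT_zero_order]

lemma diffOp_add_const (f : (∀ i, 𝒳 i) → ℝ) (c : ℝ) {k : ℕ} (hk : k ≠ 0) :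
    diffOp (fun x => f x + c) k = diffOp f k := by
  funext x
  simp only [diffOp, hT_add_const f c hk]

variable [∀ i, Fintype (𝒳 i)]

lemma hT_sub_hT_update_le (f : (∀ i, 𝒳 i) → ℝ) {k : ℕ} (idx : Fin k → Fin n) (x : ∀ i, 𝒳 i)
    (i : Fin n) (z : 𝒳 i) :
    hT f k idx x - hT f k idx (Function.update x i z) ≤ hT f (k + 1) (Fin.cons i idx) x := by
  by_cases hinj : Function.Injective idx
  swap
  · simpa [hT, hinj] using hT_nonneg f (k + 1) (Fin.cons i idx) x
  by_cases hi : i ∈ Set.range idx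
  · have h := hT_nonneg f (k + 1) (Fin.cons i idx) x
    simpa [hT, hinj, hOrd_eq_iSup, altDiff_update_of_mem_range f x _ hi] using h
  · have hinj' : Function.Injective (Fin.cons i idx : Fin (k + 1) → Fin n) :=
      Fin.cons_injective_iff.2 ⟨hi, hinj⟩
    simp only [hT, if_pos hinj, if_pos hinj', hOrd_eq_iSup]
    rw [sub_le_iff_le_add]
    have : Nonempty ((∀ i, 𝒳 i) × (∀ i, 𝒳 i)) := ⟨(x, x)⟩
    refine ciSup_le fun y => ?_
    have h1 := le_ciSup (f := fun y => |altDiff f (k + 1) (Fin.cons i idx) x y|)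
      (Finite.bddAbove_range _) (Function.update y.1 i (x i), Function.update y.2 i z)
    have h2 := le_ciSup (f := fun y => |altDiff f k idx (Function.update x i z) y|)
      (Finite.bddAbove_range _) y
    simp only [← altDiff_sub_altDiff_update f x y hi z] at h1
    have h3 := abs_sub_abs_le_abs_sub (altDiff f k idx x y)
      (altDiff f k idx (Function.update x i z) y)
    linarith

/-- The one-sided gradient of `|𝔥^{(k)} f|_op` is bounded by `|𝔥^{(k+1)} f|_op`. -/
lemma hasUpperGradient_diffOp (f : (∀ i, 𝒳 i) → ℝ) (k : ℕ) :
    HasUpperGradient (diffOp f k) (diffOp f (k + 1)) := by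
  intro x y
  obtain ⟨v, hv, hv0, hmax⟩ := exists_nonneg_tOp_eq fun idx => hT_nonneg f k idx x
  refine le_trans (Finset.sum_le_sum fun i _ => ?_)
    (sum_sq_contract_le_tOp_sq (fun idx => hT_nonneg f (k + 1) idx x) hv)
  have hprod : ∀ idx : Fin k → Fin n, 0 ≤ ∏ j, v j (idx j) :=
    fun idx => Finset.prod_nonneg fun j _ => hv0 j _
  refine pow_le_pow_left₀ (le_max_right _ _) (max_le ?_ ?_) 2
  · have h1 := le_tOp (fun idx => hT f k idx (Function.update x i (y i))) hv
    simp only [diffOp]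
    rw [hmax]
    refine (sub_le_sub_left h1 _).trans ?_
    rw [← Finset.sum_sub_distrib]
    refine Finset.sum_le_sum fun idx _ => ?_
    rw [← mul_sub]
    exact mul_le_mul_of_nonneg_left (hT_sub_hT_update_le f idx x i (y i)) (hprod idx)
  · exact Finset.sum_nonneg fun idx _ => mul_nonneg (hprod idx) (hT_nonneg f (k + 1) _ x)

variable [∀ i, MeasurableSpace (𝒳 i)]

lemma measurable_diffOp {f : (∀ i, 𝒳 i) → ℝ} (hf : Measurable f) (k : ℕ) :
    Measurable (diffOp f k) := by
  refine measurable_tOp.comp (measurable_pi_lambda _ fun idx => ?_)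
  unfold hT
  split_ifs
  · refine Measurable.iSup fun y => (Finset.measurable_fun_sum _ fun S _ =>
      (hf.comp (measurable_pi_lambda _ fun i => ?_)).const_mul _).abs
    split_ifs <;> fun_prop
  · exact measurable_const

end HigherDifferences

section Concentration

variable {n : ℕ} {𝒳 : Fin n → Type*} [∀ i, MeasurableSpace (𝒳 i)]

lemma lpN_nonneg {α : Type*} [MeasurableSpace α] (μ : Measure α) (p : ℝ) (g : α → ℝ) :
    0 ≤ lpN μ p g :=
  Real.rpow_nonneg (integral_nonneg fun _ => Real.rpow_nonneg (abs_nonneg _) _) _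

lemma lpN_sq {α : Type*} [MeasurableSpace α] (μ : Measure α) (p : ℝ) {g : α → ℝ}
    (hg : ∀ x, 0 ≤ g x) : lpN μ p g ^ 2 = (∫ x, g x ^ p ∂μ) ^ (2 / p) := by
  simp only [lpN, abs_of_nonneg (hg _)]
  rw [← Real.rpow_natCast, ← Real.rpow_mul
    (integral_nonneg fun x => Real.rpow_nonneg (hg x) p)]
  congr 1
  push_cast
  ring

variable [∀ i, Fintype (𝒳 i)] {μ : Measure (∀ i, 𝒳 i)} {ν : ∀ i, (∀ j, 𝒳 j) → Measure (𝒳 i)}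
  {σ2 : ℝ} {f : (∀ i, 𝒳 i) → ℝ} {p : ℝ}

lemma integral_sq_le_lpN_sq [IsProbabilityMeasure μ] {H : (∀ i, 𝒳 i) → ℝ} (hH : Measurable H)
    (hH0 : ∀ x, 0 ≤ H x) (hp : 2 ≤ p) : ∫ x, H x ^ 2 ∂μ ≤ lpN μ p H ^ 2 := by
  rw [lpN_sq μ p hH0]
  simpa using integral_rpow_rpow_le_of_le (μ := μ) hH hH0 zero_lt_two hp

lemma DLSI.lpN_diffOp_le [IsProbabilityMeasure μ] (hσ : 0 ≤ σ2) (h : DLSI μ ν σ2)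
    (hf : Measurable f) (k : ℕ) (hp : 2 ≤ p) :
    lpN μ p (diffOp f k) ≤ ∫ x, diffOp f k x ∂μ + √(σ2 * p) * lpN μ p (diffOp f (k + 1)) := by
  have hm := measurable_diffOp hf k
  have hm' := measurable_diffOp hf (k + 1)
  have h1 := h.integral_rpow_rpow_le hσ hm (diffOp_nonneg f k) hm' (diffOp_nonneg f (k + 1))
    (hasUpperGradient_diffOp f k) hp
  have h2 := h.integral_sq_sub_sq_integral_le hσ hm hm' (hasUpperGradient_diffOp f k)
  have h3 := mul_le_mul_of_nonneg_left
    (integral_sq_le_lpN_sq (μ := μ) hm' (diffOp_nonneg f (k + 1)) hp)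
    (show 0 ≤ 2 * σ2 by positivity)
  rw [← lpN_sq μ p (diffOp_nonneg f k), ← lpN_sq μ p (diffOp_nonneg f (k + 1))] at h1
  have ha : 0 ≤ ∫ x, diffOp f k x ∂μ := integral_nonneg (diffOp_nonneg f k)
  have hb := lpN_nonneg μ p (diffOp f (k + 1))
  have hs : √(σ2 * p) ^ 2 = σ2 * p := Real.sq_sqrt (by positivity)
  refine le_of_sq_le_sq ?_ (by positivity)
  have h4 : 0 ≤ (∫ x, diffOp f k x ∂μ) * (√(σ2 * p) * lpN μ p (diffOp f (k + 1))) := by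
    positivity
  rw [add_sq, mul_pow, hs]
  linarith

lemma DLSI.lpN_sub_integral_le [IsProbabilityMeasure μ] (hσ : 0 ≤ σ2) (h : DLSI μ ν σ2)
    (hf : Measurable f) (hp : 2 ≤ p) :
    lpN μ p (fun x => |f x - ∫ y, f y ∂μ|) ≤ √(σ2 * p) * lpN μ p (diffOp f 1) := by
  obtain ⟨C, hC⟩ := exists_abs_le_of_finite f
  set e := ∫ y, f y ∂μ with he
  have hm' := measurable_diffOp hf 1
  have hgrad : ∀ c, HasUpperGradient (fun x => |f x + c|) (diffOp f 1) := fun c => by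
    have h0 : diffOp (fun x => f x + c) 0 = fun x => |f x + c| := funext (diffOp_zero_order _)
    rw [← diffOp_add_const f c one_ne_zero, ← h0]
    exact hasUpperGradient_diffOp _ 0
  have hm : Measurable fun x => |f x - e| := (hf.sub_const e).abs
  have h1 := h.integral_rpow_rpow_le hσ hm (fun x => abs_nonneg _) hm' (diffOp_nonneg f 1)
    (hgrad (-e)) hp
  have hfC : ∀ x, |f x + C| = f x + C := fun x =>
    abs_of_nonneg (by linarith [neg_le_of_abs_le (hC x)])
  have h2 := h.integral_sq_sub_sq_integral_le hσ (hf.add_const C).abs hm' (hgrad C)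
  simp only [hfC] at h2
  rw [integral_add_const_sq_of_finite hf, integral_add_const_of_finite hf] at h2
  have h3 := mul_le_mul_of_nonneg_left
    (integral_sq_le_lpN_sq (μ := μ) hm' (diffOp_nonneg f 1) hp) (show 0 ≤ 2 * σ2 by positivity)
  have h4 := integral_add_const_sq_of_finite (μ := μ) hf (-e)
  simp only [← sub_eq_add_neg] at h4
  rw [← lpN_sq μ p (fun x => abs_nonneg _), ← lpN_sq μ p (diffOp_nonneg f 1)] at h1
  simp only [sq_abs] at h1
  have hb := lpN_nonneg μ p (diffOp f 1)
  have hs : √(σ2 * p) ^ 2 = σ2 * p := Real.sq_sqrt (by positivity)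
  refine le_of_sq_le_sq ?_ (by positivity)
  rw [mul_pow, hs]
  rw [← he] at h2 h4
  linarith

lemma mul_le_sum_of_le_add_mul {N a : ℕ → ℝ} {s : ℝ} (hs : 0 ≤ s)
    (h : ∀ k, N k ≤ a k + s * N (k + 1)) (m : ℕ) :
    s * N 1 ≤ ∑ k ∈ Finset.Icc 1 m, s ^ k * a k + s ^ (m + 1) * N (m + 1) := by
  induction m with
  | zero => simp
  | succ m ih =>
    rw [Finset.sum_Icc_succ_top (by omega)]
    have := mul_le_mul_of_nonneg_left (h (m + 1)) (pow_nonneg hs (m + 1))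
    rw [pow_succ s (m + 1)]
    linarith

lemma lpN_le_toReal_eLpNorm_top [IsProbabilityMeasure μ] {g : (∀ i, 𝒳 i) → ℝ}
    (hg : Measurable g) (hp : 0 < p) : lpN μ p g ≤ (eLpNorm g ⊤ μ).toReal := by
  have hfin : eLpNormEssSup g μ ≠ ⊤ := by
    rw [← eLpNorm_exponent_top]; exact (hg.memLp_of_finite ⊤).eLpNorm_ne_top
  rw [eLpNorm_exponent_top]
  have hae : ∀ᵐ x ∂μ, |g x| ^ p ≤ (eLpNormEssSup g μ).toReal ^ p := by
    filter_upwards [ae_le_eLpNormEssSup (f := g) (μ := μ)] with x hx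
    refine Real.rpow_le_rpow (abs_nonneg _) ?_ hp.le
    simpa using ENNReal.toReal_mono hfin hx
  have h1 := integral_mono_ae (hg.abs.pow_const p).integrable_of_finite (integrable_const _) hae
  simp only [integral_const, probReal_univ, smul_eq_mul, one_mul] at h1
  have h2 := Real.rpow_le_rpow
    (integral_nonneg fun x => Real.rpow_nonneg (abs_nonneg (g x)) p) h1
    (show 0 ≤ 1 / p by positivity)
  rwa [← Real.rpow_mul ENNReal.toReal_nonneg, mul_one_div_cancel hp.ne', Real.rpow_one] at h2

/-- Multilevel moment inequality under a `𝔡`-LSI. -/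
lemma DLSI.lpN_sub_integral_le_sum [IsProbabilityMeasure μ] (hσ : 0 ≤ σ2) (h : DLSI μ ν σ2)
    (hf : Measurable f) (hp : 2 ≤ p) {d : ℕ} (hd : 1 ≤ d) :
    lpN μ p (fun x => |f x - ∫ y, f y ∂μ|) ≤ ∑ k ∈ Finset.Icc 1 d, √(σ2 * p) ^ k *
      (if k = d then (eLpNorm (diffOp f d) ⊤ μ).toReal else ∫ x, diffOp f k x ∂μ) := by
  obtain ⟨m, rfl⟩ := Nat.exists_eq_add_of_le' hd
  have hs := Real.sqrt_nonneg (σ2 * p)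
  refine (h.lpN_sub_integral_le hσ hf hp).trans ((mul_le_sum_of_le_add_mul hs
    (N := fun k => lpN μ p (diffOp f k)) (fun k => h.lpN_diffOp_le hσ hf k hp) m).trans ?_)
  rw [Finset.sum_Icc_succ_top (by omega), if_pos rfl]
  refine add_le_add (Finset.sum_le_sum fun k hk => ?_) (mul_le_mul_of_nonneg_left
    (lpN_le_toReal_eLpNorm_top (measurable_diffOp hf _) (by linarith)) (pow_nonneg hs _))
  rw [if_neg (by have := Finset.mem_Icc.1 hk; omega)]

lemma measure_le_of_lpN_le [IsProbabilityMeasure μ] {Z : (∀ i, 𝒳 i) → ℝ} (hZ : Measurable Z)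
    (hZ0 : ∀ x, 0 ≤ Z x) {t θ : ℝ} (ht : 0 < t) (hθ : 0 ≤ θ) (hp : 0 < p)
    (h : lpN μ p Z ≤ t * θ) : μ {x | t ≤ Z x} ≤ ENNReal.ofReal (θ ^ p) := by
  have h1 := mul_meas_ge_le_integral_of_nonneg (μ := μ)
    (.of_forall fun x => Real.rpow_nonneg (hZ0 x) p) (hZ.pow_const p).integrable_of_finite (t ^ p)
  have h2 : {x | t ^ p ≤ Z x ^ p} = {x | t ≤ Z x} := by
    ext x; exact Real.rpow_le_rpow_iff ht.le (hZ0 x) hp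
  rw [h2] at h1
  have h3 := Real.rpow_le_rpow (lpN_nonneg μ p Z) h hp.le
  simp only [lpN, abs_of_nonneg (hZ0 _)] at h3
  rw [← Real.rpow_mul (integral_nonneg fun x => Real.rpow_nonneg (hZ0 x) p),
    one_div_mul_cancel hp.ne', Real.rpow_one, Real.mul_rpow ht.le hθ] at h3
  have h4 : μ.real {x | t ≤ Z x} ≤ θ ^ p :=
    le_of_mul_le_mul_left (h1.trans h3) (Real.rpow_pos_of_pos ht p)
  rw [← ENNReal.ofReal_toReal (measure_ne_top μ {x | t ≤ Z x})]
  exact ENNReal.ofReal_le_ofReal h4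

lemma exists_exponent_rpow_le_two_mul_exp {q : ℝ} (hq : Real.log 2 < q) :
    ∃ p, 2 ≤ p ∧ p ≤ 15 * q ∧ (p / (15 * q)) ^ (p / 2) ≤ 2 * Real.exp (-q) := by
  have hlog := Real.log_two_gt_d9
  have hexp : (0.36 : ℝ) ≤ Real.exp (-1) := by
    rw [Real.exp_neg, le_inv_comm₀ (by norm_num) (Real.exp_pos 1)]
    have := Real.exp_one_lt_d9
    norm_num
    linarith
  rcases le_total q 1 with h1 | h1
  · refine ⟨2, le_rfl, by linarith, ?_⟩
    rw [div_self two_ne_zero, Real.rpow_one, div_le_iff₀ (by linarith)]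
    have h2 : Real.exp (-1) ≤ Real.exp (-q) := Real.exp_le_exp.2 (by linarith)
    nlinarith
  · refine ⟨2 * q, by linarith, by linarith, ?_⟩
    rw [mul_div_mul_right _ _ (by linarith), mul_div_cancel_left₀ _ (two_ne_zero' ℝ),
      show -q = -1 * q by ring, Real.exp_mul]
    have h2 : (2 / 15 : ℝ) ^ q ≤ Real.exp (-1) ^ q :=
      Real.rpow_le_rpow (by norm_num) (by linarith) (by linarith)
    have h3 : 0 ≤ Real.exp (-1) ^ q := by positivity
    linarith

lemma sqrt_pow_mul_le_of_le_div_rpow {m t c : ℝ} {k : ℕ} (hk : k ≠ 0) (hm : 0 < m) (ht : 0 ≤ t)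
    (hc : 0 ≤ c) (h : m ≤ (t / c) ^ ((2 : ℝ) / k)) : √m ^ k * c ≤ t := by
  have hk' : (k : ℝ) ≠ 0 := Nat.cast_ne_zero.2 hk
  have hc0 : 0 < c := by
    refine hc.lt_of_ne' fun h0 => ?_
    rw [h0, div_zero, Real.zero_rpow (by positivity)] at h
    linarith
  rw [← le_div_iff₀ hc0]
  have h1 := Real.rpow_le_rpow hm.le h (show (0 : ℝ) ≤ k / 2 by positivity)
  rwa [← Real.rpow_mul (by positivity), show (2 : ℝ) / k * (k / 2) = 1 by field_simp,
    Real.rpow_one, show (k : ℝ) / 2 = 1 / 2 * k by ring, Real.rpow_mul hm.le,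
    ← Real.sqrt_eq_rpow, Real.rpow_natCast] at h1

end Concentration

/-- multilevel concentration under a `𝔡`-LSI on a finite product space
(Theorem 2 / `theorem:partialLSITails`). -/
theorem stmt2 {n : ℕ} {𝒳 : Fin n → Type*} [∀ i, MeasurableSpace (𝒳 i)] [∀ i, Fintype (𝒳 i)]
    (μ : Measure (∀ i, 𝒳 i)) (hμ : IsProbabilityMeasure μ)
    (ν : ∀ i, (∀ j, 𝒳 j) → Measure (𝒳 i)) (σ2 : ℝ) (hσ : 0 < σ2) (hLSI : DLSI μ ν σ2)
    (f : (∀ i, 𝒳 i) → ℝ) (hf : Measurable f) (hbd : ∃ M, ∀ x, |f x| ≤ M)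
    (d : ℕ) (hd : 1 ≤ d) (t : ℝ) (ht : 0 ≤ t) :
    μ {x | t ≤ |f x - ∫ y, f y ∂μ|} ≤
      ENNReal.ofReal (2 * Real.exp (-(1 / (15 * σ2 * (d : ℝ) ^ 2)) *
        (Finset.Icc 1 d).inf' ⟨d, Finset.mem_Icc.mpr ⟨hd, le_rfl⟩⟩ (fun k =>
          (t / (if k = d
            then (eLpNorm (fun x => tOp (fun idx : Fin d → Fin n => hT f d idx x)) ⊤ μ).toReal
            else ∫ x, tOp (fun idx : Fin k → Fin n => hT f k idx x) ∂μ)) ^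
              ((2 : ℝ) / k)))) := by
  let c : ℕ → ℝ := fun k => if k = d then (eLpNorm (diffOp f d) ⊤ μ).toReal
    else ∫ x, diffOp f k x ∂μ
  have hc : ∀ k, 0 ≤ c k := fun k => by
    simp only [c]
    split_ifs
    · exact ENNReal.toReal_nonneg
    · exact integral_nonneg (diffOp_nonneg f k)
  change _ ≤ ENNReal.ofReal (2 * Real.exp (-(1 / (15 * σ2 * (d : ℝ) ^ 2)) *
    (Finset.Icc 1 d).inf' ⟨d, Finset.mem_Icc.mpr ⟨hd, le_rfl⟩⟩
      (fun k => (t / c k) ^ ((2 : ℝ) / k))))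
  set m := (Finset.Icc 1 d).inf' ⟨d, Finset.mem_Icc.mpr ⟨hd, le_rfl⟩⟩
    (fun k => (t / c k) ^ ((2 : ℝ) / k)) with hm_def
  have hm_le : ∀ k ∈ Finset.Icc 1 d, m ≤ (t / c k) ^ ((2 : ℝ) / k) := fun k hk =>
    Finset.inf'_le _ hk
  have hd0 : (0 : ℝ) < d := by exact_mod_cast hd
  obtain ⟨q, hq_def⟩ : ∃ q, q = 1 / (15 * σ2 * (d : ℝ) ^ 2) * m := ⟨_, rfl⟩
  rw [neg_mul, ← hq_def]
  rcases le_or_gt q (Real.log 2) with hq | hq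
  · refine prob_le_one.trans ?_
    rw [← ENNReal.ofReal_one]
    refine ENNReal.ofReal_le_ofReal ?_
    have h1 : Real.exp (-Real.log 2) ≤ Real.exp (-q) := Real.exp_le_exp.2 (by linarith)
    rw [Real.exp_neg, Real.exp_log two_pos] at h1
    linarith
  obtain ⟨p, hp, hpq, hpexp⟩ := exists_exponent_rpow_le_two_mul_exp hq
  have hq0 : 0 < q := (Real.log_pos one_lt_two).trans hq
  have hmq : m = 15 * σ2 * (d : ℝ) ^ 2 * q := by rw [hq_def]; field_simp
  have hm : 0 < m := by rw [hmq]; positivity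
  have hlev : ∀ k ∈ Finset.Icc 1 d, √m ^ k * c k ≤ t := fun k hk =>
    sqrt_pow_mul_le_of_le_div_rpow (by have := Finset.mem_Icc.1 hk; omega) hm ht (hc k)
      (hm_le k hk)
  have ht0 : 0 < t := by
    refine ht.lt_of_ne' fun h0 => ?_
    have h1 := hm_le d (Finset.mem_Icc.2 ⟨hd, le_rfl⟩)
    rw [h0, zero_div, Real.zero_rpow (by positivity)] at h1
    linarith
  have hp0 : 0 < p := by linarith
  set θ := √(p / (15 * q)) with hθ_def
  have hθ1 : θ ≤ 1 := Real.sqrt_le_one.2 ((div_le_one (by positivity)).2 hpq)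
  have hθ0 : 0 ≤ θ := Real.sqrt_nonneg _
  have hd1 : (1 : ℝ) ≤ d := by exact_mod_cast hd
  have hr1 : θ / d ≤ 1 := (div_le_one hd0).2 (hθ1.trans hd1)
  have hs : √(σ2 * p) = θ / d * √m := by
    rw [← Real.sqrt_sq hd0.le, hθ_def, ← Real.sqrt_div' _ (by positivity),
      ← Real.sqrt_mul (by positivity), hmq]
    congr 1
    field_simp
  have hnorm : lpN μ p (fun x => |f x - ∫ y, f y ∂μ|) ≤ t * θ := by
    refine (hLSI.lpN_sub_integral_le_sum hσ.le hf hp hd).trans ?_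
    calc ∑ k ∈ Finset.Icc 1 d, √(σ2 * p) ^ k * c k ≤ ∑ k ∈ Finset.Icc 1 d, θ / d * t := by
          refine Finset.sum_le_sum fun k hk => ?_
          rw [hs, mul_pow, mul_assoc]
          exact mul_le_mul (pow_le_of_le_one (by positivity) hr1
            (by have := Finset.mem_Icc.1 hk; omega)) (hlev k hk)
            (mul_nonneg (by positivity) (hc k)) (by positivity)
      _ = t * θ := by
          simp only [Finset.sum_const, Nat.card_Icc, add_tsub_cancel_right, nsmul_eq_mul]
          field_simp
  refine (measure_le_of_lpN_le (hf.sub_const _).abs (fun x => abs_nonneg _) ht0 hθ0 hp0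
    hnorm).trans (ENNReal.ofReal_le_ofReal (le_of_eq_of_le ?_ hpexp))
  rw [hθ_def, Real.sqrt_eq_rpow, ← Real.rpow_mul (by positivity)]
  congr 1
  ring
end
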